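/- Let A = kQ/I be a non simply connected toupie algebra with dim_k e_0 A e_∞ = 0. Then the following are equivalent: (a) A is tilted; (b) A is quasitilted; (c) there is exactly one relation on each branch of Q. -/

import Mathlib

/-!
Formalization preamble for "Toupie algebras".

We realize the bound quiver algebra `A = kQ/I` of a toupie quiver `Q` concretely:
the path algebra `kQ` is realized, via its (faithful) left regular representation,
as the subalgebra of `Module.End k (paths → k)` generated by the operators of left
multiplication by the trivial paths `e_v` and by the arrows of `Q`.  Paths are
composed from left to right (`p * q` = "first `p`, then `q`"), as in
Assem–Simson–Skowroński, so that paths from the source `0` to the sink `∞` span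
`e₀ (kQ) e∞`, and (right) `A`-modules are identified with representations of `(Q, I)`.
Right `A`-modules are formalized as (left) modules over `Aᵐᵒᵖ`.
-/

set_option synthInstance.maxHeartbeats 400000
set_option maxHeartbeats 800000

noncomputable section
open scoped Classical
open MulOpposite

universe u

namespace Toupie

/-- Vertices of a toupie quiver with `t` branches, branch `i` having length `ℓ i ≥ 1`:
the unique source `src`, the unique sink `snk`, and for each branch `i` its interior
vertices `mid i a` (the `(a+1)`-st vertex on branch `i`, for `a : Fin (ℓ i - 1)`). -/
inductive Vtx (t : ℕ) (ℓ : Fin t → ℕ) : Type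
  | src : Vtx t ℓ
  | snk : Vtx t ℓ
  | mid (i : Fin t) (a : Fin (ℓ i - 1)) : Vtx t ℓ

/-- The `a`-th vertex on branch `i`, for `0 ≤ a ≤ ℓ i`
(`a = 0` is the source, `a = ℓ i` is the sink). -/
def vtx (t : ℕ) (ℓ : Fin t → ℕ) (i : Fin t) (a : ℕ) : Vtx t ℓ :=
  if a = 0 then .src else if h : a - 1 < ℓ i - 1 then .mid i ⟨a - 1, h⟩ else .snk

/-- The paths of a toupie quiver: trivial paths at the vertices, and for each branch
`i` and `a < b ≤ ℓ i` the path `sub i a b` along branch `i` from its `a`-th vertex to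
its `b`-th vertex.  (`sub i 0 (ℓ i)` is the `i`-th branch `w i`.) -/
inductive PIdx (t : ℕ) (ℓ : Fin t → ℕ) : Type
  | vert (v : Vtx t ℓ) : PIdx t ℓ
  | sub (i : Fin t) (a b : ℕ) (hab : a < b) (hb : b ≤ ℓ i) : PIdx t ℓ

variable (k : Type u) [Field k] (t : ℕ) (ℓ : Fin t → ℕ)

/-- The vector space with basis the set of paths of the toupie quiver. -/
abbrev PSp : Type u := PIdx t ℓ → k

variable {t ℓ}

/-- The starting vertex of a path. -/
def startIdx : PIdx t ℓ → Vtx t ℓ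
  | .vert v => v
  | .sub i a _ _ _ => vtx t ℓ i a

/-- Left multiplication by the trivial path (primitive idempotent) `e_v`. -/
def Ev (v : Vtx t ℓ) : Module.End k (PSp k t ℓ) where
  toFun f := fun p => if startIdx p = v then f p else 0
  map_add' f g := by funext p; by_cases h : startIdx p = v <;> simp [h]
  map_smul' c f := by funext p; by_cases h : startIdx p = v <;> simp [h]

/-- Strip the `j`-th arrow of branch `i` (the arrow `vtx i j ⟶ vtx i (j+1)`) from the
front of a path, if possible. -/
def strip (i : Fin t) (j : ℕ) : PIdx t ℓ → Option (PIdx t ℓ)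
  | .vert _ => none
  | .sub i' a b _ hb =>
      if h : i' = i ∧ a = j then
        if hb2 : j + 1 < b then some (.sub i (j + 1) b hb2 (h.1 ▸ hb))
        else some (.vert (vtx t ℓ i b))
      else none

/-- Left multiplication by the `j`-th arrow of branch `i`
(the arrow from `vtx i j` to `vtx i (j+1)`, for `j < ℓ i`; the zero operator for junk `j`). -/
def Ar (i : Fin t) (j : ℕ) : Module.End k (PSp k t ℓ) where
  toFun f := fun p => (strip i j p).elim 0 f
  map_add' f g := by funext p; rcases h : strip i j p with _ | q <;> simp [h]
  map_smul' c f := by funext p; rcases h : strip i j p with _ | q <;> simp [h]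

variable (t ℓ)

/-- The generators of the path algebra: the trivial paths and the arrows. -/
def gens : Set (Module.End k (PSp k t ℓ)) :=
  Set.range (Ev k) ∪ {x | ∃ i j, x = Ar k i j}

/-- The path algebra `kQ` of the toupie quiver, realized as the subalgebra of
`Module.End k (PSp k t ℓ)` generated by left multiplication by trivial paths and arrows. -/
def PathAlg : Subalgebra k (Module.End k (PSp k t ℓ)) :=
  Algebra.adjoin k (gens k t ℓ)

variable {k t ℓ}

/-- The trivial path `e_v` as an element of the path algebra. -/
def eV (v : Vtx t ℓ) : PathAlg k t ℓ :=
  ⟨Ev k v, Algebra.subset_adjoin (Or.inl ⟨v, rfl⟩)⟩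

/-- The `j`-th arrow of branch `i` as an element of the path algebra. -/
def arE (i : Fin t) (j : ℕ) : PathAlg k t ℓ :=
  ⟨Ar k i j, Algebra.subset_adjoin (Or.inr ⟨i, j, rfl⟩)⟩

/-- The path along branch `i` from its `a`-th vertex to its `b`-th vertex, as an element
of the path algebra: the product (composed from left to right) of the arrows
`a → a+1 → ⋯ → b`.  (For `b ≤ a` this is the empty product `1`.) -/
def subE (i : Fin t) (a b : ℕ) : PathAlg k t ℓ :=
  (((List.range (b - a)).map fun s => arE i (a + s)).prod)

/-- The `i`-th branch `w i` (the path from the source to the sink along branch `i`)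
as an element of the path algebra. -/
def wE (i : Fin t) : PathAlg k t ℓ := subE i 0 (ℓ i)

variable {k : Type u} [Field k]

/-- A toupie algebra `A = kQ/I`: a toupie quiver `Q` (a non-linear quiver with a unique
source, a unique sink, and all other vertices having exactly one incoming and one
outgoing arrow, i.e. `t ≥ 2` branches of lengths `ℓ i ≥ 1`), together with an admissible
ideal `I` of the path algebra `kQ`.  Since `Q` is finite and acyclic, the arrow ideal is
nilpotent, so admissibility amounts to `I ⊆ R_Q²`, i.e. every element of `I` is a linear
combination of paths of length `≥ 2`. -/
structure ToupieAlg (k : Type u) [Field k] : Type u where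
  t : ℕ
  ht : 2 ≤ t
  ℓ : Fin t → ℕ
  hℓ : ∀ i, 1 ≤ ℓ i
  I : TwoSidedIdeal (PathAlg k t ℓ)
  adm : ∀ x ∈ I, x ∈ Submodule.span k
    {y : PathAlg k t ℓ | ∃ i a b, a + 2 ≤ b ∧ b ≤ ℓ i ∧ y = subE i a b}

variable (T : ToupieAlg k)

/-- The underlying algebra `A = kQ/I` of a toupie algebra. -/
def Alg : Type u := T.I.ringCon.Quotient

instance : Ring (Alg T) := inferInstanceAs (Ring T.I.ringCon.Quotient)

/-- The quotient map `kQ → A = kQ/I`. -/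
def mkA : PathAlg k T.t T.ℓ →+* Alg T := T.I.ringCon.mk'

lemma mkA_surjective : Function.Surjective (mkA T) := Quotient.mk''_surjective

instance : Algebra k (Alg T) :=
  RingHom.toAlgebra' ((mkA T).comp (algebraMap k (PathAlg k T.t T.ℓ)))
    (by
      intro c x
      obtain ⟨y, rfl⟩ := mkA_surjective T x
      simp only [RingHom.coe_comp, Function.comp_apply, ← map_mul]
      rw [Algebra.commutes])

/-- The idempotent `e₀` (at the source) in `A`. -/
def e0 : Alg T := mkA T (eV Vtx.src)

/-- The idempotent `e∞` (at the sink) in `A`. -/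
def einf : Alg T := mkA T (eV Vtx.snk)

/-- The `k`-linear map `A → A`, `x ↦ e₀ * x * e∞`, whose range is `e₀ A e∞`. -/
def lrMap : Alg T →ₗ[k] Alg T where
  toFun x := e0 T * x * einf T
  map_add' x y := by simp [mul_add, add_mul]
  map_smul' c x := by
    simp only [RingHom.id_apply]
    rw [mul_smul_comm, smul_mul_assoc]

/-- `m = dim_k e₀ A e∞`, the dimension of the span of the (residues of the) paths from
the source to the sink. -/
def mDim : ℕ := Module.finrank k ↥(LinearMap.range (lrMap T))

/-- The branch `w i` lies in the ideal `I`. -/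
def branchInI (i : Fin T.t) : Prop := wE i ∈ T.I

/-- A minimal relation: `∑_{i ∈ J} λ i • w i ∈ I` with `|J| ≥ 2`, all `λ i ≠ 0`, and no
nonempty proper subsum in `I`. -/
def MinRel (J : Finset (Fin T.t)) (lam : Fin T.t → k) : Prop :=
  2 ≤ J.card ∧ (∀ i ∈ J, lam i ≠ 0) ∧ (∑ i ∈ J, lam i • wE i) ∈ T.I ∧
    ∀ J' ⊂ J, J'.Nonempty → (∑ i ∈ J', lam i • wE i) ∉ T.I

/-- A toupie algebra is simply connected if any two distinct branches are involved in a
common minimal relation. -/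
def SimplyConnected : Prop :=
  ∀ i j : Fin T.t, i ≠ j → ∃ J lam, MinRel T J lam ∧ i ∈ J ∧ j ∈ J

/-- A (minimal) zero-relation on branch `i`: the subpath of branch `i` from its `a`-th
to its `b`-th vertex lies in `I`, but no proper subpath of it does. -/
def ZeroRel (i : Fin T.t) (a b : ℕ) : Prop :=
  a < b ∧ b ≤ T.ℓ i ∧ subE i a b ∈ T.I ∧
    ∀ a' b', a ≤ a' → b' ≤ b → a' < b' → (a', b') ≠ (a, b) → subE i a' b' ∉ T.I

/-- There is exactly one relation on branch `i`. -/
def ExactlyOneRel (i : Fin T.t) : Prop := ∃! p : ℕ × ℕ, ZeroRel T i p.1 p.2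

/-- Branch `i` carries more than one relation. -/
def MoreThanOneRel (i : Fin T.t) : Prop :=
  ∃ p q : ℕ × ℕ, p ≠ q ∧ ZeroRel T i p.1 p.2 ∧ ZeroRel T i q.1 q.2

/-- At most one branch of `Q` has length at least three. -/
def AtMostOneLongBranch : Prop := ∀ i j : Fin T.t, 3 ≤ T.ℓ i → 3 ≤ T.ℓ j → i = j

/-- The two-sided ideal `I` is generated by the set `S`. -/
def IsGenBy {R : Type u} [Ring R] (I : TwoSidedIdeal R) (S : Set R) : Prop :=
  S ⊆ (I : Set R) ∧ ∀ J : TwoSidedIdeal R, S ⊆ (J : Set R) → (I : Set R) ⊆ (J : Set R)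

/-- A toupie algebra is canonical if (after choosing two distinguished branches `i₁, i₂`)
its ideal is generated by `{w i₁ + λ j • w i₂ - w j}` over the remaining branches `j`,
with the `λ j` pairwise distinct and nonzero. -/
def IsCanonical : Prop :=
  ∃ (i₁ i₂ : Fin T.t) (lam : Fin T.t → k), i₁ ≠ i₂ ∧
    (∀ j, j ≠ i₁ → j ≠ i₂ → lam j ≠ 0) ∧
    (∀ j j', j ≠ i₁ → j ≠ i₂ → j' ≠ i₁ → j' ≠ i₂ → j ≠ j' → lam j ≠ lam j') ∧
    IsGenBy T.I {x | ∃ j, j ≠ i₁ ∧ j ≠ i₂ ∧ x = wE i₁ + lam j • wE i₂ - wE j}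

end Toupie
namespace Toupie

/-! ### Module-theoretic notions over an arbitrary ring

Following the paper, all modules are finite-dimensional *right* modules; a right
`A`-module is formalized as a (left) module over `Aᵐᵒᵖ`.  The definitions below are
stated for modules over an arbitrary ring `R` and are applied with `R := Aᵐᵒᵖ`. -/

variable (R : Type u) [Ring R]

/-- A module is indecomposable if it is nonzero and its only idempotent endomorphisms
are `0` and the identity. -/
def Indec (M : ModuleCat.{u} R) : Prop :=
  Nontrivial M ∧ ∀ f : M →ₗ[R] M, f.comp f = f → f = 0 ∨ f = LinearMap.id

/-- Finiteness ("finite dimensionality") of a module. -/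
def FdMod (M : ModuleCat.{u} R) : Prop := Module.Finite R M

/-- `M` has projective dimension at most one: it is the quotient of a projective module
by a projective submodule. -/
def PdLeOne (M : ModuleCat.{u} R) : Prop :=
  ∃ (P : ModuleCat.{u} R) (f : P →ₗ[R] M), Function.Surjective f ∧
    Module.Projective R P ∧ Module.Projective R ↥(LinearMap.ker f)

/-- `M` has injective dimension at most one: it embeds in an injective module with
injective cokernel. -/
def IdLeOne (M : ModuleCat.{u} R) : Prop :=
  ∃ (E : ModuleCat.{u} R) (f : M →ₗ[R] E), Function.Injective f ∧
    Module.Injective R E ∧ Module.Injective R (E ⧸ LinearMap.range f)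

/-- One step of a path in `ind R`: a nonzero non-isomorphism between (finite-dimensional)
indecomposable modules. -/
def Step (M N : ModuleCat.{u} R) : Prop :=
  Indec R M ∧ FdMod R M ∧ Indec R N ∧ FdMod R N ∧
    ∃ f : M →ₗ[R] N, f ≠ 0 ∧ ¬ Function.Bijective f

/-- A path in `ind R` from `M` to `N` (possibly trivial): a chain
`M = M₀ → M₁ → ⋯ → Mₙ = N` of nonzero non-isomorphisms between indecomposables. -/
def IndPath (M N : ModuleCat.{u} R) : Prop := Relation.ReflTransGen (Step R) M N

/-- The left part `L_R`: the indecomposable (finite-dimensional) modules `M` such that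
every indecomposable `X` with a path `X ⇝ M` in `ind R` has projective dimension `≤ 1`. -/
def InLeftPart (M : ModuleCat.{u} R) : Prop :=
  Indec R M ∧ FdMod R M ∧
    ∀ X : ModuleCat.{u} R, Indec R X → FdMod R X → IndPath R X M → PdLeOne R X

/-- The right part `R_R`: the indecomposable (finite-dimensional) modules `M` such that
every indecomposable `X` with a path `M ⇝ X` in `ind R` has injective dimension `≤ 1`. -/
def InRightPart (M : ModuleCat.{u} R) : Prop :=
  Indec R M ∧ FdMod R M ∧
    ∀ X : ModuleCat.{u} R, Indec R X → FdMod R X → IndPath R M X → IdLeOne R X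

/-- Hereditary: global dimension at most one, i.e. every module has projective dimension
at most one. -/
def Hereditary : Prop := ∀ M : ModuleCat.{u} R, PdLeOne R M

/-- Quasitilted: every indecomposable projective module lies in the left part. -/
def Quasitilted : Prop :=
  ∀ P : ModuleCat.{u} R, Indec R P → FdMod R P → Module.Projective R P → InLeftPart R P

/-- A module is directed if it lies on no cycle of nonzero non-isomorphisms between
indecomposables in `ind R`. -/
def Directed (M : ModuleCat.{u} R) : Prop := ¬ Relation.TransGen (Step R) M M

/-- Weakly shod: every indecomposable (finite-dimensional) module not lying in
`L_R ∪ R_R` is directed. -/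
def WeaklyShod : Prop :=
  ∀ M : ModuleCat.{u} R, Indec R M → FdMod R M →
    ¬ InLeftPart R M → ¬ InRightPart R M → Directed R M

/-- Laura: all but finitely many isomorphism classes of indecomposable
(finite-dimensional) modules lie in `L_R ∪ R_R`. -/
def Laura : Prop :=
  ∃ S : Set (ModuleCat.{u} R), S.Finite ∧
    ∀ M : ModuleCat.{u} R, Indec R M → FdMod R M →
      ¬ InLeftPart R M → ¬ InRightPart R M → ∃ N ∈ S, Nonempty (M ≃ₗ[R] N)

/-- There are exactly `n` isomorphism classes of modules satisfying `P`. -/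
def NumClasses (P : ModuleCat.{u} R → Prop) (n : ℕ) : Prop :=
  ∃ f : Fin n → ModuleCat.{u} R, (∀ i, P (f i)) ∧
    (∀ i j, Nonempty ((f i : Type u) ≃ₗ[R] (f j : Type u)) → i = j) ∧
    ∀ M : ModuleCat.{u} R, P M → ∃ i, Nonempty ((M : Type u) ≃ₗ[R] (f i : Type u))

/-- `M` is (isomorphic to) a direct summand of `T`. -/
def IsSummandOf (T : Type u) [AddCommGroup T] [Module R T] (M : ModuleCat.{u} R) : Prop :=
  ∃ N N' : Submodule R T, IsCompl N N' ∧ Nonempty ((M : Type u) ≃ₗ[R] N)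

/-- `Ext¹_R(T, T) = 0`: every self-extension `0 → T → E → T → 0` splits. -/
def SelfExtVanish (T : Type u) [AddCommGroup T] [Module R T] : Prop :=
  ∀ (E : Type u) [AddCommGroup E] [Module R E] (ι : T →ₗ[R] E) (π : E →ₗ[R] T),
    Function.Injective ι → Function.Surjective π → LinearMap.range ι = LinearMap.ker π →
      ∃ s : T →ₗ[R] E, π.comp s = LinearMap.id

/-- A tilting module over a hereditary algebra: a finite module with `Ext¹(T,T) = 0`
having as many pairwise non-isomorphic indecomposable direct summands as there are
simple modules. -/
def IsTiltingMod (T : Type u) [AddCommGroup T] [Module R T] : Prop :=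
  Module.Finite R T ∧ SelfExtVanish R T ∧
    ∃ n : ℕ, NumClasses R (fun M => Indec R M ∧ IsSummandOf R T M) n ∧
      NumClasses R (fun M => IsSimpleModule R M) n

variable (k : Type u) [Field k]

/-- A `k`-algebra `A` is tilted if it is the endomorphism algebra of a tilting (right)
module over a hereditary finite-dimensional `k`-algebra `H`.  (Right `H`-modules are
modules over `Hᵐᵒᵖ`; the isomorphism `A ≅ End_H T` is a `k`-linear ring isomorphism.) -/
def IsTilted (A : Type u) [Ring A] [Algebra k A] : Prop :=
  ∃ (H : Type u) (_ : Ring H) (_ : Algebra k H),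
    FiniteDimensional k H ∧ Hereditary Hᵐᵒᵖ ∧
      ∃ (T : Type u) (_ : AddCommGroup T) (_ : Module Hᵐᵒᵖ T),
        IsTiltingMod Hᵐᵒᵖ T ∧
          ∃ (_ : Module k T) (_ : SMulCommClass Hᵐᵒᵖ k T) (_ : IsScalarTower k Hᵐᵒᵖ T)
            (φ : A ≃+* Module.End Hᵐᵒᵖ T), ∀ (c : k) (x : A), φ (c • x) = c • φ x

end Toupie
namespace Toupie

variable {k : Type u} [Field k] (T : ToupieAlg k)

/-! ### Right `A`-modules as representations of `(Q, I)`

For a right `A`-module `M` (a module over `Aᵐᵒᵖ`) and a vertex `v`, the space of the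
corresponding representation at `v` is `M_v = M • e_v`. -/

/-- The action of the idempotent `e_v ∈ A` on a right `A`-module (= `Aᵐᵒᵖ`-module). -/
def actV (v : Vtx T.t T.ℓ) : (Alg T)ᵐᵒᵖ := op (mkA T (eV v))

/-- The space `M_v = M • e_v` of the representation `M` at the vertex `v` is zero. -/
def VanishAt (M : ModuleCat.{u} (Alg T)ᵐᵒᵖ) (v : Vtx T.t T.ℓ) : Prop :=
  ∀ m : M, actV T v • m = 0

/-- Every simple summand of `top M = M / rad M` is one of the simple modules `S_v`,
`v ∈ vs`: for every maximal submodule `N` the simple quotient `M/N` is supported at some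
vertex of `vs` (for an admissible quotient of a path algebra, the simple module `S_v` is
the unique simple on which `e_v` acts nontrivially). -/
def TopIn (M : ModuleCat.{u} (Alg T)ᵐᵒᵖ) (vs : Set (Vtx T.t T.ℓ)) : Prop :=
  ∀ N : Submodule (Alg T)ᵐᵒᵖ M, IsCoatom N → ∃ v ∈ vs, ∃ m : M, actV T v • m ∉ N

/-- Every simple summand of the socle of `M` is one of the simple modules `S_v`,
`v ∈ vs`: every simple submodule `N ≤ M` is supported at some vertex of `vs`. -/
def SocIn (M : ModuleCat.{u} (Alg T)ᵐᵒᵖ) (vs : Set (Vtx T.t T.ℓ)) : Prop :=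
  ∀ N : Submodule (Alg T)ᵐᵒᵖ M, IsAtom N → ∃ v ∈ vs, ∃ m ∈ N, actV T v • m ≠ 0

/-- The module `D x y` (for two positions `0 ≤ x, y ≤ ℓ i₀` on the unique branch `i₀`
lying in `I`, and an auxiliary branch `i₂ ≠ i₀`): the right `A`-module with generators
`g = e₀` (at the source) and `h = e_y` (at the `y`-th vertex of branch `i₀`), subject to
the relations `g ⬝ (subpath of w i₀ from 0 to x+1) = 0` and
`g ⬝ w i₂ = h ⬝ (subpath of w i₀ from y to ℓ i₀)`.  It is presented as the quotient of
the right regular module `A ⊕ A` by the right submodule generated by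
`(1 - e₀, 0)`, `(0, 1 - e_y)`, `(subE i₀ 0 (min (x+1) (ℓ i₀)), 0)` and
`(w i₂, - subE i₀ y (ℓ i₀))`. -/
abbrev Dmod (i₀ i₂ : Fin T.t) (x y : ℕ) : Type u :=
  (Alg T × Alg T) ⧸ Submodule.span (Alg T)ᵐᵒᵖ
    ({((mkA T (1 - eV Vtx.src) : Alg T), (0 : Alg T)),
      ((0 : Alg T), (mkA T (1 - eV (vtx T.t T.ℓ i₀ y)) : Alg T)),
      ((mkA T (subE i₀ 0 (min (x + 1) (T.ℓ i₀))) : Alg T), (0 : Alg T)),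
      ((mkA T (wE i₂) : Alg T), (- mkA T (subE i₀ y (T.ℓ i₀)) : Alg T))} :
        Set (Alg T × Alg T))

end Toupie

namespace Toupie

section ModuleTheory

variable {R : Type u} [Ring R]

/-- Every extension of `Y` by `X` splits. -/
def ExtZero (R : Type u) [Ring R] (Y X : Type u) [AddCommGroup Y] [Module R Y]
    [AddCommGroup X] [Module R X] : Prop :=
  ∀ (E : Type u) [AddCommGroup E] [Module R E] (ι : X →ₗ[R] E) (π : E →ₗ[R] Y),
    Function.Injective ι → Function.Surjective π → LinearMap.range ι = LinearMap.ker π →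
      ∃ s : Y →ₗ[R] E, π.comp s = LinearMap.id

lemma exists_retraction_of_section {X E Y : Type u} [AddCommGroup X] [Module R X]
    [AddCommGroup E] [Module R E] [AddCommGroup Y] [Module R Y]
    (ι : X →ₗ[R] E) (π : E →ₗ[R] Y) (hι : Function.Injective ι)
    (h : LinearMap.range ι = LinearMap.ker π) (s : Y →ₗ[R] E) (hs : π.comp s = LinearMap.id) :
    ∃ r : E →ₗ[R] X, r.comp ι = LinearMap.id := by
  have hs' : ∀ y, π (s y) = y := fun y => LinearMap.congr_fun hs y
  have hmem : ∀ e : E, e - s (π e) ∈ LinearMap.range ι := by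
    intro e
    rw [h, LinearMap.mem_ker, map_sub, hs', sub_self]
  refine ⟨(LinearEquiv.ofInjective ι hι).symm.toLinearMap.comp
    (LinearMap.codRestrict _ (LinearMap.id - s.comp π) hmem), ?_⟩
  ext x
  apply hι
  have hx : π (ι x) = 0 := by
    rw [← LinearMap.mem_ker, ← h]
    exact ⟨x, rfl⟩
  have : ∀ z : LinearMap.range ι, ι ((LinearEquiv.ofInjective ι hι).symm z) = z := by
    intro z
    have := (LinearEquiv.ofInjective ι hι).apply_symm_apply z
    exact congrArg Subtype.val this
  simp [this, hx]

lemma pdLeOne_of_projective {P : Type u} [AddCommGroup P] [Module R P] [Module.Projective R P] :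
    PdLeOne R (.of R P) := by
  refine ⟨.of R P, LinearMap.id, Function.surjective_id, ‹_›, ?_⟩
  rw [LinearMap.ker_id]
  infer_instance

lemma pdLeOne_congr {M N : Type u} [AddCommGroup M] [Module R M] [AddCommGroup N] [Module R N]
    (e : M ≃ₗ[R] N) (h : PdLeOne R (.of R M)) : PdLeOne R (.of R N) := by
  obtain ⟨P, f, hf, hP, hK⟩ := h
  refine ⟨P, e.toLinearMap.comp f, e.surjective.comp hf, hP, ?_⟩
  have : LinearMap.ker (e.toLinearMap.comp f) = LinearMap.ker f := by
    ext x; simp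
  rw [this]
  exact hK

/-- Modules of projective dimension at most one are closed under extensions. -/
lemma pdLeOne_of_submodule {M : Type u} [AddCommGroup M] [Module R M] (N : Submodule R M)
    (h₁ : PdLeOne R (.of R N)) (h₂ : PdLeOne R (.of R (M ⧸ N))) : PdLeOne R (.of R M) := by
  obtain ⟨P₁, f₁, hf₁, hP₁, hK₁⟩ := h₁
  obtain ⟨P₂, f₂, hf₂, hP₂, hK₂⟩ := h₂
  change P₁ →ₗ[R] N at f₁
  change P₂ →ₗ[R] (M ⧸ N) at f₂
  obtain ⟨g, hg⟩ := Module.projective_lifting_property N.mkQ f₂ N.mkQ_surjective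
  have hg' : ∀ y, N.mkQ (g y) = f₂ y := fun y => LinearMap.congr_fun hg y
  have hgN : ∀ y : LinearMap.ker f₂, g y ∈ N := by
    intro y
    have := hg' y
    rw [LinearMap.mem_ker.1 y.2] at this
    simpa using this
  obtain ⟨h, hh⟩ := Module.projective_lifting_property f₁
    (LinearMap.codRestrict N (g.comp (LinearMap.ker f₂).subtype) hgN) hf₁
  have hh' : ∀ y : LinearMap.ker f₂, (f₁ (h y) : M) = g y := fun y =>
    congrArg Subtype.val (LinearMap.congr_fun hh y)
  let F : (P₁ × P₂) →ₗ[R] M := LinearMap.coprod (N.subtype.comp f₁) g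
  have hF : ∀ x y, F (x, y) = f₁ x + g y := fun x y => by simp [F]
  have hFker : ∀ z ∈ LinearMap.ker F, z.2 ∈ LinearMap.ker f₂ := by
    rintro ⟨x, y⟩ hz
    rw [LinearMap.mem_ker, hF] at hz
    rw [LinearMap.mem_ker, ← hg', eq_neg_of_add_eq_zero_right hz]
    simp
  refine ⟨.of R (P₁ × P₂), F, ?_, inferInstanceAs (Module.Projective R (P₁ × P₂)), ?_⟩
  · intro m
    obtain ⟨y, hy⟩ := hf₂ (N.mkQ m)
    have : m - g y ∈ N := by
      rw [← Submodule.ker_mkQ N, LinearMap.mem_ker, map_sub, hg', hy, sub_self]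
    obtain ⟨x, hx⟩ := hf₁ ⟨_, this⟩
    exact ⟨(x, y), by rw [hF, hx]; simp⟩
  · let i : LinearMap.ker F →ₗ[R] (LinearMap.ker f₁ × LinearMap.ker f₂) :=
      LinearMap.prod
        (LinearMap.codRestrict _
          ((LinearMap.fst R P₁ P₂).comp (LinearMap.ker F).subtype +
            h.comp (LinearMap.codRestrict _
              ((LinearMap.snd R P₁ P₂).comp (LinearMap.ker F).subtype)
              (fun z => hFker z.1 z.2))) (by
            rintro ⟨⟨x, y⟩, hz⟩
            rw [LinearMap.mem_ker]
            apply Subtype.ext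
            have h2 := hh' ⟨y, hFker _ hz⟩
            rw [LinearMap.mem_ker, hF] at hz
            simp only [LinearMap.add_apply, LinearMap.comp_apply, map_add, Submodule.coe_add]
            refine Eq.trans ?_ hz
            congr 1))
        (LinearMap.codRestrict _
          ((LinearMap.snd R P₁ P₂).comp (LinearMap.ker F).subtype) (fun z => hFker z.1 z.2))
    let j : (LinearMap.ker f₁ × LinearMap.ker f₂) →ₗ[R] LinearMap.ker F :=
      LinearMap.codRestrict _
        (LinearMap.prod
          ((LinearMap.ker f₁).subtype.comp (LinearMap.fst R _ _) -
            h.comp (LinearMap.snd R _ _))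
          ((LinearMap.ker f₂).subtype.comp (LinearMap.snd R _ _))) (by
            rintro ⟨x, y⟩
            have h2 := hh' y
            rw [LinearMap.mem_ker]
            have : F (x.1 - h y, y.1) = 0 := by
              rw [hF, map_sub, LinearMap.mem_ker.1 x.2]
              simp [h2]
            exact this)
    have hji : j.comp i = LinearMap.id := by
      ext z <;> simp [i, j]
      have : ∀ (a b : LinearMap.ker f₂), a = b → h a = h b := fun a b hab => by rw [hab]
      rfl
    exact Module.Projective.of_split i j hji

/-- Splitting of all extensions by `X` is closed under extensions. -/
lemma extZero_of_submodule {M X : Type u} [AddCommGroup M] [Module R M] [AddCommGroup X]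
    [Module R X] (N : Submodule R M)
    (h₁ : ExtZero R N X) (h₂ : ExtZero R (M ⧸ N) X) : ExtZero R M X := by
  intro E _ _ ι π hι hπ hex
  have hπι : ∀ x, π (ι x) = 0 := fun x => by
    rw [← LinearMap.mem_ker, ← hex]; exact ⟨x, rfl⟩
  let E₁ : Submodule R E := N.comap π
  let ι₁ : X →ₗ[R] E₁ := LinearMap.codRestrict _ ι (fun x => by simp [E₁, hπι])
  let π₁ : E₁ →ₗ[R] N := LinearMap.restrict π (fun x hx => hx)
  obtain ⟨s₁, hs₁⟩ := h₁ E₁ ι₁ π₁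
    (fun x y hxy => hι (congrArg Subtype.val hxy))
    (fun n => by
      obtain ⟨e, he⟩ := hπ n
      exact ⟨⟨e, by simp [E₁, he]⟩, Subtype.ext he⟩)
    (by
      ext ⟨e, he⟩
      have : e ∈ LinearMap.range ι ↔ e ∈ LinearMap.ker π := by rw [hex]
      simp only [LinearMap.mem_range, LinearMap.mem_ker] at this ⊢
      constructor
      · rintro ⟨x, hx⟩
        exact Subtype.ext (this.1 ⟨x, congrArg Subtype.val hx⟩)
      · intro h
        obtain ⟨x, hx⟩ := this.2 (congrArg Subtype.val h)
        exact ⟨x, Subtype.ext hx⟩)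
  have hs₁' : ∀ n, π (s₁ n) = n := fun n => congrArg Subtype.val (LinearMap.congr_fun hs₁ n)
  let D : Submodule R E := LinearMap.range (E₁.subtype.comp s₁)
  have hDN : D ≤ N.comap π := by
    rintro _ ⟨n, rfl⟩
    exact (s₁ n).2
  let π₂ : (E ⧸ D) →ₗ[R] (M ⧸ N) := Submodule.mapQ D N π hDN
  obtain ⟨s₂, hs₂⟩ := h₂ (E ⧸ D) (D.mkQ.comp ι) π₂
    (by
      rw [← LinearMap.ker_eq_bot, LinearMap.ker_eq_bot']
      intro x hx
      have hx' : ι x ∈ D := by simpa using hx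
      obtain ⟨n, hn⟩ := hx'
      have : π (s₁ n) = 0 := by
        have := congrArg π hn
        rw [hπι] at this
        exact this
      rw [hs₁'] at this
      have hn0 : n = 0 := Subtype.ext this
      rw [hn0, map_zero] at hn
      exact hι (by rw [← hn, map_zero]))
    (by
      intro z
      obtain ⟨m, rfl⟩ := N.mkQ_surjective z
      obtain ⟨e, rfl⟩ := hπ m
      exact ⟨D.mkQ e, rfl⟩)
    (by
      ext z
      obtain ⟨e, rfl⟩ := D.mkQ_surjective z
      simp only [LinearMap.mem_range, LinearMap.mem_ker, LinearMap.comp_apply]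
      constructor
      · rintro ⟨x, hx⟩
        rw [← hx]
        change N.mkQ (π (ι x)) = 0
        rw [hπι, map_zero]
      · intro h
        have h' : N.mkQ (π e) = 0 := h
        have h'' : π e ∈ N := by simpa using h'
        have : e - s₁ ⟨π e, h''⟩ ∈ LinearMap.range ι := by
          rw [hex, LinearMap.mem_ker, map_sub, hs₁', sub_self]
        obtain ⟨x, hx⟩ := this
        refine ⟨x, ?_⟩
        rw [hx, map_sub]
        have : D.mkQ (s₁ ⟨π e, h''⟩ : E) = 0 := by
          rw [Submodule.mkQ_apply, Submodule.Quotient.mk_eq_zero]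
          exact ⟨_, rfl⟩
        rw [this, sub_zero])
  let Φ : E →ₗ[R] (E ⧸ D) × M := D.mkQ.prod π
  have hΦ : Function.Injective Φ := by
    rw [← LinearMap.ker_eq_bot, LinearMap.ker_eq_bot']
    intro e he
    have h1 : D.mkQ e = 0 := congrArg Prod.fst he
    have h2 : π e = 0 := congrArg Prod.snd he
    have h3 : e ∈ D := by simpa using h1
    obtain ⟨n, hn⟩ := h3
    have h4 : π (s₁ n) = 0 := by rw [← h2, ← hn]; rfl
    rw [hs₁'] at h4
    have hn0 : n = 0 := Subtype.ext h4
    rw [← hn, hn0, map_zero]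
  have hmem : ∀ m, (s₂.comp N.mkQ).prod LinearMap.id m ∈ LinearMap.range Φ := by
    intro m
    obtain ⟨e, he⟩ := D.mkQ_surjective (s₂ (N.mkQ m))
    have h1 : N.mkQ (π e) = N.mkQ m := by
      have := LinearMap.congr_fun hs₂ (N.mkQ m)
      rw [LinearMap.comp_apply, ← he] at this
      exact this
    have h2 : m - π e ∈ N := by
      rw [← Submodule.ker_mkQ N, LinearMap.mem_ker, map_sub, h1, sub_self]
    refine ⟨e + s₁ ⟨_, h2⟩, ?_⟩
    have h3 : D.mkQ (s₁ ⟨_, h2⟩ : E) = 0 := by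
      rw [Submodule.mkQ_apply, Submodule.Quotient.mk_eq_zero]
      exact ⟨_, rfl⟩
    refine Prod.ext ?_ ?_
    · change D.mkQ (e + _) = s₂ (N.mkQ m)
      rw [map_add, h3, add_zero, he]
    · change π (e + _) = m
      rw [map_add, hs₁']
      simp
  refine ⟨(LinearEquiv.ofInjective Φ hΦ).symm.toLinearMap.comp
    (LinearMap.codRestrict _ _ hmem), ?_⟩
  ext m
  have key : ∀ z : LinearMap.range Φ, π ((LinearEquiv.ofInjective Φ hΦ).symm z) = z.1.2 := by
    intro z
    have := congrArg Subtype.val ((LinearEquiv.ofInjective Φ hΦ).apply_symm_apply z)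
    exact congrArg Prod.snd this
  rw [LinearMap.comp_apply, LinearMap.comp_apply, LinearEquiv.coe_coe, key]
  rfl

/-- A direct summand inherits the splitting of extensions. -/
lemma extZero_of_retract {X Y X' Y' : Type u} [AddCommGroup X] [Module R X] [AddCommGroup Y]
    [Module R Y] [AddCommGroup X'] [Module R X'] [AddCommGroup Y'] [Module R Y']
    (i : X →ₗ[R] X') (r : X' →ₗ[R] X) (hri : ∀ x, r (i x) = x)
    (j : Y →ₗ[R] Y') (s : Y' →ₗ[R] Y) (hsj : ∀ y, s (j y) = y) (h : ExtZero R Y' X') :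
    ExtZero R Y X := by
  intro E _ _ ι π hι hπ hex
  have hπι : ∀ x, π (ι x) = 0 := fun x => by
    rw [← LinearMap.mem_ker, ← hex]; exact ⟨x, rfl⟩
  let c : X' →ₗ[R] LinearMap.ker r :=
    LinearMap.codRestrict _ (LinearMap.id - i.comp r) (fun x => by simp [hri])
  have hc : ∀ x, (c x : X') = x - i (r x) := fun x => rfl
  let ι' : X' →ₗ[R] (E × LinearMap.ker r × LinearMap.ker s) :=
    (ι.comp r).prod (c.prod 0)
  let π' : (E × LinearMap.ker r × LinearMap.ker s) →ₗ[R] Y' :=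
    LinearMap.coprod (j.comp π)
      ((LinearMap.ker s).subtype.comp (LinearMap.snd R (LinearMap.ker r) (LinearMap.ker s)))
  have hπ' : ∀ e u v, π' (e, u, v) = j (π e) + v := fun e u v => by simp [π']
  obtain ⟨σ, hσ⟩ := h _ ι' π'
    (by
      rw [← LinearMap.ker_eq_bot, LinearMap.ker_eq_bot']
      intro x hx
      have h1 : ι (r x) = 0 := congrArg Prod.fst hx
      have h2 : c x = 0 := congrArg (fun z => z.2.1) hx
      have h3 : r x = 0 := hι (by rw [h1, map_zero])
      have h4 := congrArg Subtype.val h2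
      rw [hc, h3, map_zero, sub_zero] at h4
      exact h4)
    (by
      intro y
      obtain ⟨e, he⟩ := hπ (s y)
      refine ⟨(e, 0, ⟨y - j (s y), by simp [hsj]⟩), ?_⟩
      rw [hπ', he]
      simp)
    (by
      ext ⟨e, u, v⟩
      rw [LinearMap.mem_ker, hπ']
      constructor
      · rintro ⟨x, hx⟩
        have h1 : ι (r x) = e := congrArg Prod.fst hx
        have h2 : 0 = v := congrArg (fun z => z.2.2) hx
        rw [← h1, ← h2, hπι]
        simp
      · intro h0
        have h1 : π e = 0 := by
          have := congrArg s h0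
          rw [map_add, hsj, LinearMap.mem_ker.1 v.2, map_zero, add_zero] at this
          exact this
        have h2 : v = 0 := by
          rw [h1, map_zero, zero_add] at h0
          exact Subtype.ext h0
        have h3 : e ∈ LinearMap.range ι := by rw [hex]; exact h1
        obtain ⟨x, rfl⟩ := h3
        have hu : r u.1 = 0 := u.2
        refine ⟨i x + u, ?_⟩
        refine Prod.ext ?_ (Prod.ext (Subtype.ext ?_) ?_)
        · change ι (r (i x + u)) = ι x
          rw [map_add, hri, hu, add_zero]
        · change ((c (i x + u)) : X') = u
          rw [hc, map_add, hri, hu, add_zero, add_sub_cancel_left]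
        · exact h2.symm)
  refine ⟨(LinearMap.fst R _ _).comp (σ.comp j), ?_⟩
  ext y
  have h1 := LinearMap.congr_fun hσ (j y)
  rcases h2 : σ (j y) with ⟨e, u, v⟩
  rw [LinearMap.comp_apply, h2, hπ'] at h1
  have h3 := congrArg s h1
  rw [map_add, hsj, LinearMap.mem_ker.1 v.2, add_zero, LinearMap.id_apply, hsj] at h3
  simp [h2, h3]

/-- The Happel–Ringel lemma. -/
lemma injective_or_surjective_of_extZero {X Y : Type u} [AddCommGroup X] [Module R X]
    [AddCommGroup Y] [Module R Y] (hR : Hereditary R)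
    (hX : ∀ f g : X →ₗ[R] X, f + g = LinearMap.id → Function.Bijective f ∨ Function.Bijective g)
    (hY : ∀ f : Y →ₗ[R] Y, f.comp f = f → f = 0 ∨ f = LinearMap.id)
    (hext : ExtZero R Y X) (f : X →ₗ[R] Y) (hf : f ≠ 0) :
    Function.Injective f ∨ Function.Surjective f := by
  let I : Submodule R Y := LinearMap.range f
  obtain ⟨P, πC, hπC, hP, hQ⟩ := hR (.of R (Y ⧸ I))
  change P →ₗ[R] (Y ⧸ I) at πC
  obtain ⟨φ, hφ⟩ := Module.projective_lifting_property I.mkQ πC I.mkQ_surjective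
  have hφ' : ∀ p, I.mkQ (φ p) = πC p := fun p => LinearMap.congr_fun hφ p
  have hφI : ∀ q : LinearMap.ker πC, φ q ∈ I := by
    intro q
    have := hφ' q.1
    rw [LinearMap.mem_ker.1 q.2] at this
    simpa using this
  obtain ⟨ψ, hψ⟩ := Module.projective_lifting_property f.rangeRestrict
    (LinearMap.codRestrict I (φ.comp (LinearMap.ker πC).subtype) hφI) f.surjective_rangeRestrict
  have hψ' : ∀ q : LinearMap.ker πC, f (ψ q) = φ q := fun q =>
    congrArg Subtype.val (LinearMap.congr_fun hψ q)
  let D : Submodule R (X × P) := LinearMap.range (ψ.prod (-(LinearMap.ker πC).subtype))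
  let g : (X × P) →ₗ[R] Y := f.coprod φ
  have hg : ∀ x p, g (x, p) = f x + φ p := fun x p => by simp [g]
  have hDg : D ≤ LinearMap.ker g := by
    rintro _ ⟨q, rfl⟩
    rw [LinearMap.mem_ker]
    change g (ψ q, -q.1) = 0
    rw [hg, hψ', map_neg, add_neg_cancel]
  let gE : ((X × P) ⧸ D) →ₗ[R] Y := D.liftQ g hDg
  have hgE : ∀ z, gE (D.mkQ z) = g z := fun z => rfl
  let j : X →ₗ[R] ((X × P) ⧸ D) := D.mkQ.comp (LinearMap.inl R X P)
  have hgj : ∀ x, gE (j x) = f x := fun x => by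
    change gE (D.mkQ (x, 0)) = _
    rw [hgE, hg, map_zero, add_zero]
  have hker : ∀ ε, gE ε ∈ I → ∃ x, ε = j x := by
    intro ε hε
    obtain ⟨⟨x, p⟩, rfl⟩ := D.mkQ_surjective ε
    rw [hgE, hg] at hε
    have hp : φ p ∈ I := by
      have := I.sub_mem hε (⟨x, rfl⟩ : f x ∈ I)
      simpa using this
    have hq : πC p = 0 := by
      rw [← hφ', ← LinearMap.mem_ker, Submodule.ker_mkQ]
      exact hp
    refine ⟨x + ψ ⟨p, hq⟩, ?_⟩
    rw [← sub_eq_zero]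
    change D.mkQ (x, p) - D.mkQ (x + ψ ⟨p, hq⟩, 0) = 0
    rw [← map_sub, Submodule.mkQ_apply, Submodule.Quotient.mk_eq_zero]
    refine ⟨-⟨p, hq⟩, ?_⟩
    refine Prod.ext ?_ ?_ <;> simp
  have hj : ∀ x, j x = 0 → x = 0 := by
    intro x hx
    have hx' : (x, (0 : P)) ∈ D := by
      rw [← Submodule.Quotient.mk_eq_zero]; exact hx
    obtain ⟨q, hq⟩ := hx'
    have h1 : -q.1 = (0 : P) := congrArg Prod.snd hq
    have h2 : ψ q = x := congrArg Prod.fst hq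
    have h3 : q = 0 := Subtype.ext (neg_eq_zero.1 h1)
    rw [← h2, h3, map_zero]
  let ι : X →ₗ[R] I × ((X × P) ⧸ D) := f.rangeRestrict.prod (-j)
  let π : I × ((X × P) ⧸ D) →ₗ[R] Y := I.subtype.coprod gE
  have hπ : ∀ z ε, π (z, ε) = z + gE ε := fun z ε => by simp [π]
  have hιinj : Function.Injective ι := by
    rw [← LinearMap.ker_eq_bot, LinearMap.ker_eq_bot']
    intro x hx
    have h1 : -j x = 0 := congrArg Prod.snd hx
    exact hj x (neg_eq_zero.1 h1)
  have hex : LinearMap.range ι = LinearMap.ker π := by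
    ext ⟨z, ε⟩
    rw [LinearMap.mem_ker, hπ]
    constructor
    · rintro ⟨x, hx⟩
      have h1 : f.rangeRestrict x = z := congrArg Prod.fst hx
      have h2 : -j x = ε := congrArg Prod.snd hx
      rw [← h1, ← h2, map_neg, hgj]
      simp
    · intro h0
      have h1 : gE ε = -z := eq_neg_of_add_eq_zero_right h0
      obtain ⟨x, rfl⟩ := hker ε (by rw [h1]; exact I.neg_mem z.2)
      refine ⟨-x, ?_⟩
      refine Prod.ext (Subtype.ext ?_) ?_
      · change f (-x) = z
        rw [map_neg, ← hgj, h1, neg_neg]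
      · change -j (-x) = j x
        rw [map_neg, neg_neg]
  obtain ⟨σ, hσ⟩ := hext _ ι π hιinj
    (by
      intro y
      obtain ⟨p, hp⟩ := hπC (I.mkQ y)
      have : y - φ p ∈ I := by
        rw [← Submodule.ker_mkQ I, LinearMap.mem_ker, map_sub, hφ', hp, sub_self]
      refine ⟨(⟨_, this⟩, D.mkQ (0, p)), ?_⟩
      rw [hπ, hgE, hg]
      simp) hex
  obtain ⟨ρ, hρ⟩ := exists_retraction_of_section ι π hιinj hex σ hσ
  let ρ₁ : I →ₗ[R] X := ρ.comp (LinearMap.inl R _ _)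
  let ρ₂ : ((X × P) ⧸ D) →ₗ[R] X := -ρ.comp (LinearMap.inr R _ _)
  have hsum : ρ₁.comp f.rangeRestrict + ρ₂.comp j = LinearMap.id := by
    rw [← hρ]
    ext x
    change ρ (f.rangeRestrict x, 0) + -ρ (0, j x) = ρ (f.rangeRestrict x, -j x)
    rw [← map_neg, ← map_add]
    simp
  rcases hX _ _ hsum with hb | hb
  · left
    intro x y hxy
    apply hb.1
    change ρ₁ (f.rangeRestrict x) = ρ₁ (f.rangeRestrict y)
    congr 1
    exact Subtype.ext hxy
  · right
    let u := LinearEquiv.ofBijective _ hb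
    let ρ₃ : ((X × P) ⧸ D) →ₗ[R] X := u.symm.toLinearMap.comp ρ₂
    have hρ₃ : ∀ x, ρ₃ (j x) = x := fun x => u.symm_apply_apply x
    have hgsurj : Function.Surjective gE := by
      intro y
      obtain ⟨p, hp⟩ := hπC (I.mkQ y)
      have : y - φ p ∈ I := by
        rw [← Submodule.ker_mkQ I, LinearMap.mem_ker, map_sub, hφ', hp, sub_self]
      obtain ⟨x, hx⟩ := this
      exact ⟨D.mkQ (x, p), by rw [hgE, hg, hx, sub_add_cancel]⟩
    have hkk : LinearMap.ker gE ≤ LinearMap.ker (f.comp ρ₃) := by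
      intro ε hε
      rw [LinearMap.mem_ker] at hε
      obtain ⟨x, rfl⟩ := hker ε (by rw [hε]; exact I.zero_mem)
      rw [LinearMap.mem_ker, LinearMap.comp_apply, hρ₃, ← hgj, hε]
    let τ : Y →ₗ[R] Y := ((LinearMap.ker gE).liftQ (f.comp ρ₃) hkk).comp
      (gE.quotKerEquivOfSurjective hgsurj).symm.toLinearMap
    have hτ : ∀ ε, τ (gE ε) = f (ρ₃ ε) := by
      intro ε
      have : (gE.quotKerEquivOfSurjective hgsurj).symm (gE ε) = (LinearMap.ker gE).mkQ ε := by
        rw [LinearEquiv.symm_apply_eq]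
        rfl
      change ((LinearMap.ker gE).liftQ (f.comp ρ₃) hkk)
        ((gE.quotKerEquivOfSurjective hgsurj).symm (gE ε)) = _
      rw [this]
      rfl
    have hτf : ∀ x, τ (f x) = f x := fun x => by rw [← hgj, hτ, hρ₃, hgj]
    have hidem : τ.comp τ = τ := by
      ext y
      obtain ⟨ε, rfl⟩ := hgsurj y
      rw [LinearMap.comp_apply, hτ, hτf]
    rcases hY τ hidem with h0 | h1
    · exfalso
      apply hf
      ext x
      rw [← hτf, h0]
      rfl
    · intro y
      obtain ⟨ε, rfl⟩ := hgsurj y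
      refine ⟨ρ₃ ε, ?_⟩
      rw [← hτ, h1]
      rfl

end ModuleTheory

section PathAlgebra

variable {k : Type u} [Field k] {t : ℕ} {ℓ : Fin t → ℕ}

lemma vtx_zero (i : Fin t) : vtx t ℓ i 0 = .src := by simp [vtx]

lemma vtx_succ (i : Fin t) (a : ℕ) (h : a < ℓ i - 1) : vtx t ℓ i (a + 1) = .mid i ⟨a, h⟩ := by
  simp [vtx, h]

lemma vtx_len (i : Fin t) (h : 1 ≤ ℓ i) : vtx t ℓ i (ℓ i) = .snk := by
  rw [vtx, if_neg (by omega), dif_neg (by omega)]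

lemma vtx_cases (i : Fin t) (hℓ : 1 ≤ ℓ i) (a : ℕ) (ha : a ≤ ℓ i) :
    (a = 0 ∧ vtx t ℓ i a = .src) ∨ (a = ℓ i ∧ vtx t ℓ i a = .snk) ∨
      ∃ c : Fin (ℓ i - 1), a = c + 1 ∧ vtx t ℓ i a = .mid i c := by
  rcases Nat.eq_zero_or_pos a with rfl | h0
  · exact Or.inl ⟨rfl, vtx_zero i⟩
  rcases ha.eq_or_lt with rfl | h1
  · exact Or.inr (Or.inl ⟨rfl, vtx_len i hℓ⟩)
  · obtain ⟨c, rfl⟩ : ∃ c, a = c + 1 := ⟨a - 1, by omega⟩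
    exact Or.inr (Or.inr ⟨⟨c, by omega⟩, rfl, vtx_succ i c (by omega)⟩)

lemma vtx_succ_eq_vtx {i j : Fin t} {a b : ℕ} (ha : a < ℓ i) (hb : b < ℓ j)
    (h : vtx t ℓ i (a + 1) = vtx t ℓ j b) : i = j ∧ b = a + 1 := by
  rcases vtx_cases i (by omega) (a + 1) ha with h1 | h1 | ⟨c, h1, h1'⟩ <;>
    rcases vtx_cases j (by omega) b hb.le with h2 | h2 | ⟨d, h2, h2'⟩
  · omega
  · omega
  · omega
  · rw [h1.2, h2.2] at h; cases h
  · omega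
  · rw [h1.2, h2'] at h; cases h
  · rw [h1', h2.2] at h; cases h
  · omega
  · rw [h1', h2'] at h
    cases h
    exact ⟨rfl, by omega⟩

lemma eV_mul_eV (v w : Vtx t ℓ) :
    (eV v * eV w : PathAlg k t ℓ) = if v = w then eV v else 0 := by
  apply Subtype.ext
  apply LinearMap.ext
  intro f
  funext p
  split_ifs with h
  · subst h
    change (if startIdx p = v then (if startIdx p = v then f p else 0) else 0) =
      if startIdx p = v then f p else 0
    split_ifs <;> rfl
  · change (if startIdx p = v then (if startIdx p = w then f p else 0) else 0) = 0
    split_ifs with h1 h2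
    · exact absurd (h1.symm.trans h2) h
    · rfl
    · rfl

lemma eV_mul_self (v : Vtx t ℓ) : (eV v * eV v : PathAlg k t ℓ) = eV v := by
  rw [eV_mul_eV, if_pos rfl]

lemma eV_mul_of_ne {v w : Vtx t ℓ} (h : v ≠ w) : (eV v * eV w : PathAlg k t ℓ) = 0 := by
  rw [eV_mul_eV, if_neg h]

lemma startIdx_of_strip {i : Fin t} {j : ℕ} {p q : PIdx t ℓ} (h : strip i j p = some q) :
    startIdx p = vtx t ℓ i j ∧ startIdx q = vtx t ℓ i (j + 1) ∧ j < ℓ i := by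
  cases p with
  | vert v => simp [strip] at h
  | sub i' a b hab hb =>
    rw [strip] at h
    split_ifs at h with h1 h2
    · obtain ⟨rfl, rfl⟩ := h1
      cases h
      exact ⟨rfl, rfl, by omega⟩
    · obtain ⟨rfl, rfl⟩ := h1
      cases h
      have : b = a + 1 := by omega
      subst this
      exact ⟨rfl, rfl, by omega⟩

lemma eV_mul_arE (i : Fin t) (j : ℕ) : (eV (vtx t ℓ i j) * arE i j : PathAlg k t ℓ) = arE i j := by
  apply Subtype.ext
  apply LinearMap.ext
  intro f
  funext p
  change (if startIdx p = vtx t ℓ i j then (strip i j p).elim 0 f else 0) =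
    (strip i j p).elim 0 f
  rcases h : strip i j p with _ | q
  · simp
  · rw [if_pos (startIdx_of_strip h).1]

lemma arE_mul_eV (i : Fin t) (j : ℕ) :
    (arE i j * eV (vtx t ℓ i (j + 1)) : PathAlg k t ℓ) = arE i j := by
  apply Subtype.ext
  apply LinearMap.ext
  intro f
  funext p
  change (strip i j p).elim 0 (fun p => if startIdx p = vtx t ℓ i (j + 1) then f p else 0) =
    (strip i j p).elim 0 f
  rcases h : strip i j p with _ | q
  · rfl
  · simp [(startIdx_of_strip h).2.1]

lemma arE_eq_zero {i : Fin t} {j : ℕ} (h : ℓ i ≤ j) : (arE i j : PathAlg k t ℓ) = 0 := by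
  apply Subtype.ext
  apply LinearMap.ext
  intro f
  funext p
  change (strip i j p).elim 0 f = 0
  rcases h1 : strip i j p with _ | q
  · rfl
  · have := (startIdx_of_strip h1).2.2
    omega

lemma subE_self (i : Fin t) (a : ℕ) : (subE i a a : PathAlg k t ℓ) = 1 := by
  simp [subE]

lemma subE_succ (i : Fin t) {a b : ℕ} (h : a ≤ b) :
    (subE i a (b + 1) : PathAlg k t ℓ) = subE i a b * arE i b := by
  rw [subE, subE, show b + 1 - a = (b - a) + 1 by omega, List.range_succ, List.map_append,
    List.prod_append]
  simp [show a + (b - a) = b by omega]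

lemma subE_one (i : Fin t) (a : ℕ) : (subE i a (a + 1) : PathAlg k t ℓ) = arE i a := by
  rw [subE_succ i le_rfl, subE_self, one_mul]

lemma subE_mul (i : Fin t) {a b c : ℕ} (hab : a ≤ b) (hbc : b ≤ c) :
    (subE i a b * subE i b c : PathAlg k t ℓ) = subE i a c := by
  induction c, hbc using Nat.le_induction with
  | base => rw [subE_self, mul_one]
  | succ c hbc ih => rw [subE_succ i hbc, ← mul_assoc, ih, subE_succ i (hab.trans hbc)]

lemma eV_mul_subE (i : Fin t) {a b : ℕ} (h : a < b) :
    (eV (vtx t ℓ i a) * subE i a b : PathAlg k t ℓ) = subE i a b := by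
  rw [← subE_mul i (Nat.le_succ a) h, subE_one, ← mul_assoc, eV_mul_arE]

lemma subE_mul_eV (i : Fin t) {a b : ℕ} (h : a < b) :
    (subE i a b * eV (vtx t ℓ i b) : PathAlg k t ℓ) = subE i a b := by
  obtain ⟨c, rfl⟩ : ∃ c, b = c + 1 := ⟨b - 1, by omega⟩
  rw [subE_succ i (by omega), mul_assoc, arE_mul_eV]

instance : Fintype (Vtx t ℓ) :=
  Fintype.ofEquiv (Option (Option (Σ i : Fin t, Fin (ℓ i - 1))))
    { toFun := fun x => match x with
        | none => .src
        | some none => .snk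
        | some (some ⟨i, a⟩) => .mid i a
      invFun := fun v => match v with
        | .src => none
        | .snk => some none
        | .mid i a => some (some ⟨i, a⟩)
      left_inv := by rintro (_ | _ | ⟨i, a⟩) <;> rfl
      right_inv := by rintro (_ | _ | ⟨i, a⟩) <;> rfl }

lemma sum_eV : (∑ v, eV v : PathAlg k t ℓ) = 1 := by
  apply Subtype.ext
  apply LinearMap.ext
  intro f
  funext p
  rw [AddSubmonoidClass.coe_finsetSum, LinearMap.sum_apply, Finset.sum_apply]
  change ∑ v, (if startIdx p = v then f p else 0) = f p
  simp

/-- The set of paths in the path algebra. -/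
def pathSet (k : Type u) [Field k] (t : ℕ) (ℓ : Fin t → ℕ) : Set (PathAlg k t ℓ) :=
  Set.range eV ∪ {y | ∃ i a b, a < b ∧ b ≤ ℓ i ∧ y = subE i a b}

lemma span_pathSet : Submodule.span k (pathSet k t ℓ) = ⊤ := by
  set S := Submodule.span k (pathSet k t ℓ) with hS
  have hv : ∀ v, eV v ∈ S := fun v => Submodule.subset_span (Or.inl ⟨v, rfl⟩)
  have hs : ∀ i a b, a < b → b ≤ ℓ i → (subE i a b : PathAlg k t ℓ) ∈ S := fun i a b h1 h2 =>
    Submodule.subset_span (Or.inr ⟨i, a, b, h1, h2, rfl⟩)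
  have hgen : ∀ x : PathAlg k t ℓ, (∀ y ∈ pathSet k t ℓ, x * y ∈ S) → ∀ y ∈ S, x * y ∈ S := by
    intro x hx y hy
    induction hy using Submodule.span_induction with
    | mem y hy => exact hx y hy
    | zero => rw [mul_zero]; exact S.zero_mem
    | add y z _ _ h1 h2 => rw [mul_add]; exact S.add_mem h1 h2
    | smul c y _ h => rw [mul_smul_comm]; exact S.smul_mem c h
  have key : ∀ (x : Module.End k (PSp k t ℓ)) (hx : x ∈ PathAlg k t ℓ),
      ∀ y ∈ S, (⟨x, hx⟩ : PathAlg k t ℓ) * y ∈ S := by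
    intro x hx
    induction hx using Algebra.adjoin_induction with
    | mem x hx =>
      rcases hx with ⟨v, rfl⟩ | ⟨i, j, rfl⟩
      · apply hgen
        change ∀ y ∈ pathSet k t ℓ, eV v * y ∈ S
        rintro _ (⟨w, rfl⟩ | ⟨i, a, b, hab, hb, rfl⟩)
        · rw [eV_mul_eV]
          split_ifs
          · exact hv v
          · exact S.zero_mem
        · rw [← eV_mul_subE i hab, ← mul_assoc, eV_mul_eV]
          split_ifs with h
          · rw [h, eV_mul_subE i hab]
            exact hs _ _ _ hab hb
          · rw [zero_mul]; exact S.zero_mem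
      · apply hgen
        change ∀ y ∈ pathSet k t ℓ, arE i j * y ∈ S
        rcases lt_or_ge j (ℓ i) with hj | hj
        swap
        · intro y _
          rw [arE_eq_zero hj, zero_mul]; exact S.zero_mem
        rintro _ (⟨w, rfl⟩ | ⟨i', a, b, hab, hb, rfl⟩)
        · rw [← arE_mul_eV, mul_assoc, eV_mul_eV]
          split_ifs
          · rw [arE_mul_eV, ← subE_one]
            exact hs _ _ _ (by omega) hj
          · rw [mul_zero]; exact S.zero_mem
        · by_cases h : vtx t ℓ i (j + 1) = vtx t ℓ i' a
          · obtain ⟨rfl, rfl⟩ := vtx_succ_eq_vtx hj (by omega) h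
            rw [← subE_one, subE_mul i (by omega) (by omega)]
            exact hs _ _ _ (by omega) hb
          · rw [← arE_mul_eV, ← eV_mul_subE i' hab, mul_assoc, ← mul_assoc (eV _),
              eV_mul_of_ne h, zero_mul, mul_zero]
            exact S.zero_mem
    | algebraMap r =>
      intro y hy
      have : (⟨algebraMap k _ r, (PathAlg k t ℓ).algebraMap_mem r⟩ : PathAlg k t ℓ) * y =
          r • y := by
        rw [Algebra.smul_def]; rfl
      rw [this]
      exact S.smul_mem r hy
    | add x y hx hy h1 h2 =>
      intro z hz
      have := S.add_mem (h1 z hz) (h2 z hz)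
      rw [← add_mul] at this
      exact this
    | mul x y hx hy h1 h2 =>
      intro z hz
      have := h1 _ (h2 z hz)
      rw [← mul_assoc] at this
      exact this
  rw [eq_top_iff]
  rintro x -
  have h1 : (1 : PathAlg k t ℓ) ∈ S := by
    rw [← sum_eV]
    exact S.sum_mem fun v _ => hv v
  simpa using key x.1 x.2 1 h1

lemma finite_pathSet : (pathSet k t ℓ).Finite := by
  refine (Set.finite_range _).union ?_
  let f : (Σ i : Fin t, Fin (ℓ i + 1) × Fin (ℓ i + 1)) → PathAlg k t ℓ :=
    fun x => subE x.1 x.2.1 x.2.2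
  refine (Set.finite_range f).subset ?_
  rintro _ ⟨i, a, b, h1, h2, rfl⟩
  exact ⟨⟨i, ⟨a, by omega⟩, ⟨b, by omega⟩⟩, rfl⟩

instance : FiniteDimensional k (PathAlg k t ℓ) := by
  rw [FiniteDimensional, Module.finite_def, ← span_pathSet]
  exact Submodule.fg_span finite_pathSet

/-- The sum of the trivial paths in the regular representation. -/
def trivSum (k : Type u) [Field k] (t : ℕ) (ℓ : Fin t → ℕ) : PSp k t ℓ := fun p =>
  match p with
  | .vert _ => 1
  | .sub _ _ _ _ _ => 0

lemma apply_trivSum_of_mem_span {x : PathAlg k t ℓ} (hx : x ∈ Submodule.span k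
    {y : PathAlg k t ℓ | ∃ i a b, a + 2 ≤ b ∧ b ≤ ℓ i ∧ y = subE i a b}) :
    (∀ v, x.1 (trivSum k t ℓ) (.vert v) = 0) ∧
      ∀ i a (h : a + 1 ≤ ℓ i), x.1 (trivSum k t ℓ) (.sub i a (a + 1) (Nat.lt_succ_self a) h) = 0 := by
  induction hx using Submodule.span_induction with
  | mem y hy =>
    obtain ⟨i, a, b, hab, hb, rfl⟩ := hy
    rw [← subE_mul i (show a ≤ a + 2 by omega) hab, subE_succ i (show a ≤ a + 1 by omega),
      subE_one]
    constructor
    · intro v; rfl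
    · intro i' a' h
      change (strip i a (.sub i' a' (a' + 1) _ h)).elim 0 (fun p => (strip i (a + 1) p).elim 0 _) = 0
      rw [strip]
      by_cases h1 : i' = i ∧ a' = a
      · rw [dif_pos h1, dif_neg (by omega)]
        rfl
      · rw [dif_neg h1]; rfl
  | zero => exact ⟨fun _ => rfl, fun _ _ _ => rfl⟩
  | add y z _ _ h1 h2 =>
    refine ⟨fun v => ?_, fun i a h => ?_⟩
    · change y.1 _ _ + z.1 _ _ = 0
      rw [h1.1, h2.1, add_zero]
    · change y.1 _ _ + z.1 _ _ = 0
      rw [h1.2, h2.2, add_zero]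
  | smul c y _ h =>
    refine ⟨fun v => ?_, fun i a h' => ?_⟩
    · change c * y.1 _ _ = 0
      rw [h.1, mul_zero]
    · change c * y.1 _ _ = 0
      rw [h.2, mul_zero]

end PathAlgebra

section QuotientAlgebra

variable {k : Type u} [Field k] (T : ToupieAlg k)

/-- The primitive idempotent of `A` at a vertex. -/
def ev (v : Vtx T.t T.ℓ) : Alg T := mkA T (eV v)

/-- The residue in `A` of the path along branch `i` from position `a` to position `b`
(a trivial path if `a = b`, and zero if `b < a`). -/
def pp (i : Fin T.t) (a b : ℕ) : Alg T :=
  if a < b then mkA T (subE i a b) else if a = b then ev T (vtx T.t T.ℓ i a) else 0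

lemma mkA_eq_zero_iff (x : PathAlg k T.t T.ℓ) : mkA T x = 0 ↔ x ∈ T.I := by
  rw [TwoSidedIdeal.mem_iff, ← RingCon.eq]
  rfl

lemma mkA_smul (c : k) (x : PathAlg k T.t T.ℓ) : mkA T (c • x) = c • mkA T x := by
  rw [Algebra.smul_def, Algebra.smul_def, map_mul]
  rfl

/-- The quotient map as a linear map. -/
def mkL : PathAlg k T.t T.ℓ →ₗ[k] Alg T where
  toFun := mkA T
  map_add' := map_add _
  map_smul' := mkA_smul T

instance : FiniteDimensional k (Alg T) :=
  Module.Finite.of_surjective (mkL T) (mkA_surjective T)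

variable {T}

lemma ev_mul_self (v : Vtx T.t T.ℓ) : ev T v * ev T v = ev T v := by
  rw [ev, ← map_mul, eV_mul_self]

lemma ev_mul_of_ne {v w : Vtx T.t T.ℓ} (h : v ≠ w) : ev T v * ev T w = 0 := by
  rw [ev, ev, ← map_mul, eV_mul_of_ne h, map_zero]

lemma sum_ev : ∑ v, ev T v = 1 := by
  simp only [ev]
  rw [← map_sum, sum_eV, map_one]

lemma ev_ne_zero (v : Vtx T.t T.ℓ) : ev T v ≠ 0 := by
  intro h
  have h1 := T.adm _ ((mkA_eq_zero_iff T _).1 h)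
  have h2 := (apply_trivSum_of_mem_span h1).1 v
  have h3 : (eV v : PathAlg k T.t T.ℓ).1 (trivSum k T.t T.ℓ) (.vert v) = 1 := by
    change (if v = v then _ else _) = _
    rw [if_pos rfl]
    rfl
  rw [h3] at h2
  exact one_ne_zero h2

lemma pp_self (i : Fin T.t) (a : ℕ) : pp T i a a = ev T (vtx T.t T.ℓ i a) := by
  simp [pp]

lemma pp_of_lt {i : Fin T.t} {a b : ℕ} (h : a < b) : pp T i a b = mkA T (subE i a b) := by
  simp [pp, h]

lemma pp_of_gt {i : Fin T.t} {a b : ℕ} (h : b < a) : pp T i a b = 0 := by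
  simp [pp, h.not_gt, h.ne']

lemma ev_mul_pp (i : Fin T.t) (a b : ℕ) : ev T (vtx T.t T.ℓ i a) * pp T i a b = pp T i a b := by
  rcases lt_trichotomy a b with h | rfl | h
  · rw [pp_of_lt h, ev, ← map_mul, eV_mul_subE i h]
  · rw [pp_self, ev_mul_self]
  · rw [pp_of_gt h, mul_zero]

lemma pp_mul_ev (i : Fin T.t) (a b : ℕ) : pp T i a b * ev T (vtx T.t T.ℓ i b) = pp T i a b := by
  rcases lt_trichotomy a b with h | rfl | h
  · rw [pp_of_lt h, ev, ← map_mul, subE_mul_eV i h]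
  · rw [pp_self, ev_mul_self]
  · rw [pp_of_gt h, zero_mul]

lemma pp_mul_pp (i : Fin T.t) {a b c : ℕ} (hab : a ≤ b) (hbc : b ≤ c) :
    pp T i a b * pp T i b c = pp T i a c := by
  rcases hab.eq_or_lt with rfl | h1
  · rw [pp_self, ev_mul_pp]
  rcases hbc.eq_or_lt with rfl | h2
  · rw [pp_self, pp_mul_ev]
  rw [pp_of_lt h1, pp_of_lt h2, pp_of_lt (h1.trans h2), ← map_mul, subE_mul i hab hbc]

lemma pp_succ_ne_zero (i : Fin T.t) {a : ℕ} (ha : a + 1 ≤ T.ℓ i) : pp T i a (a + 1) ≠ 0 := by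
  intro h
  rw [pp_of_lt (Nat.lt_succ_self a), subE_one] at h
  have h1 := T.adm _ ((mkA_eq_zero_iff T _).1 h)
  have h2 := (apply_trivSum_of_mem_span h1).2 i a ha
  have h3 : (arE i a : PathAlg k T.t T.ℓ).1 (trivSum k T.t T.ℓ)
      (.sub i a (a + 1) (Nat.lt_succ_self a) ha) = 1 := by
    change (strip i a _).elim 0 _ = _
    rw [strip, dif_pos ⟨rfl, rfl⟩, dif_neg (lt_irrefl _)]
    rfl
  rw [h3] at h2
  exact one_ne_zero h2

lemma pp_self_ne_zero (i : Fin T.t) (a : ℕ) : pp T i a a ≠ 0 := by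
  rw [pp_self]; exact ev_ne_zero _

lemma src_mul_snk (hm : mDim T = 0) (x : Alg T) : ev T .src * x * ev T .snk = 0 := by
  have h : LinearMap.range (lrMap T) = ⊥ := Submodule.finrank_eq_zero.1 hm
  have : lrMap T x ∈ LinearMap.range (lrMap T) := ⟨x, rfl⟩
  rw [h, Submodule.mem_bot] at this
  exact this

lemma pp_zero_len (hm : mDim T = 0) (i : Fin T.t) : pp T i 0 (T.ℓ i) = 0 := by
  have h := src_mul_snk hm (pp T i 0 (T.ℓ i))
  rw [← vtx_zero i, ev_mul_pp, ← vtx_len i (T.hℓ i), pp_mul_ev] at h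
  exact h

/-- The residue in `A` of the unique path between two vertices (zero if there is no such
path, or if the vertices are the source and the sink). -/
def pathOf : Vtx T.t T.ℓ → Vtx T.t T.ℓ → Alg T
  | .src, .src => ev T .src
  | .src, .mid j d => pp T j 0 (d + 1)
  | .src, .snk => 0
  | .mid _ _, .src => 0
  | .mid i c, .mid j d => if i = j then pp T i (c + 1) (d + 1) else 0
  | .mid i c, .snk => pp T i (c + 1) (T.ℓ i)
  | .snk, .snk => ev T .snk
  | .snk, .mid _ _ => 0
  | .snk, .src => 0

lemma vtx_mid (i : Fin T.t) (c : Fin (T.ℓ i - 1)) : vtx T.t T.ℓ i (c + 1) = .mid i c :=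
  vtx_succ i c c.2

lemma pathOf_self (v : Vtx T.t T.ℓ) : pathOf v v = ev T v := by
  cases v with
  | src => rfl
  | snk => rfl
  | mid i c => rw [pathOf, if_pos rfl, pp_self, vtx_mid]

lemma pathOf_vtx (hm : mDim T = 0) (i : Fin T.t) {a b : ℕ} (ha : a ≤ T.ℓ i) (hb : b ≤ T.ℓ i) :
    pathOf (vtx T.t T.ℓ i a) (vtx T.t T.ℓ i b) = pp T i a b := by
  have hℓ := T.hℓ i
  rcases vtx_cases i hℓ a ha with ⟨rfl, h1⟩ | ⟨rfl, h1⟩ | ⟨c, rfl, h1⟩ <;>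
    rcases vtx_cases i hℓ b hb with ⟨rfl, h2⟩ | ⟨rfl, h2⟩ | ⟨d, rfl, h2⟩ <;> simp only [h1, h2]
  · rw [pathOf, pp_self, h1]
  · rw [pathOf, pp_zero_len hm]
  · rw [pathOf]
  · rw [pathOf, pp_of_gt hℓ]
  · rw [pathOf, pp_self, h1]
  · rw [pathOf, pp_of_gt (by omega)]
  · rw [pathOf, pp_of_gt (by omega)]
  · rw [pathOf]
  · simp [pathOf]

lemma corner (hm : mDim T = 0) (v w : Vtx T.t T.ℓ) (x : Alg T) :
    ∃ c : k, ev T v * x * ev T w = c • pathOf v w := by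
  obtain ⟨x, rfl⟩ := mkA_surjective T x
  have hx : x ∈ Submodule.span k (pathSet k T.t T.ℓ) := by rw [span_pathSet]; trivial
  induction hx using Submodule.span_induction with
  | mem x hx =>
    rcases hx with ⟨u, rfl⟩ | ⟨i, a, b, hab, hb, rfl⟩
    · change ∃ c : k, ev T v * ev T u * ev T w = _
      by_cases h1 : v = u
      · subst h1
        by_cases h2 : v = w
        · subst h2
          exact ⟨1, by rw [ev_mul_self, ev_mul_self, one_smul, pathOf_self]⟩
        · exact ⟨0, by rw [ev_mul_self, ev_mul_of_ne h2, zero_smul]⟩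
      · exact ⟨0, by rw [ev_mul_of_ne h1, zero_mul, zero_smul]⟩
    · rw [← pp_of_lt hab]
      by_cases h1 : v = vtx T.t T.ℓ i a
      · by_cases h2 : vtx T.t T.ℓ i b = w
        · refine ⟨1, ?_⟩
          rw [h1, ← h2, ev_mul_pp, pp_mul_ev, pathOf_vtx hm i (by omega) hb, one_smul]
        · exact ⟨0, by rw [← pp_mul_ev, mul_assoc, mul_assoc, ev_mul_of_ne h2, mul_zero, mul_zero,
            zero_smul]⟩
      · exact ⟨0, by rw [← ev_mul_pp, ← mul_assoc, ev_mul_of_ne h1, zero_mul, zero_mul,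
            zero_smul]⟩
  | zero => exact ⟨0, by rw [map_zero, mul_zero, zero_mul, zero_smul]⟩
  | add x y _ _ h1 h2 =>
    obtain ⟨c, hc⟩ := h1
    obtain ⟨d, hd⟩ := h2
    exact ⟨c + d, by rw [map_add, mul_add, add_mul, hc, hd, add_smul]⟩
  | smul r x _ h =>
    obtain ⟨c, hc⟩ := h
    exact ⟨r * c, by rw [mkA_smul, mul_smul_comm, smul_mul_assoc, hc, mul_smul]⟩

lemma corner_vtx (hm : mDim T = 0) (i : Fin T.t) {a b : ℕ} (ha : a ≤ T.ℓ i) (hb : b ≤ T.ℓ i)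
    (x : Alg T) :
    ∃ c : k, ev T (vtx T.t T.ℓ i a) * x * ev T (vtx T.t T.ℓ i b) = c • pp T i a b := by
  rw [← pathOf_vtx hm i ha hb]
  exact corner hm _ _ x

/-! ### Zero-relations on a branch -/

lemma pp_eq_zero_iff {i : Fin T.t} {a b : ℕ} (h : a < b) : pp T i a b = 0 ↔ subE i a b ∈ T.I := by
  rw [pp_of_lt h, mkA_eq_zero_iff]

lemma pp_eq_zero_of_le {i : Fin T.t} {a b c d : ℕ} (h : pp T i a b = 0) (hab : a ≤ b)
    (hca : c ≤ a) (hbd : b ≤ d) : pp T i c d = 0 := by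
  rw [← pp_mul_pp i hca (hab.trans hbd), ← pp_mul_pp i hab hbd, h, zero_mul, mul_zero]

lemma exists_zeroRel {i : Fin T.t} {a b : ℕ} (hab : a ≤ b) (hb : b ≤ T.ℓ i)
    (h : pp T i a b = 0) : ∃ c d, a ≤ c ∧ d ≤ b ∧ ZeroRel T i c d := by
  induction hn : b - a using Nat.strong_induction_on generalizing a b with
  | _ n ih =>
    have hab' : a < b := by
      rcases hab.eq_or_lt with rfl | h'
      · exact absurd h (pp_self_ne_zero i a)
      · exact h'
    by_cases hz : ZeroRel T i a b
    · exact ⟨a, b, le_rfl, le_rfl, hz⟩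
    · rw [ZeroRel] at hz
      push Not at hz
      obtain ⟨c, d, h1, h2, h3, h4, h5⟩ := hz hab' hb ((pp_eq_zero_iff hab').1 h)
      have h6 : d - c < n := by
        by_contra h7
        apply h4
        rw [Prod.mk.injEq]
        omega
      obtain ⟨c', d', h7, h8, h9⟩ := ih _ h6 h3.le (h2.trans hb) ((pp_eq_zero_iff h3).2 h5) rfl
      exact ⟨c', d', h1.trans h7, h8.trans h2, h9⟩

lemma ZeroRel.pp_eq_zero {i : Fin T.t} {a b : ℕ} (h : ZeroRel T i a b) : pp T i a b = 0 :=
  (pp_eq_zero_iff h.1).2 h.2.2.1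

lemma ZeroRel.pp_ne_zero {i : Fin T.t} {a b c d : ℕ} (h : ZeroRel T i a b) (hac : a ≤ c)
    (hcd : c ≤ d) (hdb : d ≤ b) (hne : (c, d) ≠ (a, b)) : pp T i c d ≠ 0 := by
  rcases hcd.eq_or_lt with rfl | hcd'
  · exact pp_self_ne_zero i c
  · rw [Ne, pp_eq_zero_iff hcd']
    exact h.2.2.2 c d hac hdb hcd' hne

lemma ZeroRel.two_le {i : Fin T.t} {a b : ℕ} (h : ZeroRel T i a b) : a + 2 ≤ b := by
  have h1 := h.1
  by_contra h2
  obtain rfl : b = a + 1 := by omega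
  exact pp_succ_ne_zero i h.2.1 h.pp_eq_zero

/-- Two overlapping zero-relations on a branch, consecutive in the sense that no other
zero-relation lies strictly inside their union. -/
structure TwoRel (T : ToupieAlg k) (i : Fin T.t) (a₁ b₁ a₂ b₂ : ℕ) : Prop where
  lt_left : a₁ < a₂
  lt_right : b₁ < b₂
  le_len : b₂ ≤ T.ℓ i
  two_le₁ : a₁ + 2 ≤ b₁
  two_le₂ : a₂ + 2 ≤ b₂
  zero₁ : pp T i a₁ b₁ = 0
  zero₂ : pp T i a₂ b₂ = 0
  ne_zero : ∀ c d, a₁ < c → c ≤ d → d < b₂ → pp T i c d ≠ 0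
  ne_zero₁ : ∀ d, a₁ ≤ d → d < b₁ → pp T i a₁ d ≠ 0
  ne_zero₂ : ∀ c, a₂ < c → c ≤ b₂ → pp T i c b₂ ≠ 0

lemma ZeroRel.lt_of_lt {i : Fin T.t} {a₁ b₁ a₂ b₂ : ℕ} (h₁ : ZeroRel T i a₁ b₁)
    (h₂ : ZeroRel T i a₂ b₂) (h : a₁ < a₂) : b₁ < b₂ := by
  by_contra hb
  refine h₁.pp_ne_zero h.le h₂.1.le (by omega) ?_ h₂.pp_eq_zero
  rw [Ne, Prod.mk.injEq]
  omega

lemma exists_twoRel (hm : mDim T = 0) (h : ¬ ∀ i, ExactlyOneRel T i) :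
    ∃ i a₁ b₁ a₂ b₂, TwoRel T i a₁ b₁ a₂ b₂ := by
  push Not at h
  obtain ⟨i, hi⟩ := h
  obtain ⟨a, b, -, -, hab⟩ := exists_zeroRel (Nat.zero_le _) le_rfl (pp_zero_len hm i)
  obtain ⟨c, d, hcd, hne⟩ : ∃ c d, ZeroRel T i c d ∧ (c, d) ≠ (a, b) := by
    by_contra h0
    push Not at h0
    exact hi ⟨(a, b), hab, fun p hp => h0 p.1 p.2 hp⟩
  have : ∃ a₁ b₁, ZeroRel T i a₁ b₁ ∧ ∃ a₂, a₁ < a₂ ∧ ∃ b₂, ZeroRel T i a₂ b₂ := by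
    rcases lt_trichotomy a c with h1 | rfl | h1
    · exact ⟨a, b, hab, c, h1, d, hcd⟩
    · exfalso
      rcases le_total b d with h2 | h2
      · exact hcd.pp_ne_zero le_rfl hab.1.le h2 hne.symm hab.pp_eq_zero
      · exact hab.pp_ne_zero le_rfl hcd.1.le h2 hne hcd.pp_eq_zero
    · exact ⟨c, d, hcd, a, h1, b, hab⟩
  obtain ⟨a₁, b₁, h₁, hex⟩ := this
  have hmin := fun m (h : m < Nat.find hex) => Nat.find_min hex h
  obtain ⟨hlt, b₂, h₂⟩ := Nat.find_spec hex
  set a₂ := Nat.find hex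
  refine ⟨i, a₁, b₁, a₂, b₂, hlt, h₁.lt_of_lt h₂ hlt, h₂.2.1, h₁.two_le, h₂.two_le,
    h₁.pp_eq_zero, h₂.pp_eq_zero, ?_, ?_, ?_⟩
  · intro c d hc hcd hd h0
    obtain ⟨a₃, b₃, h3, h4, h₃⟩ := exists_zeroRel hcd (by have := h₂.2.1; omega) h0
    rcases lt_or_ge a₃ a₂ with h5 | h5
    · exact hmin a₃ h5 ⟨by omega, b₃, h₃⟩
    · refine h₂.pp_ne_zero h5 h₃.1.le (by omega) ?_ h₃.pp_eq_zero
      rw [Ne, Prod.mk.injEq]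
      omega
  · intro d h3 h4
    refine h₁.pp_ne_zero le_rfl h3 h4.le ?_
    rw [Ne, Prod.mk.injEq]
    omega
  · intro c h3 h4
    refine h₂.pp_ne_zero h3.le h4 le_rfl ?_
    rw [Ne, Prod.mk.injEq]
    omega

lemma exists_of_exactlyOneRel {i : Fin T.t} (h : ExactlyOneRel T i) :
    ∃ a b, a + 2 ≤ b ∧ b ≤ T.ℓ i ∧
      ∀ c d, c ≤ d → d ≤ T.ℓ i → (pp T i c d = 0 ↔ c ≤ a ∧ b ≤ d) := by
  obtain ⟨⟨a, b⟩, hab, huniq⟩ := h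
  change ZeroRel T i a b at hab
  refine ⟨a, b, hab.two_le, hab.2.1, fun c d hcd hd => ⟨fun h => ?_, fun h => ?_⟩⟩
  · obtain ⟨a', b', h1, h2, h3⟩ := exists_zeroRel hcd hd h
    have := huniq (a', b') h3
    rw [Prod.mk.injEq] at this
    omega
  · exact pp_eq_zero_of_le hab.pp_eq_zero hab.1.le h.1 h.2

end QuotientAlgebra

section TiltedImplies

/-- For the endomorphism algebra of a tilting module over a hereditary algebra, a nonzero
element between two idempotents with one-dimensional corners is left or right cancellable. -/
lemma cancel_of_isTilted {k A : Type u} [Field k] [Ring A] [Algebra k A] (hA : IsTilted k A)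
    {e f x : A} (he : e * e = e) (hf : f * f = f)
    (hek : ∀ a : A, ∃ c : k, e * a * e = c • e) (hfk : ∀ a : A, ∃ c : k, f * a * f = c • f)
    (hfx : f * x = x) (hxe : x * e = x) (hx : x ≠ 0) :
    (∀ y, e * y = y → x * y = 0 → y = 0) ∨ (∀ z, z * f = z → z * x = 0 → z = 0) := by
  obtain ⟨H, _, _, -, hH, M, _, _, ⟨-, hext, -⟩, _, _, _, φ, hφ⟩ := hA
  have hmul : ∀ (a b : A) (m : M), φ (a * b) m = φ a (φ b m) := fun a b m => by
    rw [map_mul]; rfl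
  have hid : ∀ {g : A}, g * g = g → ∀ m ∈ LinearMap.range (φ g), φ g m = m := by
    rintro g hg _ ⟨m, rfl⟩
    rw [← hmul, hg]
  have hend : ∀ {g : A}, g * g = g → (∀ a : A, ∃ c : k, g * a * g = c • g) →
      ∀ F : LinearMap.range (φ g) →ₗ[Hᵐᵒᵖ] LinearMap.range (φ g),
        ∃ c : k, ∀ m, (F m : M) = c • (m : M) := by
    intro g hg hgk F
    obtain ⟨a, ha⟩ := φ.surjective
      ((LinearMap.range (φ g)).subtype.comp (F.comp (φ g).rangeRestrict))
    obtain ⟨c, hc⟩ := hgk a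
    refine ⟨c, fun m => ?_⟩
    have h1 : (F m : M) = φ a m := by
      rw [ha]
      change _ = (F ⟨φ g m, _⟩ : M)
      congr 2
      exact Subtype.ext (hid hg m m.2).symm
    have h2 : φ (g * a * g) m = φ a m := by
      rw [hmul, hid hg m m.2, hmul, hid hg]
      rw [← h1]
      exact (F m).2
    rw [h1, ← h2, hc, hφ, LinearMap.smul_apply, hid hg m m.2]
  have hret : ∀ {g : A} (hg : g * g = g) (m : LinearMap.range (φ g)),
      (φ g).rangeRestrict ((LinearMap.range (φ g)).subtype m) = m := fun hg m =>
    Subtype.ext (hid hg m m.2)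
  have hX : ∀ F G : LinearMap.range (φ e) →ₗ[Hᵐᵒᵖ] LinearMap.range (φ e),
      F + G = LinearMap.id → Function.Bijective F ∨ Function.Bijective G := by
    have hbij : ∀ (F : LinearMap.range (φ e) →ₗ[Hᵐᵒᵖ] LinearMap.range (φ e)) (c : k), c ≠ 0 →
        (∀ m, (F m : M) = c • (m : M)) → Function.Bijective F := by
      intro F c hc hF
      constructor
      · intro m m' h
        have := congrArg Subtype.val h
        rw [hF, hF] at this
        exact Subtype.ext (smul_right_injective M hc this)
      · intro m
        refine ⟨⟨c⁻¹ • (m : M), ?_⟩, Subtype.ext ?_⟩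
        · obtain ⟨m', hm'⟩ := m.2
          refine ⟨c⁻¹ • m', ?_⟩
          rw [← hm', ← LinearMap.smul_apply, ← hφ]
          rw [show φ (c⁻¹ • e) m' = c⁻¹ • φ e m' by rw [hφ]; rfl]
          have : φ e (c⁻¹ • m') = φ (e * (c⁻¹ • (1 : A))) m' := by
            rw [hmul, hφ, map_one]; rfl
          rw [this, mul_smul_comm, mul_one, hφ]; rfl
        · rw [hF, smul_smul, mul_inv_cancel₀ hc, one_smul]
    intro F G hFG
    obtain ⟨c, hc⟩ := hend he hek F
    obtain ⟨d, hd⟩ := hend he hek G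
    by_cases hc0 : c = 0
    · by_cases hd0 : d = 0
      · left
        have h0 : ∀ m : LinearMap.range (φ e), m = 0 := by
          intro m
          have h1 := congrArg Subtype.val (LinearMap.congr_fun hFG m)
          change (F m : M) + G m = m at h1
          rw [hc, hd, hc0, hd0, zero_smul, add_zero] at h1
          exact Subtype.ext h1.symm
        exact ⟨fun m m' _ => (h0 m).trans (h0 m').symm, fun m => ⟨0, (h0 _).trans (h0 m).symm⟩⟩
      · exact Or.inr (hbij G d hd0 hd)
    · exact Or.inl (hbij F c hc0 hc)
  have hY : ∀ F : LinearMap.range (φ f) →ₗ[Hᵐᵒᵖ] LinearMap.range (φ f), F.comp F = F →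
      F = 0 ∨ F = LinearMap.id := by
    intro F hF
    obtain ⟨c, hc⟩ := hend hf hfk F
    by_cases hc0 : c = 0
    · left
      ext m
      rw [hc, hc0, zero_smul]; rfl
    · right
      ext m
      have h1 := congrArg Subtype.val (LinearMap.congr_fun hF m)
      rw [LinearMap.comp_apply, hc] at h1
      exact smul_right_injective M hc0 (h1.trans (hc m))
  have hE : ExtZero Hᵐᵒᵖ (LinearMap.range (φ f)) (LinearMap.range (φ e)) :=
    extZero_of_retract (LinearMap.range (φ e)).subtype (φ e).rangeRestrict (hret he)
      (LinearMap.range (φ f)).subtype (φ f).rangeRestrict (hret hf) hext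
  let X : LinearMap.range (φ e) →ₗ[Hᵐᵒᵖ] LinearMap.range (φ f) :=
    LinearMap.codRestrict _ ((φ x).comp (LinearMap.range (φ e)).subtype) (fun m => by
      rw [← hfx]
      exact ⟨φ x m, by rw [LinearMap.comp_apply, hmul]; rfl⟩)
  have hXv : ∀ m, (X m : M) = φ x m := fun m => rfl
  have hX0 : X ≠ 0 := by
    intro h0
    apply hx
    apply φ.injective
    rw [map_zero]
    ext m
    rw [← hxe, hmul]
    exact congrArg Subtype.val (LinearMap.congr_fun h0 ⟨φ e m, m, rfl⟩)
  rcases injective_or_surjective_of_extZero hH hX hY hE X hX0 with h | h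
  · left
    intro y hy hxy
    apply φ.injective
    rw [map_zero]
    ext m
    have h1 : φ y m ∈ LinearMap.range (φ e) := ⟨φ y m, by rw [← hmul, hy]⟩
    have h2 : X ⟨φ y m, h1⟩ = 0 := by
      apply Subtype.ext
      rw [hXv, ← hmul, hxy, map_zero]
      rfl
    exact congrArg Subtype.val (h (h2.trans (map_zero X).symm))
  · right
    intro z hz hzx
    apply φ.injective
    rw [map_zero]
    ext m
    obtain ⟨m', hm'⟩ := h ⟨φ f m, m, rfl⟩
    have h1 : φ x m' = φ f m := congrArg Subtype.val hm'
    rw [← hz, hmul, ← h1, ← hmul, hzx, map_zero]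
    rfl

variable {k : Type u} [Field k] {T : ToupieAlg k}

lemma exactlyOneRel_of_isTilted (hm : mDim T = 0) (h : IsTilted k (Alg T)) (i : Fin T.t) :
    ExactlyOneRel T i := by
  by_contra hi
  obtain ⟨i, a₁, b₁, a₂, b₂, R⟩ := exists_twoRel hm (fun h => hi (h i))
  have := R.lt_left
  have := R.lt_right
  have := R.le_len
  have := R.two_le₁
  have := R.two_le₂
  obtain ⟨c, hc⟩ : ∃ c, c = min a₂ (b₁ - 1) := ⟨_, rfl⟩
  obtain ⟨d, hd⟩ : ∃ d, d = max b₁ (a₂ + 1) := ⟨_, rfl⟩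
  have hk : ∀ a ≤ T.ℓ i, ∀ x, ∃ r : k,
      ev T (vtx T.t T.ℓ i a) * x * ev T (vtx T.t T.ℓ i a) = r • ev T (vtx T.t T.ℓ i a) := by
    intro a ha x
    rw [← pp_self]
    simpa only [pp_self] using corner_vtx hm i ha ha x
  rcases cancel_of_isTilted h (ev_mul_self _) (ev_mul_self _) (hk d (by omega)) (hk c (by omega))
    (ev_mul_pp i c d) (pp_mul_ev i c d) (R.ne_zero c d (by omega) (by omega) (by omega)) with h | h
  · refine R.ne_zero₂ d (by omega) (by omega) (h _ (ev_mul_pp i d b₂) ?_)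
    rw [pp_mul_pp i (by omega) (by omega)]
    exact pp_eq_zero_of_le R.zero₂ (by omega) (by omega) (by omega)
  · refine R.ne_zero₁ c (by omega) (by omega) (h _ (pp_mul_ev i a₁ c) ?_)
    rw [pp_mul_pp i (by omega) (by omega)]
    exact pp_eq_zero_of_le R.zero₁ (by omega) (by omega) (by omega)

end TiltedImplies

section QuasitiltedImplies

/-- A submodule of a projective module whose quotient has projective dimension at most one
is projective. -/
lemma projective_of_pdLeOne_quotient {R : Type u} [Ring R] {Q : Type u} [AddCommGroup Q]
    [Module R Q] [Module.Projective R Q] (J : Submodule R Q)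
    (h : PdLeOne R (.of R (Q ⧸ J))) : Module.Projective R J := by
  obtain ⟨P, f, hf, hP, hK⟩ := h
  change P →ₗ[R] (Q ⧸ J) at f
  obtain ⟨g, hg⟩ := Module.projective_lifting_property f J.mkQ hf
  obtain ⟨h, hh⟩ := Module.projective_lifting_property J.mkQ f J.mkQ_surjective
  have hg' : ∀ q, f (g q) = J.mkQ q := fun q => LinearMap.congr_fun hg q
  have hh' : ∀ p, J.mkQ (h p) = f p := fun p => LinearMap.congr_fun hh p
  have hhK : ∀ x : LinearMap.ker f, h x ∈ J := fun x => by
    have := hh' x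
    rw [LinearMap.mem_ker.1 x.2] at this
    simpa using this
  have hgJ : ∀ x : J, g x ∈ LinearMap.ker f := fun x => by
    rw [LinearMap.mem_ker, hg']
    simp
  have hd : ∀ q, q - h (g q) ∈ J := fun q => by
    rw [← Submodule.Quotient.mk_eq_zero J, ← Submodule.mkQ_apply, map_sub, hh', hg', sub_self]
  apply Module.Projective.of_lifting_property''
  intro ρ hρ
  obtain ⟨σ₁, hσ₁⟩ := Module.projective_lifting_property ρ
    (LinearMap.codRestrict J (h.comp (LinearMap.ker f).subtype) hhK) hρ
  obtain ⟨σ₂, hσ₂⟩ := Module.projective_lifting_property ρ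
    (LinearMap.codRestrict J (LinearMap.id - h.comp g) hd) hρ
  refine ⟨σ₁.comp (LinearMap.codRestrict _ (g.comp J.subtype) hgJ) + σ₂.comp J.subtype, ?_⟩
  ext x
  have h1 := congrArg Subtype.val (LinearMap.congr_fun hσ₁ ⟨g x, hgJ x⟩)
  have h2 := congrArg Subtype.val (LinearMap.congr_fun hσ₂ (x : Q))
  change ((ρ (σ₁ ⟨g x, hgJ x⟩) : J) : Q) = h (g x) at h1
  change ((ρ (σ₂ (x : Q)) : J) : Q) = x - h (g x) at h2
  change ((ρ (σ₁ ⟨g x, hgJ x⟩ + σ₂ (x : Q)) : J) : Q) = x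
  rw [map_add, Submodule.coe_add, h1, h2, add_sub_cancel]

/-- The left part is closed under nonzero maps into it from indecomposables. -/
lemma inLeftPart_of_hom {R : Type u} [Ring R] {X Y : ModuleCat.{u} R} (hY : InLeftPart R Y)
    (hX : Indec R X) (hXf : FdMod R X) (f : X →ₗ[R] Y) (hf : f ≠ 0) : InLeftPart R X := by
  refine ⟨hX, hXf, fun Z hZ hZf hp => ?_⟩
  by_cases hb : Function.Bijective f
  · rcases Relation.ReflTransGen.cases_tail hp with rfl | ⟨Z', h1, h2⟩
    · exact pdLeOne_congr (LinearEquiv.ofBijective f hb).symm (hY.2.2 Y hY.1 hY.2.1 .refl)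
    · obtain ⟨h3, h4, -, -, g, hg0, hgb⟩ := h2
      refine hY.2.2 Z hZ hZf (h1.tail ⟨h3, h4, hY.1, hY.2.1, f.comp g, ?_, ?_⟩)
      · intro h0
        apply hg0
        ext z
        apply hb.1
        rw [LinearMap.zero_apply, map_zero]
        exact LinearMap.congr_fun h0 z
      · intro h0
        apply hgb
        exact (Function.Bijective.of_comp_iff' hb g).1 h0
  · exact hY.2.2 Z hZ hZf (hp.tail ⟨hX, hXf, hY.1, hY.2.1, f, hf, hb⟩)

section

variable {A : Type u} [Ring A]

/-- The right regular module. -/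
def opRegular (A : Type u) [Ring A] : Aᵐᵒᵖ ≃ₗ[Aᵐᵒᵖ] A where
  toFun := unop
  invFun := op
  map_add' _ _ := rfl
  map_smul' _ _ := rfl
  left_inv _ := rfl
  right_inv _ := rfl

instance : Module.Finite Aᵐᵒᵖ A := Module.Finite.equiv (opRegular A)

instance : Module.Projective Aᵐᵒᵖ A := Module.Projective.of_equiv (opRegular A)

/-- The right ideal of all `a` with `e * a ∈ x * A`. -/
def cycIdeal (e x : A) : Submodule Aᵐᵒᵖ A where
  carrier := {a | ∃ b, e * a = x * b}
  add_mem' := by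
    rintro a b ⟨c, hc⟩ ⟨d, hd⟩
    exact ⟨c + d, by rw [mul_add, mul_add, hc, hd]⟩
  zero_mem' := ⟨0, by simp⟩
  smul_mem' := by
    rintro r a ⟨c, hc⟩
    exact ⟨c * r.unop, by rw [MulOpposite.smul_eq_mul_unop, ← mul_assoc, hc, mul_assoc]⟩

/-- The cyclic right module `e A / x A`. -/
abbrev Cyc (e x : A) : Type u := A ⧸ cycIdeal e x

lemma mkQ_mul (e x a b : A) :
    (cycIdeal e x).mkQ (a * b) = op b • (cycIdeal e x).mkQ a := by
  rw [← map_smul]; rfl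

lemma mkQ_idem_mul {e x : A} (he : e * e = e) (a : A) :
    (cycIdeal e x).mkQ (e * a) = (cycIdeal e x).mkQ a := by
  rw [← sub_eq_zero, ← map_sub, Submodule.mkQ_apply, Submodule.Quotient.mk_eq_zero]
  exact ⟨0, by rw [mul_sub, ← mul_assoc, he, sub_self, mul_zero]⟩

lemma indec_cyc {k : Type u} [Field k] [Algebra k A] {e x : A} (he : e * e = e)
    (hk : ∀ a : A, ∃ c : k, e * a * e = c • e) (hx : ∀ b, e ≠ x * b) :
    Indec Aᵐᵒᵖ (.of Aᵐᵒᵖ (Cyc e x)) := by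
  set J := cycIdeal e x
  have h1 : J.mkQ 1 ≠ 0 := by
    rw [Ne, Submodule.mkQ_apply, Submodule.Quotient.mk_eq_zero]
    rintro ⟨b, hb⟩
    exact hx b (by rw [← hb, mul_one])
  refine ⟨⟨J.mkQ 1, 0, h1⟩, ?_⟩
  change ∀ f : Cyc e x →ₗ[Aᵐᵒᵖ] Cyc e x, _
  intro f hf
  obtain ⟨y, hy⟩ := J.mkQ_surjective (f (J.mkQ 1))
  obtain ⟨c, hc⟩ := hk y
  have hf1 : f (J.mkQ 1) = J.mkQ (c • (1 : A)) := by
    have h2 : J.mkQ 1 = op e • J.mkQ 1 := by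
      rw [← mkQ_mul, one_mul, ← mkQ_idem_mul he 1, mul_one]
    rw [h2, map_smul, ← hy, ← mkQ_mul, ← mkQ_idem_mul he, ← mul_assoc, hc,
      ← mkQ_idem_mul he (c • 1), mul_smul_comm, mul_one]
  have hfa : ∀ a, f (J.mkQ a) = J.mkQ (c • a) := by
    intro a
    rw [← one_mul a, mkQ_mul, map_smul, hf1, ← mkQ_mul, smul_mul_assoc]
  by_cases hc0 : c = 0
  · left
    apply LinearMap.ext
    intro z
    obtain ⟨a, rfl⟩ := J.mkQ_surjective z
    rw [hfa, hc0, zero_smul, map_zero]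
    rfl
  · right
    have h3 := LinearMap.congr_fun hf (J.mkQ (c⁻¹ • 1))
    rw [LinearMap.comp_apply, hfa, hfa, smul_smul c c⁻¹, mul_inv_cancel₀ hc0, one_smul] at h3
    apply LinearMap.ext
    intro z
    obtain ⟨a, rfl⟩ := J.mkQ_surjective z
    change _ = J.mkQ a
    rw [hfa]
    have h4 : op a • J.mkQ (c • (1 : A)) = op a • J.mkQ 1 := by rw [h3]
    rw [← mkQ_mul, ← mkQ_mul, smul_mul_assoc, one_mul] at h4
    exact h4

lemma fdMod_cyc (e x : A) : FdMod Aᵐᵒᵖ (.of Aᵐᵒᵖ (Cyc e x)) :=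
  Module.Finite.of_surjective (cycIdeal e x).mkQ (Submodule.mkQ_surjective _)

lemma projective_cyc {e x : A} (he : e * e = e) (hx : x = 0) :
    Module.Projective Aᵐᵒᵖ (Cyc e x) := by
  subst hx
  refine Module.Projective.of_split (M := A) ((cycIdeal e 0).liftQ (LinearMap.mulLeft Aᵐᵒᵖ e) ?_)
    (cycIdeal e 0).mkQ ?_
  · rintro a ⟨b, hb⟩
    rw [LinearMap.mem_ker, LinearMap.mulLeft_apply, hb, zero_mul]
  · apply LinearMap.ext
    intro z
    obtain ⟨a, rfl⟩ := (cycIdeal e 0).mkQ_surjective z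
    exact mkQ_idem_mul he a

/-- Left multiplication between cyclic modules. -/
lemma exists_cyc_hom {e x e' x' y : A} (hye : y * e = y) (hey : e' * y = y)
    (hyx : ∃ b, y * x = x' * b) (hy : ∀ b, y ≠ x' * b) :
    ∃ f : Cyc e x →ₗ[Aᵐᵒᵖ] Cyc e' x', f ≠ 0 := by
  refine ⟨(cycIdeal e x).liftQ ((cycIdeal e' x').mkQ.comp (LinearMap.mulLeft Aᵐᵒᵖ y)) ?_, ?_⟩
  · rintro a ⟨b, hb⟩
    rw [LinearMap.mem_ker, LinearMap.comp_apply, Submodule.mkQ_apply,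
      Submodule.Quotient.mk_eq_zero, LinearMap.mulLeft_apply]
    obtain ⟨c, hc⟩ := hyx
    exact ⟨c * b, by rw [← mul_assoc, hey, ← hye, mul_assoc, hb, ← mul_assoc, hc, mul_assoc]⟩
  · intro h0
    have h1 := LinearMap.congr_fun h0 ((cycIdeal e x).mkQ 1)
    change (cycIdeal e' x').mkQ (y * 1) = 0 at h1
    rw [mul_one, Submodule.mkQ_apply, Submodule.Quotient.mk_eq_zero] at h1
    obtain ⟨b, hb⟩ := h1
    exact hy b (by rw [← hb, hey])

lemma not_pdLeOne_cyc {k : Type u} [Field k] [Algebra k A] {e x f q : A} (he : e * e = e)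
    (hex : e * x = x) (hxf : x * f = x) (hfk : ∀ a : A, ∃ c : k, f * a * f = c • f)
    (hfq : f * q = q) (hxq : x * q = 0) (hx : x ≠ 0) (hq : q ≠ 0) :
    ¬ PdLeOne Aᵐᵒᵖ (.of Aᵐᵒᵖ (Cyc e x)) := by
  intro h
  have hJ := projective_of_pdLeOne_quotient (cycIdeal e x) h
  have he1 : ∀ a, e * ((1 - e) * a) = 0 := fun a => by
    rw [← mul_assoc, mul_sub, mul_one, he, sub_self, zero_mul]
  let ρ : A × A →ₗ[Aᵐᵒᵖ] cycIdeal e x := LinearMap.codRestrict _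
    ((LinearMap.mulLeft Aᵐᵒᵖ (1 - e)).coprod (LinearMap.mulLeft Aᵐᵒᵖ x)) (fun z => by
      refine ⟨z.2, ?_⟩
      change e * ((1 - e) * z.1 + x * z.2) = _
      rw [mul_add, he1, zero_add, ← mul_assoc, hex])
  have hρ : ∀ u v, (ρ (u, v) : A) = (1 - e) * u + x * v := fun u v => rfl
  obtain ⟨s, hs⟩ := Module.projective_lifting_property ρ LinearMap.id (by
    rintro ⟨a, b, hb⟩
    refine ⟨(a, b), Subtype.ext ?_⟩
    rw [hρ, ← hb, ← add_mul, sub_add_cancel, one_mul])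
  let xJ : cycIdeal e x := ⟨x, 1, by rw [hex, mul_one]⟩
  rcases hsx : s xJ with ⟨u, v⟩
  have h1 : (1 - e) * u + x * v = x := by
    have := congrArg Subtype.val (LinearMap.congr_fun hs xJ)
    rw [LinearMap.comp_apply, hsx, hρ] at this
    exact this
  have h2 : x * v = x := by
    have := congrArg (fun z => e * z) h1
    simp only [mul_add, he1, zero_add, ← mul_assoc, hex] at this
    exact this
  obtain ⟨c, hc⟩ := hfk v
  have h3 : c • x = x := by
    conv_rhs => rw [← hxf, ← h2, ← hxf]
    rw [mul_assoc, mul_assoc, ← mul_assoc f, hc, mul_smul_comm, hxf]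
  have h4 : c = 1 := by
    have : (c - 1) • x = 0 := by rw [sub_smul, h3, one_smul, sub_self]
    exact sub_eq_zero.1 ((smul_eq_zero.1 this).resolve_right hx)
  have h5 : op q • xJ = 0 := Subtype.ext hxq
  have h6 := map_smul s (op q) xJ
  rw [h5, map_zero, hsx] at h6
  have h7 : v * q = 0 := (congrArg Prod.snd h6).symm
  apply hq
  rw [← hfq, ← one_smul k f, ← h4, ← hc, mul_assoc, hfq, mul_assoc, h7, mul_zero]

end

variable {k : Type u} [Field k] {T : ToupieAlg k}

/-- The cyclic module on branch `i` starting at position `c` and stopping before position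
`d`. -/
abbrev SegMod (T : ToupieAlg k) (i : Fin T.t) (c d : ℕ) : Type u :=
  Cyc (ev T (vtx T.t T.ℓ i c)) (pp T i c d)

lemma corner_ev (hm : mDim T = 0) (v : Vtx T.t T.ℓ) (x : Alg T) :
    ∃ r : k, ev T v * x * ev T v = r • ev T v := by
  rw [← pathOf_self]
  simpa only [pathOf_self] using corner hm v v x

lemma pp_ne_pp_mul (hm : mDim T = 0) {i : Fin T.t} {a c d : ℕ} (hcd : c < d)
    (hd : d ≤ T.ℓ i) (h : pp T i a c ≠ 0) (b : Alg T) : pp T i a c ≠ pp T i a d * b := by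
  intro h0
  obtain ⟨r, hr⟩ := corner_vtx hm i hd (hcd.le.trans hd) b
  apply h
  rw [← pp_mul_ev, h0, ← pp_mul_ev, mul_assoc, mul_assoc, ← mul_assoc _ b, hr, pp_of_gt hcd,
    smul_zero, mul_zero]

lemma indec_segMod (hm : mDim T = 0) {i : Fin T.t} {c d : ℕ} (hcd : c < d) (hd : d ≤ T.ℓ i) :
    Indec (Alg T)ᵐᵒᵖ (.of (Alg T)ᵐᵒᵖ (SegMod T i c d)) := by
  refine indec_cyc (k := k) (ev_mul_self _) (corner_ev hm _) ?_
  rw [← pp_self]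
  exact pp_ne_pp_mul hm hcd hd (pp_self_ne_zero _ _)

lemma inLeftPart_segMod (hm : mDim T = 0) {i : Fin T.t} {c d c' d' : ℕ} (h₁ : c' ≤ c)
    (h₂ : c < d') (h₃ : d' ≤ d) (hd : d ≤ T.ℓ i) (h : pp T i c' c ≠ 0)
    (hL : InLeftPart (Alg T)ᵐᵒᵖ (.of (Alg T)ᵐᵒᵖ (SegMod T i c' d'))) :
    InLeftPart (Alg T)ᵐᵒᵖ (.of (Alg T)ᵐᵒᵖ (SegMod T i c d)) := by
  obtain ⟨f, hf⟩ := exists_cyc_hom (e := ev T (vtx T.t T.ℓ i c)) (x := pp T i c d)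
    (e' := ev T (vtx T.t T.ℓ i c')) (x' := pp T i c' d') (y := pp T i c' c)
    (pp_mul_ev _ _ _) (ev_mul_pp _ _ _)
    ⟨pp T i d' d, by rw [pp_mul_pp i h₁ (by omega), pp_mul_pp i (by omega) h₃]⟩
    (pp_ne_pp_mul hm h₂ (by omega) h)
  exact inLeftPart_of_hom hL (indec_segMod hm (by omega) hd) (fdMod_cyc _ _) f hf

lemma exactlyOneRel_of_quasitilted (hm : mDim T = 0) (h : Quasitilted (Alg T)ᵐᵒᵖ)
    (i : Fin T.t) : ExactlyOneRel T i := by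
  by_contra hi
  obtain ⟨i, a₁, b₁, a₂, b₂, R⟩ := exists_twoRel hm (fun h => hi (h i))
  have := R.lt_left
  have := R.lt_right
  have := R.le_len
  have := R.two_le₁
  have := R.two_le₂
  have hP : InLeftPart (Alg T)ᵐᵒᵖ (.of (Alg T)ᵐᵒᵖ (SegMod T i a₁ b₁)) := by
    refine h _ (indec_segMod hm (by omega) (by omega)) (fdMod_cyc _ _) ?_
    exact projective_cyc (ev_mul_self _) R.zero₁
  have hnot : ∀ d, a₂ < d → d < b₂ →
      ¬ PdLeOne (Alg T)ᵐᵒᵖ (.of (Alg T)ᵐᵒᵖ (SegMod T i a₂ d)) := by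
    intro d h1 h2
    refine not_pdLeOne_cyc (k := k) (q := pp T i d b₂) (ev_mul_self _) (ev_mul_pp _ _ _)
      (pp_mul_ev _ _ _) (corner_ev hm _) (ev_mul_pp _ _ _) ?_ (R.ne_zero _ _ (by omega) h1.le h2)
      (R.ne_zero₂ _ h1 h2.le)
    rw [pp_mul_pp i h1.le h2.le, R.zero₂]
  have hfin : ∀ d, a₂ < d → d < b₂ →
      ¬ InLeftPart (Alg T)ᵐᵒᵖ (.of (Alg T)ᵐᵒᵖ (SegMod T i a₂ d)) :=
    fun d h1 h2 hL => hnot d h1 h2 (hL.2.2 _ hL.1 hL.2.1 .refl)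
  rcases lt_or_ge a₂ b₁ with hlt | hge
  · exact hfin b₁ hlt (by omega) (inLeftPart_segMod hm (by omega) (by omega) le_rfl (by omega)
      (R.ne_zero₁ _ (by omega) hlt) hP)
  · have h1 : InLeftPart (Alg T)ᵐᵒᵖ (.of (Alg T)ᵐᵒᵖ (SegMod T i (b₁ - 1) b₁)) :=
      inLeftPart_segMod hm (by omega) (by omega) le_rfl (by omega)
        (R.ne_zero₁ _ (by omega) (by omega)) hP
    have h2 : InLeftPart (Alg T)ᵐᵒᵖ (.of (Alg T)ᵐᵒᵖ (SegMod T i (b₁ - 1) (a₂ + 1))) :=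
      inLeftPart_segMod hm le_rfl (by omega) (by omega) (by omega) (pp_self_ne_zero _ _) h1
    exact hfin (a₂ + 1) (by omega) (by omega) (inLeftPart_segMod hm (by omega) (by omega) le_rfl
      (by omega) (R.ne_zero _ _ (by omega) (by omega) (by omega)) h2)

end QuasitiltedImplies

section Filtration

variable {B : Type u} [Ring B]

lemma projective_of_generators {M : Type u} [AddCommGroup M] [Module B M] {ι : Type} [Fintype ι]
    (y : ι → M) (e : ι → B) (he : ∀ j, e j • y j = y j)
    (hgen : ∀ x : M, ∃ b : ι → B, x = ∑ j, b j • y j)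
    (hinj : ∀ b : ι → B, ∑ j, b j • y j = 0 → ∀ j, b j * e j = 0) : Module.Projective B M := by
  let s : (ι → B) →ₗ[B] M :=
    ∑ j, (LinearMap.toSpanSingleton B M (y j)).comp (LinearMap.proj j)
  have hs : ∀ b, s b = ∑ j, b j • y j := fun b => by simp [s]
  have hsurj : Function.Surjective s := fun x => by
    obtain ⟨b, rfl⟩ := hgen x
    exact ⟨b, hs b⟩
  let g : (ι → B) →ₗ[B] (ι → B) :=
    LinearMap.pi fun j => (LinearMap.toSpanSingleton B B (e j)).comp (LinearMap.proj j)
  have hg : ∀ b j, g b j = b j * e j := fun b j => rfl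
  have hk : LinearMap.ker s ≤ LinearMap.ker g := by
    intro b hb
    rw [LinearMap.mem_ker, hs] at hb
    rw [LinearMap.mem_ker]
    funext j
    exact hinj b hb j
  refine Module.Projective.of_split (((LinearMap.ker s).liftQ g hk).comp
    (s.quotKerEquivOfSurjective hsurj).symm.toLinearMap) s ?_
  apply LinearMap.ext
  intro x
  obtain ⟨b, rfl⟩ := hsurj x
  have : (s.quotKerEquivOfSurjective hsurj).symm (s b) = (LinearMap.ker s).mkQ b := by
    rw [LinearEquiv.symm_apply_eq]
    rfl
  change s (((LinearMap.ker s).liftQ g hk) ((s.quotKerEquivOfSurjective hsurj).symm (s b))) = s b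
  rw [this]
  change s (g b) = s b
  rw [hs, hs]
  refine Finset.sum_congr rfl fun j _ => ?_
  rw [hg, mul_smul, he]

/-- The submodule generated by the elements fixed by `e`. -/
def trace (e : B) (N : Type u) [AddCommGroup N] [Module B N] : Submodule B N :=
  Submodule.span B {n | e • n = n}

lemma smul_mem_trace {e : B} (he : e * e = e) {N : Type u} [AddCommGroup N] [Module B N] (n : N) :
    e • n ∈ trace e N :=
  Submodule.subset_span (by rw [Set.mem_ofPred_eq, ← mul_smul, he])

lemma projective_comap_mulRight {e : B} (he : e * e = e) (J : Submodule B B)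
    (hJe : ∀ x ∈ J, x * e = x) [Module.Projective B J] :
    Module.Projective B (J.comap (LinearMap.toSpanSingleton B B e)) := by
  have hmem : ∀ b, b ∈ J.comap (LinearMap.toSpanSingleton B B e) ↔ b * e ∈ J := fun b => Iff.rfl
  refine Module.Projective.of_split (M := J × B)
    (LinearMap.prod
      (LinearMap.codRestrict J ((LinearMap.toSpanSingleton B B e).comp (Submodule.subtype _))
        (fun b => b.2))
      (Submodule.subtype _))
    (LinearMap.codRestrict _ (J.subtype.coprod (LinearMap.toSpanSingleton B B (1 - e)))
      (fun z => ?_)) ?_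
  · rw [hmem]
    change (z.1.1 + z.2 * (1 - e)) * e ∈ J
    rw [add_mul, mul_assoc, sub_mul, one_mul, he, sub_self, mul_zero, add_zero, hJe _ z.1.2]
    exact z.1.2
  · apply LinearMap.ext
    intro b
    apply Subtype.ext
    change b.1 * e + b.1 * (1 - e) = b.1
    rw [← mul_add, add_sub_cancel, mul_one]

lemma trace_piece {k : Type u} [Field k] [Algebra k B] {W : Type} {e : B} (he : e * e = e)
    (f p : W → B) (hfp : ∀ b w, ∃ c : k, f w * b * e = c • p w)
    (J : Submodule B B) (hJ : ∀ x, x ∈ J ↔ x * e = x ∧ ∀ w, f w * x = 0)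
    [Module.Projective B J]
    (N : Type u) [AddCommGroup N] [Module B N]
    (htf : ∀ w, ∀ n : N, e • n = n → p w • n = 0 → n = 0)
    (hJN : ∀ x ∈ J, ∀ n : N, e • n = n → x • n = 0) :
    PdLeOne B (.of B (trace e N)) ∧
      ∀ (X : Type u) [AddCommGroup X] [Module B X],
        (∃ g : B, (∀ x ∈ J, g * x = x) ∧ ∀ y : X, g • y = 0) → ExtZero B (trace e N) X := by
  let _ : Module k N := Module.compHom N (algebraMap k B)
  have hk : ∀ (c : k) (n : N), c • n = (algebraMap k B c) • n := fun _ _ => rfl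
  have hkb : ∀ (c : k) (b : B) (n : N), (c • b) • n = c • b • n := fun c b n => by
    rw [hk, Algebra.smul_def, mul_smul]
  have hbk : ∀ (c : k) (b : B) (n : N), b • c • n = c • b • n := fun c b n => by
    rw [hk, hk, ← mul_smul, ← mul_smul, Algebra.commutes]
  let Nfix : Submodule k N :=
    { carrier := {n | e • n = n}
      add_mem' := fun {a b} ha hb => by
        rw [Set.mem_ofPred_eq] at *
        rw [smul_add, ha, hb]
      zero_mem' := smul_zero _
      smul_mem' := fun c n hn => by
        rw [Set.mem_ofPred_eq] at *
        rw [hbk, hn] }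
  let bs := Module.Basis.ofVectorSpace k Nfix
  let ι := Module.Basis.ofVectorSpaceIndex k Nfix
  have hbe : ∀ i : ι, e • (bs i : N) = bs i := fun i => (bs i).2
  let F : (ι →₀ B) →ₗ[B] trace e N := Finsupp.linearCombination B
    fun i => ⟨bs i, Submodule.subset_span (hbe i)⟩
  have hF : ∀ b : ι →₀ B, (F b : N) = b.sum fun i r => r • (bs i : N) := by
    intro b
    rw [Finsupp.linearCombination_apply, Finsupp.sum, Finsupp.sum, AddSubmonoidClass.coe_finsetSum]
    rfl
  have hNe : ∀ n : N, e • n = n → ∃ b : ι →₀ B, (F b : N) = n := by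
    intro n hn
    refine ⟨(bs.repr ⟨n, hn⟩).mapRange (algebraMap k B) (map_zero _), ?_⟩
    rw [hF, Finsupp.sum_mapRange_index (h := fun i r => r • (bs i : N)) fun i => zero_smul B _]
    have := congrArg Subtype.val (bs.linearCombination_repr ⟨n, hn⟩)
    rw [Finsupp.linearCombination_apply, Finsupp.sum, AddSubmonoidClass.coe_finsetSum] at this
    exact this
  have hFsurj : Function.Surjective F := by
    have : ∀ n ∈ trace e N, ∃ b : ι →₀ B, (F b : N) = n := by
      intro n hn
      induction hn using Submodule.span_induction with
      | mem n hn => exact hNe n hn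
      | zero => exact ⟨0, by rw [map_zero]; rfl⟩
      | add x y _ _ h1 h2 =>
        obtain ⟨b, hb⟩ := h1
        obtain ⟨c, hc⟩ := h2
        exact ⟨b + c, by rw [map_add, Submodule.coe_add, hb, hc]⟩
      | smul r x _ h =>
        obtain ⟨b, hb⟩ := h
        exact ⟨r • b, by rw [map_smul, Submodule.coe_smul, hb]⟩
    rintro ⟨n, hn⟩
    obtain ⟨b, hb⟩ := this n hn
    exact ⟨b, Subtype.ext hb⟩
  have hJe : ∀ x ∈ J, x * e = x := fun x hx => ((hJ x).1 hx).1
  let J' : Submodule B B := J.comap (LinearMap.toSpanSingleton B B e)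
  have hJ' : ∀ b, b ∈ J' ↔ b * e ∈ J := fun b => Iff.rfl
  have hJ'proj : Module.Projective B J' := projective_comap_mulRight he J hJe
  have hker : ∀ b : ι →₀ B, b ∈ LinearMap.ker F ↔ ∀ i, b i ∈ J' := by
    intro b
    rw [LinearMap.mem_ker]
    constructor
    · intro h0 i
      rw [hJ', hJ]
      refine ⟨by rw [mul_assoc, he], fun w => ?_⟩
      have h1 : (b.sum fun i r => r • (bs i : N)) = 0 := by
        rw [← hF, h0]; rfl
      choose c hc using fun i => hfp (b i) w
      have h2 : p w • (∑ i ∈ b.support, c i • (bs i : N)) = 0 := by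
        have h3 := congrArg (fun n => f w • n) h1
        simp only [smul_zero, Finsupp.sum, Finset.smul_sum] at h3
        rw [← h3, Finset.smul_sum]
        refine Finset.sum_congr rfl fun i _ => ?_
        rw [hbk, ← hkb, ← hc, mul_smul, hbe, mul_smul]
      have h3 := htf w _ (by
        rw [Finset.smul_sum]
        exact Finset.sum_congr rfl fun i _ => by rw [hbk, hbe]) h2
      have h4 : ∑ i ∈ b.support, c i • bs i = 0 := by
        apply Subtype.ext
        rw [AddSubmonoidClass.coe_finsetSum]
        exact h3
      by_cases hi : i ∈ b.support
      · have h5 := linearIndependent_iff'.1 bs.linearIndependent _ _ h4 i hi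
        rw [← mul_assoc, hc, h5, zero_smul]
      · rw [Finsupp.notMem_support_iff.1 hi, zero_mul, mul_zero]
    · intro h
      apply Subtype.ext
      rw [hF]
      refine Finset.sum_eq_zero fun i _ => ?_
      have := hJN _ ((hJ' _).1 (h i)) (bs i) (hbe i)
      rwa [mul_smul, hbe] at this
  constructor
  · refine ⟨.of B (ι →₀ B), F, hFsurj, inferInstanceAs (Module.Projective B (ι →₀ B)), ?_⟩
    let G : (ι →₀ J') →ₗ[B] (ι →₀ B) := Finsupp.mapRange.linearMap J'.subtype
    have hG : LinearMap.range G = LinearMap.ker F := by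
      ext b
      rw [hker]
      constructor
      · rintro ⟨c, rfl⟩ i
        exact (c i).2
      · intro h
        refine ⟨⟨b.support, fun i => ⟨b i, h i⟩, fun i => ?_⟩, ?_⟩
        · rw [Finsupp.mem_support_iff, Ne, Ne, ← Subtype.coe_inj]
          rfl
        · ext i
          rfl
    rw [← hG]
    have hGi : Function.Injective G := Finsupp.mapRange_injective _ rfl Subtype.val_injective
    have : Module.Projective B (ι →₀ J') :=
      Module.Projective.of_equiv (finsuppLequivDFinsupp B).symm
    exact Module.Projective.of_equiv (LinearEquiv.ofInjective G hGi)
  · rintro X _ _ ⟨g, hg, hgX⟩ E _ _ i π hi hπ hex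
    have hlift : ∀ j : ι, ∃ z : E, (π z : N) = bs j ∧ e • z = z := by
      intro j
      obtain ⟨z, hz⟩ := hπ ⟨bs j, Submodule.subset_span (hbe j)⟩
      refine ⟨e • z, ?_, by rw [← mul_smul, he]⟩
      rw [map_smul, hz]
      exact hbe j
    choose z hz hez using hlift
    let Z : (ι →₀ B) →ₗ[B] E := Finsupp.linearCombination B z
    have hZ : ∀ b : ι →₀ B, Z b = b.sum fun i r => r • z i := fun b =>
      Finsupp.linearCombination_apply _ _
    have hπZ : ∀ b, π (Z b) = F b := by
      intro b
      apply Subtype.ext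
      rw [hF, hZ, Finsupp.sum, Finsupp.sum, map_sum, AddSubmonoidClass.coe_finsetSum]
      refine Finset.sum_congr rfl fun i _ => ?_
      rw [map_smul, Submodule.coe_smul, hz]
    have hle : LinearMap.ker F ≤ LinearMap.ker Z := by
      intro b hb
      rw [hker] at hb
      rw [LinearMap.mem_ker, hZ]
      refine Finset.sum_eq_zero fun j _ => ?_
      have h1 := (hJ' _).1 (hb j)
      change b j • z j = 0
      rw [← hez, ← mul_smul]
      have h2 : (b j * e) • z j ∈ LinearMap.ker π := by
        rw [LinearMap.mem_ker, map_smul]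
        apply Subtype.ext
        rw [Submodule.coe_smul, hz]
        exact hJN _ h1 _ (hbe j)
      rw [← hex] at h2
      obtain ⟨x, hx⟩ := h2
      rw [← hg _ h1, mul_smul, ← hx, ← map_smul, hgX, map_zero]
    refine ⟨((LinearMap.ker F).liftQ Z hle).comp
      (F.quotKerEquivOfSurjective hFsurj).symm.toLinearMap, ?_⟩
    apply LinearMap.ext
    intro n
    obtain ⟨b, rfl⟩ := hFsurj n
    have : (F.quotKerEquivOfSurjective hFsurj).symm (F b) = (LinearMap.ker F).mkQ b := by
      rw [LinearEquiv.symm_apply_eq]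
      rfl
    change π (((LinearMap.ker F).liftQ Z hle) ((F.quotKerEquivOfSurjective hFsurj).symm (F b))) =
      F b
    rw [this]
    exact hπZ b

/-- Induction along the filtration of a module by the submodules generated at the vertices,
taken in order of increasing rank. -/
lemma filtration_induction {V : Type} [Fintype V] (e : V → B) (he : ∀ v, e v * e v = e v)
    (hsum : ∑ v, e v = 1) (r : V → ℕ) (Q P : ModuleCat.{u} B → Prop)
    (hzero : ∀ N : ModuleCat.{u} B, (∀ n : N, n = 0) → P N)
    (hext : ∀ (M : Type u) [AddCommGroup M] [Module B M] (N : Submodule B M),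
      P (.of B N) → P (.of B (M ⧸ N)) → P (.of B M))
    (hstep : ∀ (N : Type u) [AddCommGroup N] [Module B N], Q (.of B N) →
      ∀ v, (∀ u, r u < r v → ∀ n : N, e u • n = 0) →
        P (.of B (trace (e v) N)) ∧ Q (.of B (N ⧸ trace (e v) N)))
    (N : Type u) [AddCommGroup N] [Module B N] (hN : Q (.of B N)) : P (.of B N) := by
  induction hc : (Finset.univ.filter fun v => ∃ n : N, e v • n ≠ 0).card using
    Nat.strong_induction_on generalizing N with
  | _ c ih =>
    rcases (Finset.univ.filter fun v => ∃ n : N, e v • n ≠ 0).eq_empty_or_nonempty with h0 | h0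
    · apply hzero
      intro n
      change N at n
      change n = 0
      rw [← one_smul B n, ← hsum, Finset.sum_smul]
      refine Finset.sum_eq_zero fun v _ => ?_
      by_contra h
      have : v ∈ Finset.univ.filter fun v => ∃ n : N, e v • n ≠ 0 := by
        simp only [Finset.mem_filter, Finset.mem_univ, true_and]
        exact ⟨n, h⟩
      rw [h0] at this
      simp at this
    · obtain ⟨v, hv, hmin⟩ := Finset.exists_min_image _ r h0
      obtain ⟨h1, h2⟩ := hstep N hN v (by
        intro u hu n
        by_contra h
        have := hmin u (by
          simp only [Finset.mem_filter, Finset.mem_univ, true_and]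
          exact ⟨n, h⟩)
        omega)
      refine hext N _ h1 (ih _ ?_ _ h2 rfl)
      rw [← hc]
      apply Finset.card_lt_card
      rw [Finset.ssubset_iff_of_subset]
      · refine ⟨v, hv, ?_⟩
        simp only [Finset.mem_filter, Finset.mem_univ, true_and, not_exists, not_not]
        intro n
        obtain ⟨n, rfl⟩ := Submodule.mkQ_surjective _ n
        rw [← map_smul, Submodule.mkQ_apply, Submodule.Quotient.mk_eq_zero]
        exact smul_mem_trace (he v) n
      · intro u hu
        simp only [Finset.mem_filter, Finset.mem_univ, true_and] at hu ⊢
        obtain ⟨n, hn⟩ := hu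
        obtain ⟨n, rfl⟩ := Submodule.mkQ_surjective _ n
        refine ⟨n, fun h => hn ?_⟩
        rw [← map_smul, h, map_zero]

end Filtration

section LowHigh

variable {k : Type u} [Field k] {T : ToupieAlg k}

/-- Branch `i` carries exactly one zero-relation, namely the path from its `a i`-th to its
`b i`-th vertex. -/
structure OneRel (T : ToupieAlg k) (a b : Fin T.t → ℕ) : Prop where
  two_le : ∀ i, a i + 2 ≤ b i
  le_len : ∀ i, b i ≤ T.ℓ i
  pp_eq_zero_iff : ∀ i c d, c ≤ d → d ≤ T.ℓ i → (pp T i c d = 0 ↔ c ≤ a i ∧ b i ≤ d)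

lemma exists_oneRel (h : ∀ i, ExactlyOneRel T i) : ∃ a b, OneRel T a b := by
  choose a b h1 h2 h3 using fun i => exists_of_exactlyOneRel (h i)
  exact ⟨a, b, h1, h2, h3⟩

/-- `v` lies on branch `i`, before the end of the relation. -/
def Low (b : Fin T.t → ℕ) (i : Fin T.t) : Vtx T.t T.ℓ → Prop
  | .src => True
  | .snk => False
  | .mid j c => i = j ∧ c + 1 < b i

/-- `v` lies at or after the end of the relation. -/
def High (b : Fin T.t → ℕ) : Vtx T.t T.ℓ → Prop
  | .src => False
  | .snk => True
  | .mid j c => b j ≤ c + 1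

lemma high_iff {b : Fin T.t → ℕ} {v : Vtx T.t T.ℓ} : High b v ↔ ∀ i, ¬ Low b i v := by
  have := T.ht
  cases v with
  | src => exact ⟨False.elim, fun h => h ⟨0, by omega⟩ trivial⟩
  | snk => exact ⟨fun _ _ => id, fun _ => trivial⟩
  | mid j c =>
    simp only [High, Low]
    constructor
    · rintro h i ⟨rfl, h'⟩
      omega
    · intro h
      have := h j
      simp only [true_and] at this
      omega

/-- The order in which the vertices are stripped off. -/
def vrank (b : Fin T.t → ℕ) : Vtx T.t T.ℓ → ℕ
  | .src => ∑ i, T.ℓ i + 1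
  | .snk => 0
  | .mid j c => if b j ≤ c + 1 then T.ℓ j - (c + 1) else ∑ i, T.ℓ i + 1 + (c + 1)

lemma exists_vtx (v : Vtx T.t T.ℓ) : ∃ i s, s ≤ T.ℓ i ∧ v = vtx T.t T.ℓ i s := by
  have := T.ht
  cases v with
  | src => exact ⟨⟨0, by omega⟩, 0, Nat.zero_le _, (vtx_zero _).symm⟩
  | snk => exact ⟨⟨0, by omega⟩, _, le_rfl, (vtx_len _ (T.hℓ _)).symm⟩
  | mid j c => exact ⟨j, c + 1, by omega, (vtx_mid j c).symm⟩

lemma mid_eq_vtx {i j : Fin T.t} {d : Fin (T.ℓ j - 1)} {r : ℕ} (hr : 0 < r)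
    (h : (.mid j d : Vtx T.t T.ℓ) = vtx T.t T.ℓ i r) : i = j ∧ r = d + 1 := by
  rw [vtx, if_neg (by omega)] at h
  split at h
  · cases h
    exact ⟨rfl, by simp only; omega⟩
  · cases h

variable {a b : Fin T.t → ℕ} (h : OneRel T a b)

include h

lemma OneRel.pathOf_ne_zero_iff_mid {i j : Fin T.t} {c : Fin (T.ℓ i - 1)} {d : Fin (T.ℓ j - 1)} :
    pathOf (.mid i c : Vtx T.t T.ℓ) (.mid j d) ≠ 0 ↔
      i = j ∧ c.1 ≤ d.1 ∧ ¬ (c.1 + 1 ≤ a i ∧ b i ≤ d.1 + 1) := by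
  rw [pathOf]
  by_cases hij : i = j
  · subst hij
    rw [if_pos rfl]
    by_cases hcd : c.1 ≤ d.1
    · rw [Ne, h.pp_eq_zero_iff i _ _ (by omega) (by omega)]
      simp [hcd]
    · rw [pp_of_gt (by omega)]
      simp [hcd]
  · rw [if_neg hij]
    simp [hij]

lemma OneRel.pathOf_ne_zero_iff_src_mid {j : Fin T.t} {d : Fin (T.ℓ j - 1)} :
    pathOf (.src : Vtx T.t T.ℓ) (.mid j d) ≠ 0 ↔ d.1 + 1 < b j := by
  rw [pathOf, Ne, h.pp_eq_zero_iff j _ _ (by omega) (by omega)]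
  simp

lemma OneRel.pathOf_ne_zero_iff_mid_snk {i : Fin T.t} {c : Fin (T.ℓ i - 1)} :
    pathOf (.mid i c : Vtx T.t T.ℓ) .snk ≠ 0 ↔ a i < c.1 + 1 := by
  rw [pathOf, Ne, h.pp_eq_zero_iff i _ _ (by omega) le_rfl]
  have := h.le_len i
  simp [this]

/-- The last vertex of branch `i` before the end of the relation. -/
def OneRel.bot (i : Fin T.t) : Vtx T.t T.ℓ :=
  .mid i ⟨b i - 2, by have := h.two_le i; have := h.le_len i; omega⟩

lemma OneRel.bot_eq (i : Fin T.t) : h.bot i = .mid i ⟨b i - 2, by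
    have := h.two_le i; have := h.le_len i; omega⟩ := rfl

lemma OneRel.low_of_path {i : Fin T.t} {u v : Vtx T.t T.ℓ} (hv : Low b i v)
    (huv : pathOf u v ≠ 0) : Low b i u := by
  cases u with
  | src => trivial
  | snk => cases v <;> first | exact hv | exact absurd rfl huv
  | mid j c =>
    cases v with
    | src => exact absurd rfl huv
    | snk => exact hv.elim
    | mid l d =>
      rw [h.pathOf_ne_zero_iff_mid] at huv
      obtain ⟨rfl, h1, h2⟩ := huv
      obtain ⟨rfl, h3⟩ := hv
      exact ⟨rfl, by omega⟩

lemma OneRel.path_bot_iff {i : Fin T.t} {v : Vtx T.t T.ℓ} :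
    pathOf v (h.bot i) ≠ 0 ↔ Low b i v := by
  have := h.two_le i
  rw [h.bot_eq]
  cases v with
  | src => rw [h.pathOf_ne_zero_iff_src_mid]; exact ⟨fun _ => trivial, fun _ => by simp only; omega⟩
  | snk => exact ⟨fun h => h rfl, False.elim⟩
  | mid j c =>
    rw [h.pathOf_ne_zero_iff_mid]
    simp only [Low]
    constructor
    · rintro ⟨rfl, h1, h2⟩
      exact ⟨rfl, by omega⟩
    · rintro ⟨rfl, h1⟩
      exact ⟨rfl, by omega, by omega⟩

omit h in
lemma pathOf_mul (hm : mDim T = 0) {u v w : Vtx T.t T.ℓ} (huv : pathOf u v ≠ 0)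
    (hvw : pathOf v w ≠ 0) : pathOf u v * pathOf v w = pathOf u w := by
  cases v with
  | src =>
    cases u <;> try exact absurd rfl huv
    obtain ⟨i, s, hs, rfl⟩ := exists_vtx w
    rw [← vtx_zero i, pathOf_vtx hm i (Nat.zero_le _) (Nat.zero_le _),
      pathOf_vtx hm i (Nat.zero_le _) hs, pp_mul_pp _ le_rfl (Nat.zero_le _)]
  | snk =>
    cases w <;> try exact absurd rfl hvw
    obtain ⟨i, s, hs, rfl⟩ := exists_vtx u
    rw [← vtx_len i (T.hℓ i), pathOf_vtx hm i hs le_rfl, pathOf_vtx hm i le_rfl le_rfl,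
      pp_mul_pp _ hs le_rfl]
  | mid i c =>
    have hu : ∃ s, s ≤ (c + 1 : ℕ) ∧ u = vtx T.t T.ℓ i s := by
      cases u with
      | src => exact ⟨0, by omega, (vtx_zero i).symm⟩
      | snk => exact absurd rfl huv
      | mid j d =>
        rw [pathOf] at huv
        split at huv
        · next hij =>
          subst hij
          refine ⟨d + 1, ?_, (vtx_mid j d).symm⟩
          by_contra hlt
          exact huv (pp_of_gt (by omega))
        · exact absurd rfl huv
    have hw : ∃ s, (c + 1 : ℕ) ≤ s ∧ s ≤ T.ℓ i ∧ w = vtx T.t T.ℓ i s := by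
      cases w with
      | src => exact absurd rfl hvw
      | snk => exact ⟨_, by omega, le_rfl, (vtx_len i (T.hℓ i)).symm⟩
      | mid j d =>
        rw [pathOf] at hvw
        split at hvw
        · next hij =>
          subst hij
          refine ⟨d + 1, ?_, by omega, (vtx_mid i d).symm⟩
          by_contra hlt
          exact hvw (pp_of_gt (by omega))
        · exact absurd rfl hvw
    obtain ⟨s, hs, rfl⟩ := hu
    obtain ⟨s', hs', hs'', rfl⟩ := hw
    rw [← vtx_mid i c, pathOf_vtx hm i (by omega) (by omega), pathOf_vtx hm i (by omega) hs'',
      pathOf_vtx hm i (by omega) hs'', pp_mul_pp _ hs hs']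

lemma OneRel.path_of_rank {i : Fin T.t} {u v : Vtx T.t T.ℓ} (hu : Low b i u) (hv : Low b i v)
    (hr : vrank b v ≤ vrank b u) : pathOf v u ≠ 0 := by
  cases v with
  | src =>
    cases u with
    | src => exact ev_ne_zero (T := T) _
    | snk => exact hu.elim
    | mid l d =>
      obtain ⟨rfl, h2⟩ := hu
      rw [h.pathOf_ne_zero_iff_src_mid]
      exact h2
  | snk => exact hv.elim
  | mid j c =>
    obtain ⟨rfl, h1⟩ := hv
    cases u with
    | src =>
      simp only [vrank] at hr
      rw [if_neg (by omega)] at hr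
      omega
    | snk => exact hu.elim
    | mid l d =>
      obtain ⟨rfl, h2⟩ := hu
      simp only [vrank] at hr
      rw [if_neg (by omega), if_neg (by omega)] at hr
      rw [h.pathOf_ne_zero_iff_mid]
      exact ⟨rfl, by omega, by omega⟩

/-- The vertices at which the submodule generated at `v` is detected. -/
def Detects (b : Fin T.t → ℕ) (v w : Vtx T.t T.ℓ) : Prop :=
  pathOf v w ≠ 0 ∧ (High b v → w = v) ∧ (¬ High b v → ¬ High b w)

lemma OneRel.high_of_path {v w : Vtx T.t T.ℓ} (hv : High b v) (hvw : pathOf v w ≠ 0) :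
    High b w := by
  rw [high_iff] at hv ⊢
  exact fun i hi => hv i (h.low_of_path hi hvw)

lemma OneRel.not_detects {v w : Vtx T.t T.ℓ} (hvw : pathOf v w ≠ 0) (hn : ¬ Detects b v w) :
    High b w ∧ vrank b w < vrank b v := by
  have hle : ∀ j, T.ℓ j ≤ ∑ i, T.ℓ i := fun j =>
    Finset.single_le_sum (f := T.ℓ) (fun _ _ => Nat.zero_le _) (Finset.mem_univ j)
  by_cases hv : High b v
  · have hw := h.high_of_path hv hvw
    refine ⟨hw, ?_⟩
    have hne : w ≠ v := by
      rintro rfl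
      exact hn ⟨hvw, fun _ => rfl, fun h => absurd hv h⟩
    cases v with
    | src => exact hv.elim
    | snk => cases w <;> first | exact absurd rfl hvw | exact absurd rfl hne
    | mid j c =>
      simp only [High] at hv
      have := c.2
      cases w with
      | src => exact absurd rfl hvw
      | snk => simp only [vrank]; rw [if_pos hv]; omega
      | mid l d =>
        rw [h.pathOf_ne_zero_iff_mid] at hvw
        obtain ⟨rfl, h1, h2⟩ := hvw
        simp only [High] at hw
        simp only [vrank]
        rw [if_pos hv, if_pos hw]
        have : c.1 ≠ d.1 := fun h => hne (by rw [Fin.ext h])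
        omega
  · have hw : High b w := by
      by_contra hw
      exact hn ⟨hvw, fun h => absurd h hv, fun _ => hw⟩
    refine ⟨hw, ?_⟩
    have h1 : ∑ i, T.ℓ i < vrank b v := by
      cases v with
      | src => simp [vrank]
      | snk => exact absurd trivial hv
      | mid j c => simp only [vrank]; simp only [High] at hv; rw [if_neg hv]; omega
    refine lt_of_le_of_lt ?_ h1
    cases w with
    | src => exact hw.elim
    | snk => exact Nat.zero_le _
    | mid j c => simp only [vrank]; simp only [High] at hw; rw [if_pos hw]; have := hle j; omega

lemma OneRel.detects_cases (v : Vtx T.t T.ℓ) :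
    (∀ w, pathOf v w ≠ 0 → Detects b v w) ∨
      ∃ i s s', v = vtx T.t T.ℓ i s ∧ a i < s ∧ s < s' ∧ s' ≤ T.ℓ i ∧
        ∀ w, (pathOf v w ≠ 0 ∧ ¬ Detects b v w) ↔ ∃ r, s' ≤ r ∧ r ≤ T.ℓ i ∧ w = vtx T.t T.ℓ i r := by
  cases v with
  | src =>
    left
    intro w hw
    refine ⟨hw, fun h => h.elim, fun _ => ?_⟩
    cases w with
    | src => exact id
    | snk => exact absurd rfl hw
    | mid j d =>
      rw [h.pathOf_ne_zero_iff_src_mid] at hw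
      simp only [High]
      omega
  | snk =>
    left
    intro w hw
    refine ⟨hw, fun _ => ?_, fun h => absurd trivial h⟩
    cases w <;> first | exact absurd rfl hw | rfl
  | mid i c =>
    have hab := h.two_le i
    have hbl := h.le_len i
    have hc := c.2
    by_cases hv : b i ≤ c + 1
    · right
      refine ⟨i, c + 1, c + 2, (vtx_mid i c).symm, by omega, by omega, by omega, fun w => ?_⟩
      have hv' : High b (.mid i c : Vtx T.t T.ℓ) := hv
      have hd : Detects b (.mid i c) w ↔ w = .mid i c := by
        refine ⟨fun h => h.2.1 hv', ?_⟩
        rintro rfl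
        refine ⟨by rw [pathOf_self]; exact ev_ne_zero _, fun _ => rfl, fun h => absurd hv' h⟩
      rw [hd]
      cases w with
      | src =>
        refine ⟨fun h => absurd rfl h.1, ?_⟩
        rintro ⟨r, h1, h2, h3⟩
        rw [vtx, if_neg (by omega)] at h3
        split at h3 <;> cases h3
      | snk =>
        rw [h.pathOf_ne_zero_iff_mid_snk]
        exact ⟨fun _ => ⟨_, by omega, le_rfl, (vtx_len i (T.hℓ i)).symm⟩,
          fun _ => ⟨by omega, nofun⟩⟩
      | mid j d =>
        rw [h.pathOf_ne_zero_iff_mid]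
        constructor
        · rintro ⟨⟨rfl, h1, h2⟩, h3⟩
          refine ⟨d + 1, ?_, by omega, (vtx_mid i d).symm⟩
          have : c.1 ≠ d.1 := fun h => h3 (by rw [Fin.ext h])
          omega
        · rintro ⟨r, h1, h2, h3⟩
          obtain ⟨rfl, hr⟩ := mid_eq_vtx (by omega) h3
          refine ⟨⟨rfl, by omega, by omega⟩, fun h => ?_⟩
          cases h
          omega
    · have hv' : ¬ High b (.mid i c : Vtx T.t T.ℓ) := hv
      have hd : ∀ w, pathOf (.mid i c) w ≠ 0 → (Detects b (.mid i c) w ↔ ¬ High b w) :=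
        fun w hw => ⟨fun h => h.2.2 hv', fun h' => ⟨hw, fun h => absurd h hv', fun _ => h'⟩⟩
      by_cases ha : c + 1 ≤ a i
      · left
        intro w hw
        rw [hd w hw]
        cases w with
        | src => exact id
        | snk => rw [h.pathOf_ne_zero_iff_mid_snk] at hw; omega
        | mid j d =>
          rw [h.pathOf_ne_zero_iff_mid] at hw
          obtain ⟨rfl, h1, h2⟩ := hw
          simp only [High]
          omega
      · right
        refine ⟨i, c + 1, b i, (vtx_mid i c).symm, by omega, by omega, hbl, fun w => ?_⟩
        have : (pathOf (.mid i c) w ≠ 0 ∧ ¬ Detects b (.mid i c) w) ↔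
            (pathOf (.mid i c) w ≠ 0 ∧ High b w) := by
          refine and_congr_right fun hw => ?_
          rw [hd w hw, not_not]
        rw [this]
        cases w with
        | src =>
          refine ⟨fun h => absurd rfl h.1, ?_⟩
          rintro ⟨r, h1, h2, h3⟩
          rw [vtx, if_neg (by omega)] at h3
          split at h3 <;> cases h3
        | snk =>
          rw [h.pathOf_ne_zero_iff_mid_snk]
          exact ⟨fun _ => ⟨_, hbl, le_rfl, (vtx_len i (T.hℓ i)).symm⟩,
            fun _ => ⟨by omega, trivial⟩⟩
        | mid j d =>
          rw [h.pathOf_ne_zero_iff_mid]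
          simp only [High]
          constructor
          · rintro ⟨⟨rfl, h1, h2⟩, h3⟩
            exact ⟨d + 1, h3, by omega, (vtx_mid i d).symm⟩
          · rintro ⟨r, h1, h2, h3⟩
            obtain ⟨rfl, hr⟩ := mid_eq_vtx (by omega) h3
            exact ⟨⟨rfl, by omega, by omega⟩, by omega⟩

end LowHigh

section Quasitilted

variable {k : Type u} [Field k] {T : ToupieAlg k}

lemma path_out {i : Fin T.t} {s : ℕ} (hs : 0 < s) (hsl : s ≤ T.ℓ i)
    {w : Vtx T.t T.ℓ} (hw : pathOf (vtx T.t T.ℓ i s) w ≠ 0) :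
    ∃ r, s ≤ r ∧ r ≤ T.ℓ i ∧ w = vtx T.t T.ℓ i r := by
  rcases vtx_cases i (T.hℓ i) s hsl with ⟨rfl, h1⟩ | ⟨rfl, h1⟩ | ⟨c, rfl, h1⟩
  · omega
  · rw [h1] at hw
    refine ⟨T.ℓ i, le_rfl, le_rfl, ?_⟩
    rw [h1]
    cases w <;> first | exact absurd rfl hw | rfl
  · rw [h1] at hw
    cases w with
    | src => exact absurd rfl hw
    | snk => exact ⟨_, hsl, le_rfl, (vtx_len i (T.hℓ i)).symm⟩
    | mid j d =>
      rw [pathOf] at hw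
      split at hw
      · next hij =>
        subst hij
        refine ⟨d + 1, ?_, by omega, (vtx_mid i d).symm⟩
        by_contra hlt
        exact hw (pp_of_gt (by omega))
      · exact absurd rfl hw

lemma eq_sum_mul_ev (a : Alg T) : a = ∑ w, a * ev T w := by
  rw [← Finset.mul_sum, sum_ev, mul_one]

variable {a b : Fin T.t → ℕ} (h : OneRel T a b) (hm : mDim T = 0)

include h hm

lemma OneRel.exists_radIdeal (v : Vtx T.t T.ℓ) :
    ∃ J : Submodule (Alg T)ᵐᵒᵖ (Alg T)ᵐᵒᵖ,
      (∀ x, x ∈ J ↔ x * op (ev T v) = x ∧ ∀ w : {w // Detects b v w}, op (ev T w.1) * x = 0) ∧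
        Module.Projective (Alg T)ᵐᵒᵖ J := by
  have hterm : ∀ x : Alg T, ev T v * x = x → (∀ w, Detects b v w → x * ev T w = 0) →
      ∀ w, (pathOf v w ≠ 0 ∧ ¬ Detects b v w) ∨ x * ev T w = 0 := by
    intro x hx hd w
    by_cases hw : Detects b v w
    · exact .inr (hd w hw)
    · by_cases hp : pathOf v w = 0
      · right
        obtain ⟨c, hc⟩ := corner hm v w x
        rw [← hx, hc, hp, smul_zero]
      · exact .inl ⟨hp, hw⟩
  rcases h.detects_cases v with h0 | ⟨i, s, s', rfl, has, hss, hsl, hw⟩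
  · refine ⟨⊥, fun x => ?_, inferInstance⟩
    rw [Submodule.mem_bot]
    refine ⟨?_, ?_⟩
    · rintro rfl
      exact ⟨zero_mul _, fun _ => mul_zero _⟩
    · rintro ⟨h1, h2⟩
      obtain ⟨x, rfl⟩ := op_surjective x
      have h1' : ev T v * x = x := op_injective h1
      have h2' : ∀ w, Detects b v w → x * ev T w = 0 := fun w hw => op_injective (h2 ⟨w, hw⟩)
      rw [eq_sum_mul_ev x, Finset.sum_eq_zero, op_zero]
      intro w _
      rcases hterm x h1' h2' w with h3 | h3
      · exact absurd (h0 w h3.1) h3.2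
      · exact h3
  · set y : Alg T := pp T i s s' with hy
    have hyP : y = pathOf (vtx T.t T.ℓ i s) (vtx T.t T.ℓ i s') :=
      (pathOf_vtx hm i (by omega) hsl).symm
    have hyev : y * ev T (vtx T.t T.ℓ i s') = y := pp_mul_ev i s s'
    have hmul : ∀ (x : Alg T) w, ∃ c : k, ev T (vtx T.t T.ℓ i s') * x * ev T w =
        c • pathOf (vtx T.t T.ℓ i s') w ∧
          y * x * ev T w = c • (y * pathOf (vtx T.t T.ℓ i s') w) := by
      intro x w
      obtain ⟨c, hc⟩ := corner hm (vtx T.t T.ℓ i s') w x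
      refine ⟨c, hc, ?_⟩
      rw [← mul_smul_comm, ← hc, ← mul_assoc, ← mul_assoc, hyev]
    have hcancel : ∀ x : Alg T, y * x = 0 → ev T (vtx T.t T.ℓ i s') * x = 0 := by
      intro x hx
      rw [eq_sum_mul_ev (ev T _ * x), Finset.sum_eq_zero]
      intro w _
      obtain ⟨c, h1, h2⟩ := hmul x w
      rw [hx, zero_mul] at h2
      rw [h1]
      by_cases hp : pathOf (vtx T.t T.ℓ i s') w = 0
      · rw [hp, smul_zero]
      obtain ⟨r, hr1, hr2, rfl⟩ := path_out (by omega) hsl hp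
      rw [pathOf_vtx hm i hsl hr2, hy, pp_mul_pp i hss.le hr1] at h2
      have : pp T i s r ≠ 0 := by
        rw [Ne, h.pp_eq_zero_iff i _ _ (by omega) hr2]
        omega
      rw [(smul_eq_zero.1 h2.symm).resolve_right this, zero_smul]
    refine ⟨LinearMap.range (LinearMap.toSpanSingleton (Alg T)ᵐᵒᵖ (Alg T)ᵐᵒᵖ (op y)), ?_, ?_⟩
    · intro x
      constructor
      · rintro ⟨x, rfl⟩
        obtain ⟨x, rfl⟩ := op_surjective x
        change op x * op y * _ = op x * op y ∧ ∀ w : {w // Detects b (vtx T.t T.ℓ i s) w},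
          op (ev T w.1) * (op x * op y) = 0
        refine ⟨?_, fun ⟨w, hd⟩ => ?_⟩
        · rw [mul_assoc, ← op_mul (ev T _) y, hy, ev_mul_pp]
        · obtain ⟨c, h1, h2⟩ := hmul x w
          rw [← op_mul, ← op_mul, h2]
          by_cases hp : pathOf (vtx T.t T.ℓ i s') w = 0
          · rw [hp, mul_zero, smul_zero, op_zero]
          · exact absurd hd ((hw w).2 (path_out (by omega) hsl hp)).2
      · rintro ⟨h1, h2⟩
        obtain ⟨x, rfl⟩ := op_surjective x
        have h1' : ev T _ * x = x := op_injective h1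
        have h2' : ∀ w, Detects b (vtx T.t T.ℓ i s) w → x * ev T w = 0 :=
          fun w hw => op_injective (h2 ⟨w, hw⟩)
        have : ∀ w, ∃ z : Alg T, x * ev T w = y * z := by
          intro w
          rcases hterm x h1' h2' w with h3 | h3
          · obtain ⟨r, hr1, hr2, rfl⟩ := (hw w).1 h3
            obtain ⟨c, hc⟩ := corner_vtx hm i (by omega : s ≤ T.ℓ i) hr2 x
            refine ⟨c • pp T i s' r, ?_⟩
            rw [← h1', hc, mul_smul_comm, hy, pp_mul_pp i hss.le hr1]
          · exact ⟨0, by rw [h3, mul_zero]⟩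
        choose z hz using this
        refine ⟨op (∑ w, z w), ?_⟩
        change op _ * op y = _
        rw [← op_mul, Finset.mul_sum, eq_sum_mul_ev x]
        exact congrArg op (Finset.sum_congr rfl fun w _ => (hz w).symm)
    · refine projective_of_generators (ι := Unit) (fun _ => ⟨op y, 1, by simp⟩)
        (fun _ => op (ev T (vtx T.t T.ℓ i s'))) (fun _ => ?_) ?_ ?_
      · apply Subtype.ext
        change op (ev T _) * op y = op y
        rw [← op_mul, hyev]
      · rintro ⟨_, x, rfl⟩
        refine ⟨fun _ => x, ?_⟩
        apply Subtype.ext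
        simp
      · intro x hx _
        have h1 := congrArg Subtype.val hx
        simp only [Finset.univ_unique, Finset.sum_singleton] at h1
        change x () * op y = 0 at h1
        obtain ⟨x', hx'⟩ := op_surjective (x ())
        rw [← hx', ← op_mul] at h1
        rw [← hx', ← op_mul, hcancel x' (op_injective h1), op_zero]

end Quasitilted

section Quasitilted

variable {k : Type u} [Field k] {T : ToupieAlg k} {a b : Fin T.t → ℕ} (h : OneRel T a b)

/-- The paths ending before the end of the relations act injectively modulo `N`. -/
def OneRel.Closed {M : Type u} [AddCommGroup M] [Module (Alg T)ᵐᵒᵖ M]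
    (N : Submodule (Alg T)ᵐᵒᵖ M) : Prop :=
  ∀ i v, Low b i v → ∀ n : M, op (pathOf v (h.bot i)) • n ∈ N → op (ev T v) • n ∈ N

include h

lemma OneRel.closed_bot_quotient {M : Type u} [AddCommGroup M] [Module (Alg T)ᵐᵒᵖ M]
    {N : Submodule (Alg T)ᵐᵒᵖ M} : h.Closed (⊥ : Submodule (Alg T)ᵐᵒᵖ (M ⧸ N)) ↔ h.Closed N := by
  have key : ∀ (c : (Alg T)ᵐᵒᵖ) (n : M), c • N.mkQ n ∈ (⊥ : Submodule (Alg T)ᵐᵒᵖ (M ⧸ N)) ↔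
      c • n ∈ N := fun c n => by
    rw [Submodule.mem_bot, ← map_smul, Submodule.mkQ_apply, Submodule.Quotient.mk_eq_zero]
  constructor
  · intro hc i v hv n hn
    exact (key _ _).1 (hc i v hv _ ((key _ _).2 hn))
  · intro hc i v hv n hn
    obtain ⟨n, rfl⟩ := Submodule.mkQ_surjective _ n
    exact (key _ _).2 (hc i v hv _ ((key _ _).1 hn))

lemma OneRel.closed_regular (hm : mDim T = 0) {i : Fin T.t} {v : Vtx T.t T.ℓ} (hv : Low b i v)
    {x : Alg T} (hx : x * pathOf v (h.bot i) = 0) : x * ev T v = 0 := by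
  have h1 : x * ev T v = ∑ u, ev T u * x * ev T v := by
    simp only [mul_assoc]
    rw [← Finset.sum_mul, sum_ev, one_mul]
  rw [h1]
  refine Finset.sum_eq_zero fun u _ => ?_
  obtain ⟨c, hc⟩ := corner hm u v x
  rw [hc]
  by_cases hp : pathOf u v = 0
  · rw [hp, smul_zero]
  have h2 : c • pathOf u (h.bot i) = 0 := by
    rw [← pathOf_mul hm hp (h.path_bot_iff.2 hv), ← smul_mul_assoc, ← hc, mul_assoc, mul_assoc,
      show ev T v * pathOf v (h.bot i) = pathOf v (h.bot i) by
        rw [← pathOf_self, pathOf_mul hm _ (h.path_bot_iff.2 hv)]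
        rw [pathOf_self]
        exact ev_ne_zero v, hx, mul_zero]
  rw [(smul_eq_zero.1 h2).resolve_right (h.path_bot_iff.2 (h.low_of_path hv hp)), zero_smul]

lemma OneRel.closed_of_projective (hm : mDim T = 0) {P : Type u} [AddCommGroup P]
    [Module (Alg T)ᵐᵒᵖ P] [Module.Projective (Alg T)ᵐᵒᵖ P] :
    h.Closed (⊥ : Submodule (Alg T)ᵐᵒᵖ P) := by
  obtain ⟨s, hs⟩ := (Module.projective_def (R := (Alg T)ᵐᵒᵖ) (P := P)).1 inferInstance
  intro i v hv n hn
  rw [Submodule.mem_bot] at hn ⊢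
  apply hs.injective
  rw [map_zero, map_smul]
  have h1 : op (pathOf v (h.bot i)) • s n = 0 := by rw [← map_smul, hn, map_zero]
  ext j
  have h2 := DFunLike.congr_fun h1 j
  rw [Finsupp.smul_apply, smul_eq_mul, Finsupp.zero_apply] at h2 ⊢
  obtain ⟨x, hx⟩ := op_surjective (s n j)
  rw [← hx, ← op_mul] at h2 ⊢
  rw [h.closed_regular hm hv (op_injective h2), op_zero]

omit h in
lemma smul_mem_trace_ev (hm : mDim T = 0) (v : Vtx T.t T.ℓ) {N : Type u} [AddCommGroup N]
    [Module (Alg T)ᵐᵒᵖ N] {m : N} (hmem : m ∈ trace (op (ev T v)) N) (w : Vtx T.t T.ℓ) :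
    ∃ m' : N, op (ev T v) • m' = m' ∧ op (ev T w) • m = op (pathOf v w) • m' := by
  have key : ∀ m ∈ trace (op (ev T v)) N, ∀ c : Alg T, ∃ m' : N, op (ev T v) • m' = m' ∧
      op (c * ev T w) • m = op (pathOf v w) • m' := by
    intro m hmem
    induction hmem using Submodule.span_induction with
    | mem n hn =>
      intro c
      rw [Set.mem_ofPred_eq] at hn
      obtain ⟨d, hd⟩ := corner hm v w c
      refine ⟨op (d • ev T v) • n, ?_, ?_⟩
      · rw [← mul_smul, ← op_mul, smul_mul_assoc, ev_mul_self]
      · nth_rw 1 [← hn]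
        rw [← mul_smul, ← op_mul, ← mul_assoc, hd, ← mul_smul, ← op_mul, smul_mul_assoc]
        by_cases hp : pathOf v w = 0
        · rw [hp, mul_zero]
        · rw [← pathOf_self v, pathOf_mul hm _ hp]
          rw [pathOf_self]
          exact ev_ne_zero v
    | zero => exact fun c => ⟨0, smul_zero _, by rw [smul_zero, smul_zero]⟩
    | add x y _ _ h1 h2 =>
      intro c
      obtain ⟨x', h3, h4⟩ := h1 c
      obtain ⟨y', h5, h6⟩ := h2 c
      exact ⟨x' + y', by rw [smul_add, h3, h5], by rw [smul_add, smul_add, h4, h6]⟩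
    | smul r x _ h1 =>
      intro c
      obtain ⟨r, rfl⟩ := op_surjective r
      rw [← mul_smul, ← op_mul, ← mul_assoc]
      exact h1 _
  have := key m hmem 1
  rwa [one_mul] at this

lemma OneRel.closed_trace (hm : mDim T = 0) {N : Type u} [AddCommGroup N] [Module (Alg T)ᵐᵒᵖ N]
    (hN : h.Closed (⊥ : Submodule (Alg T)ᵐᵒᵖ N)) (v : Vtx T.t T.ℓ)
    (hv : ∀ u, vrank b u < vrank b v → ∀ n : N, op (ev T u) • n = 0) :
    h.Closed (trace (op (ev T v)) N) := by
  intro i u hu n hn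
  obtain ⟨m, hm1, hm2⟩ := smul_mem_trace_ev hm v hn (h.bot i)
  have hpu := h.path_bot_iff.2 hu
  have hbot : pathOf (h.bot i) (h.bot i) ≠ 0 := by rw [pathOf_self]; exact ev_ne_zero _
  rw [← mul_smul, ← op_mul, ← pathOf_self (h.bot i), pathOf_mul hm hpu hbot] at hm2
  by_cases hp : pathOf v (h.bot i) = 0
  · rw [hp, op_zero, zero_smul] at hm2
    have := hN i u hu n (by rw [hm2]; exact Submodule.zero_mem _)
    rw [(Submodule.mem_bot _).1 this]
    exact Submodule.zero_mem _
  · have hvl := h.path_bot_iff.1 hp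
    by_cases hr : vrank b u < vrank b v
    · rw [hv u hr]
      exact Submodule.zero_mem _
    · have hvu := h.path_of_rank hu hvl (not_lt.1 hr)
      have huu : pathOf u u ≠ 0 := by rw [pathOf_self]; exact ev_ne_zero _
      have h1 := hN i u hu (n - op (pathOf v u) • m) (by
        rw [Submodule.mem_bot, smul_sub, hm2, ← mul_smul, ← op_mul, pathOf_mul hm hvu hpu, sub_self])
      rw [Submodule.mem_bot, smul_sub, sub_eq_zero, ← mul_smul, ← op_mul, ← pathOf_self u,
        pathOf_mul hm hvu huu] at h1
      rw [← pathOf_self u, h1]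
      exact Submodule.smul_mem _ _ (Submodule.subset_span hm1)

lemma OneRel.trace_piece (hm : mDim T = 0) {N : Type u} [AddCommGroup N] [Module (Alg T)ᵐᵒᵖ N]
    (hN : h.Closed (⊥ : Submodule (Alg T)ᵐᵒᵖ N)) (v : Vtx T.t T.ℓ)
    (hv : ∀ u, vrank b u < vrank b v → ∀ n : N, op (ev T u) • n = 0) :
    PdLeOne (Alg T)ᵐᵒᵖ (.of (Alg T)ᵐᵒᵖ (trace (op (ev T v)) N)) ∧
      ∀ (X : Type u) [AddCommGroup X] [Module (Alg T)ᵐᵒᵖ X],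
        (∀ w, High b w → ∀ x : X, op (ev T w) • x = 0) →
          ExtZero (Alg T)ᵐᵒᵖ (trace (op (ev T v)) N) X := by
  obtain ⟨J, hJ, hJp⟩ := h.exists_radIdeal hm v
  have hterm : ∀ x ∈ J, ∀ w, (High b w ∧ vrank b w < vrank b v) ∨ op (ev T w) * x = 0 := by
    intro x hx w
    obtain ⟨h1, h2⟩ := (hJ x).1 hx
    by_cases hd : Detects b v w
    · exact .inr (h2 ⟨w, hd⟩)
    by_cases hp : pathOf v w = 0
    · right
      obtain ⟨x, rfl⟩ := op_surjective x
      obtain ⟨c, hc⟩ := corner hm v w x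
      rw [← h1, ← op_mul, ← op_mul, hc, hp, smul_zero, op_zero]
    · exact .inl (h.not_detects hp hd)
  have hsum : ∑ w, op (ev T w) = 1 := by
    rw [← Finset.op_sum, sum_ev, op_one]
  obtain ⟨h1, h2⟩ := Toupie.trace_piece (k := k) (e := op (ev T v))
    (by rw [← op_mul, ev_mul_self]) (W := {w // Detects b v w}) (fun w => op (ev T w.1))
    (fun w => op (pathOf v w.1)) (fun x w => by
      obtain ⟨x, rfl⟩ := op_surjective x
      obtain ⟨c, hc⟩ := corner hm v w.1 x
      exact ⟨c, by rw [← op_mul, ← op_mul, ← mul_assoc, hc, op_smul]⟩) J hJ N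
    (fun w n hn hw => by
      obtain ⟨w, hw1, hw2, hw3⟩ := w
      by_cases hhv : High b v
      · obtain rfl := hw2 hhv
        rw [pathOf_self, hn] at hw
        exact hw
      · have := hw3 hhv
        rw [high_iff] at this
        push Not at this
        obtain ⟨i, hi⟩ := this
        have h3 := hN i v (h.low_of_path hi hw1) n (by
          rw [← pathOf_mul hm hw1 (h.path_bot_iff.2 hi), op_mul, mul_smul, hw, smul_zero]
          exact Submodule.zero_mem _)
        rwa [Submodule.mem_bot, hn] at h3)
    (fun x hx n hn => by
      rw [← one_smul (Alg T)ᵐᵒᵖ (x • n), ← hsum, Finset.sum_smul]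
      refine Finset.sum_eq_zero fun w _ => ?_
      rcases hterm x hx w with h3 | h3
      · exact hv w h3.2 _
      · rw [← mul_smul, h3, zero_smul])
  refine ⟨h1, fun X _ _ hX => h2 X ⟨∑ w, if High b w then op (ev T w) else 0, fun x hx => ?_,
    fun y => ?_⟩⟩
  · conv_rhs => rw [← one_mul x, ← hsum, Finset.sum_mul]
    rw [Finset.sum_mul]
    refine Finset.sum_congr rfl fun w _ => ?_
    split_ifs with hw
    · rfl
    · rw [zero_mul]
      exact ((hterm x hx w).resolve_left fun h3 => hw h3.1).symm
  · rw [Finset.sum_smul]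
    refine Finset.sum_eq_zero fun w _ => ?_
    split_ifs with hw
    · exact hX w hw y
    · exact zero_smul _ _

lemma OneRel.pdLeOne_and_extZero (hm : mDim T = 0) {N : Type u} [AddCommGroup N]
    [Module (Alg T)ᵐᵒᵖ N] (hN : h.Closed (⊥ : Submodule (Alg T)ᵐᵒᵖ N)) :
    PdLeOne (Alg T)ᵐᵒᵖ (.of (Alg T)ᵐᵒᵖ N) ∧
      ∀ (X : Type u) [AddCommGroup X] [Module (Alg T)ᵐᵒᵖ X],
        (∀ w, High b w → ∀ x : X, op (ev T w) • x = 0) → ExtZero (Alg T)ᵐᵒᵖ N X := by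
  refine filtration_induction (fun v => op (ev T v)) (fun v => by rw [← op_mul, ev_mul_self])
    (by rw [← Finset.op_sum, sum_ev, op_one]) (vrank b)
    (fun N => h.Closed (⊥ : Submodule (Alg T)ᵐᵒᵖ N))
    (fun N => PdLeOne (Alg T)ᵐᵒᵖ N ∧
      ∀ (X : Type u) [AddCommGroup X] [Module (Alg T)ᵐᵒᵖ X],
        (∀ w, High b w → ∀ x : X, op (ev T w) • x = 0) → ExtZero (Alg T)ᵐᵒᵖ N X)
    ?_ ?_ ?_ N hN
  · intro N hN
    have : Subsingleton N := ⟨fun x y => by rw [hN x, hN y]⟩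
    have : Module.Projective (Alg T)ᵐᵒᵖ N :=
      Module.Projective.of_lifting_property'' fun g _ =>
        ⟨0, LinearMap.ext fun x => Subsingleton.elim _ _⟩
    exact ⟨pdLeOne_of_projective, fun X _ _ _ E _ _ ι π _ _ _ =>
      ⟨0, LinearMap.ext fun x => Subsingleton.elim _ _⟩⟩
  · intro M _ _ N h1 h2
    exact ⟨pdLeOne_of_submodule N h1.1 h2.1, fun X _ _ hX =>
      extZero_of_submodule N (h1.2 X hX) (h2.2 X hX)⟩
  · intro N _ _ hN v hv
    exact ⟨h.trace_piece hm hN v hv, h.closed_bot_quotient.2 (h.closed_trace hm hN v hv)⟩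

lemma OneRel.path_bot_high {i : Fin T.t} {v w : Vtx T.t T.ℓ} (hv : Low b i v) (hw : High b w)
    (hvw : pathOf v w ≠ 0) : pathOf (h.bot i) w ≠ 0 := by
  have h1 := h.two_le i
  rw [h.bot_eq]
  cases v with
  | src =>
    cases w with
    | src => exact hw.elim
    | snk => exact absurd rfl hvw
    | mid j d =>
      rw [h.pathOf_ne_zero_iff_src_mid] at hvw
      simp only [High] at hw
      omega
  | snk => exact hv.elim
  | mid j c =>
    obtain ⟨rfl, hc⟩ := hv
    cases w with
    | src => exact hw.elim
    | snk => rw [h.pathOf_ne_zero_iff_mid_snk]; simp only; omega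
    | mid l d =>
      rw [h.pathOf_ne_zero_iff_mid] at hvw ⊢
      obtain ⟨rfl, h2, h3⟩ := hvw
      simp only [High] at hw
      exact ⟨rfl, by simp only; omega, by simp only; omega⟩

lemma OneRel.closed_of_hom (hm : mDim T = 0) {X Y : ModuleCat.{u} (Alg T)ᵐᵒᵖ}
    (hX : Indec (Alg T)ᵐᵒᵖ X) (f : X →ₗ[(Alg T)ᵐᵒᵖ] Y) (hf : f ≠ 0)
    (hY : h.Closed (⊥ : Submodule (Alg T)ᵐᵒᵖ Y)) : h.Closed (⊥ : Submodule (Alg T)ᵐᵒᵖ X) := by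
  let N₀ : Submodule (Alg T)ᵐᵒᵖ X :=
    { carrier := {n | ∀ (c : (Alg T)ᵐᵒᵖ) (w : Vtx T.t T.ℓ), High b w → op (ev T w) • c • n = 0}
      add_mem' := fun {x y} hx hy c w hw => by
        rw [smul_add, smul_add, hx c w hw, hy c w hw, add_zero]
      zero_mem' := fun c w _ => by rw [smul_zero, smul_zero]
      smul_mem' := fun d x hx c w hw => by
        rw [← mul_smul c d]
        exact hx _ w hw }
  let N := LinearMap.ker f ⊓ N₀
  have hN : h.Closed N := by
    rintro i v hv n ⟨hn1, hn2⟩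
    refine ⟨?_, ?_⟩
    · change f _ = 0 at hn1
      change f _ = 0
      rw [map_smul] at hn1 ⊢
      exact (Submodule.mem_bot _).1 (hY i v hv _ ((Submodule.mem_bot _).2 hn1))
    · intro c w hw
      obtain ⟨c, rfl⟩ := op_surjective c
      obtain ⟨d, hd⟩ := corner hm v w c
      rw [← mul_smul, ← mul_smul, ← op_mul, ← op_mul, ← mul_assoc, hd]
      by_cases hp : pathOf v w = 0
      · rw [hp, smul_zero, op_zero, zero_smul]
      · have hb := h.path_bot_high hv hw hp
        have hww : pathOf w w ≠ 0 := by rw [pathOf_self]; exact ev_ne_zero _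
        have h1 := hn2 (op (d • pathOf (h.bot i) w)) w hw
        rwa [← mul_smul, ← mul_smul, ← op_mul, ← op_mul, ← pathOf_self w, smul_mul_assoc,
          pathOf_mul hm hb hww, mul_smul_comm, pathOf_mul hm (h.path_bot_iff.2 hv) hb] at h1
  obtain ⟨s, hs⟩ := (h.pdLeOne_and_extZero hm (h.closed_bot_quotient.2 hN)).2 N
    (fun w hw x => by
      apply Subtype.ext
      have := x.2.2 1 w hw
      rwa [one_smul] at this) X N.subtype N.mkQ Subtype.val_injective (Submodule.mkQ_surjective _)
    (by rw [Submodule.range_subtype, Submodule.ker_mkQ])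
  have hs' : ∀ x, N.mkQ (s x) = x := fun x => LinearMap.congr_fun hs x
  rcases hX.2 (s.comp N.mkQ) (by
    ext x
    change s (N.mkQ (s (N.mkQ x))) = s (N.mkQ x)
    rw [hs']) with h0 | h0
  · exfalso
    apply hf
    ext x
    have h1 : N.mkQ x = 0 := by
      rw [← hs' (N.mkQ x), show s (N.mkQ x) = 0 from LinearMap.congr_fun h0 x, map_zero]
    rw [Submodule.mkQ_apply, Submodule.Quotient.mk_eq_zero] at h1
    exact h1.1
  · have : N = ⊥ := by
      rw [eq_bot_iff]
      intro x hx
      rw [Submodule.mem_bot, ← LinearMap.id_apply (R := (Alg T)ᵐᵒᵖ) x, ← h0]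
      change s (N.mkQ x) = 0
      rw [show N.mkQ x = 0 by rwa [Submodule.mkQ_apply, Submodule.Quotient.mk_eq_zero], map_zero]
    rwa [this] at hN

lemma OneRel.quasitilted (hm : mDim T = 0) : Quasitilted (Alg T)ᵐᵒᵖ := by
  intro P hP hPf hPp
  refine ⟨hP, hPf, fun X _ _ hXP => ?_⟩
  have : h.Closed (⊥ : Submodule (Alg T)ᵐᵒᵖ X) := by
    induction hXP using Relation.ReflTransGen.head_induction_on with
    | refl => exact h.closed_of_projective hm
    | head hstep _ ih =>
      obtain ⟨hX, -, hM, hMf, f, hf, -⟩ := hstep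
      exact h.closed_of_hom hm hX f hf (ih hM hMf)
  exact (h.pdLeOne_and_extZero hm this).1

end Quasitilted

section Forest

/-- A family of strict orders on `V` indexed by `J`, each of which is a forest, and such that
a chain of two relations stays in one of the orders. -/
structure Forest (J V : Type) where
  lt : J → V → V → Prop
  trans : ∀ {j u v w}, lt j u v → lt j v w → lt j u w
  tree : ∀ {j u v w}, lt j u w → lt j v w → u = v ∨ lt j u v ∨ lt j v u
  branch : ∀ {i j u v w}, lt i u v → lt j v w → i = j
  rank : V → ℕ
  rank_lt : ∀ {j u v}, lt j u v → rank v < rank u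

variable {J V : Type} [Fintype J] [Fintype V] (F : Forest J V) (k : Type u) [Field k]

include F in
omit [Fintype J] [Fintype V] in
lemma Forest.irrefl {j : J} {v : V} : ¬ F.lt j v v := fun h => (F.rank_lt h).false

omit [Fintype J] [Fintype V] in
lemma Forest.asymm {j j' : J} {v w : V} (h : F.lt j v w) : ¬ F.lt j' w v := fun h' =>
  absurd (F.rank_lt h) (F.rank_lt h').asymm

/-- The path algebra of the quiver of covering relations of the forests. -/
def Forest.alg : Subalgebra k (J → Matrix V V k) where
  carrier := {h | (∀ j v w, v ≠ w → ¬ F.lt j v w → h j v w = 0) ∧ ∀ i j v, h i v v = h j v v}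
  zero_mem' := ⟨fun _ _ _ _ _ => rfl, fun _ _ _ => rfl⟩
  add_mem' := by
    rintro x y ⟨h1, h2⟩ ⟨h3, h4⟩
    refine ⟨fun j v w hne hlt => ?_, fun i j v => ?_⟩
    · rw [Pi.add_apply, Matrix.add_apply, h1 j v w hne hlt, h3 j v w hne hlt, add_zero]
    · rw [Pi.add_apply, Matrix.add_apply, h2 i j, h4 i j, Pi.add_apply, Matrix.add_apply]
  mul_mem' := by
    rintro x y ⟨h1, h2⟩ ⟨h3, h4⟩
    have hd : ∀ j v, (x * y) j v v = x j v v * y j v v := by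
      intro j v
      rw [Pi.mul_apply, Matrix.mul_apply, Finset.sum_eq_single v]
      · intro u _ hu
        by_cases hlt : F.lt j v u
        · rw [h3 j u v hu (F.asymm hlt), mul_zero]
        · rw [h1 j v u (Ne.symm hu) hlt, zero_mul]
      · simp
    refine ⟨fun j v w hne hlt => ?_, fun i j v => ?_⟩
    · rw [Pi.mul_apply, Matrix.mul_apply]
      refine Finset.sum_eq_zero fun u _ => ?_
      by_cases hvu : v = u
      · subst hvu
        rw [h3 j v w hne hlt, mul_zero]
      by_cases h5 : F.lt j v u
      · by_cases huw : u = w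
        · exact absurd (huw ▸ h5) hlt
        · rw [h3 j u w huw fun h6 => hlt (F.trans h5 h6), mul_zero]
      · rw [h1 j v u hvu h5, zero_mul]
    · rw [hd, hd, h2 i j, h4 i j]
  algebraMap_mem' := by
    intro c
    refine ⟨fun j v w hne _ => ?_, fun i j v => ?_⟩
    · rw [Pi.algebraMap_apply, Matrix.algebraMap_matrix_apply, if_neg hne]
    · rw [Pi.algebraMap_apply, Pi.algebraMap_apply]

variable {F k}

namespace Forest

omit [Fintype J] in
lemma ext_entries {x y : F.alg k} (h : ∀ j v w, x.1 j v w = y.1 j v w) : x = y :=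
  Subtype.ext (funext fun j => Matrix.ext fun v w => h j v w)

omit [Fintype J] in
lemma entry_eq_zero (x : F.alg k) {j : J} {v w : V} (hne : v ≠ w) (hlt : ¬ F.lt j v w) :
    x.1 j v w = 0 := x.2.1 j v w hne hlt

omit [Fintype J] in
lemma entry_diag (x : F.alg k) (i j : J) (v : V) : x.1 i v v = x.1 j v v := x.2.2 i j v

omit [Fintype J] in
lemma entry_mul (x y : F.alg k) (j : J) (v w : V) :
    (x * y).1 j v w = ∑ u, x.1 j v u * y.1 j u w := by
  change (x.1 * y.1) j v w = _
  rw [Pi.mul_apply, Matrix.mul_apply]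

omit [Fintype J] in
lemma entry_add (x y : F.alg k) (j : J) (v w : V) : (x + y).1 j v w = x.1 j v w + y.1 j v w := rfl

omit [Fintype J] in
lemma entry_smul (c : k) (x : F.alg k) (j : J) (v w : V) : (c • x).1 j v w = c * x.1 j v w := rfl

omit [Fintype J] in
lemma entry_zero (j : J) (v w : V) : (0 : F.alg k).1 j v w = 0 := rfl

omit [Fintype J] in
lemma entry_one (j : J) (v w : V) : (1 : F.alg k).1 j v w = if v = w then 1 else 0 := by
  change (1 : J → Matrix V V k) j v w = _
  rw [Pi.one_apply, Matrix.one_apply]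

omit [Fintype J] in
lemma entry_sum {ι : Type*} (s : Finset ι) (x : ι → F.alg k) (j : J) (v w : V) :
    (∑ i ∈ s, x i).1 j v w = ∑ i ∈ s, (x i).1 j v w := by
  induction s using Finset.induction_on with
  | empty => simp [entry_zero]
  | insert a s ha ih => rw [Finset.sum_insert ha, Finset.sum_insert ha, entry_add, ih]

omit [Fintype J] in
lemma entry_mul_diag (x y : F.alg k) (j : J) (v : V) :
    (x * y).1 j v v = x.1 j v v * y.1 j v v := by
  rw [entry_mul, Finset.sum_eq_single v]
  · intro u _ hu
    by_cases hlt : F.lt j v u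
    · rw [entry_eq_zero y hu (F.asymm hlt), mul_zero]
    · rw [entry_eq_zero x (Ne.symm hu) hlt, zero_mul]
  · simp

variable (F k) in
/-- The trivial path at a vertex. -/
def idem (v : V) : F.alg k :=
  ⟨fun _ x y => if x = v ∧ y = v then 1 else 0, fun j x y hne _ => by
    refine if_neg ?_
    rintro ⟨rfl, rfl⟩
    exact hne rfl, fun i j v => rfl⟩

variable (F k) in
/-- The path from `v` to `w` in the `i`-th order. -/
def edge (i : J) (v w : V) : F.alg k :=
  ⟨fun j x y => if j = i ∧ x = v ∧ y = w ∧ F.lt i v w then 1 else 0, fun j x y _ hlt => by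
    refine if_neg ?_
    rintro ⟨rfl, rfl, rfl, h⟩
    exact hlt h, fun j j' x => by
    refine (if_neg ?_).trans (if_neg ?_).symm
    · rintro ⟨_, rfl, rfl, h⟩
      exact F.irrefl h
    · rintro ⟨_, rfl, rfl, h⟩
      exact F.irrefl h⟩

omit [Fintype J] in
lemma entry_idem (v : V) (j : J) (x y : V) :
    (idem F k v).1 j x y = if x = v ∧ y = v then 1 else 0 := rfl

omit [Fintype J] in
lemma entry_edge (i : J) (v w : V) (j : J) (x y : V) :
    (edge F k i v w).1 j x y = if j = i ∧ x = v ∧ y = w ∧ F.lt i v w then 1 else 0 := rfl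

omit [Fintype J] in
lemma entry_idem_mul (v : V) (x : F.alg k) (j : J) (a b : V) :
    (idem F k v * x).1 j a b = if a = v then x.1 j v b else 0 := by
  rw [entry_mul, Finset.sum_eq_single v]
  · rw [entry_idem]
    by_cases h : a = v <;> simp [h]
  · intro u _ hu
    rw [entry_idem, if_neg fun h => hu h.2, zero_mul]
  · simp

omit [Fintype J] in
lemma entry_mul_idem (v : V) (x : F.alg k) (j : J) (a b : V) :
    (x * idem F k v).1 j a b = if b = v then x.1 j a v else 0 := by
  rw [entry_mul, Finset.sum_eq_single v]
  · rw [entry_idem]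
    by_cases h : b = v <;> simp [h]
  · intro u _ hu
    rw [entry_idem, if_neg fun h => hu h.1, mul_zero]
  · simp

omit [Fintype J] in
lemma entry_edge_mul (i : J) (v w : V) (x : F.alg k) (j : J) (a b : V) :
    (edge F k i v w * x).1 j a b = if j = i ∧ a = v ∧ F.lt i v w then x.1 j w b else 0 := by
  rw [entry_mul, Finset.sum_eq_single w]
  · rw [entry_edge]
    by_cases h : j = i ∧ a = v ∧ F.lt i v w
    · rw [if_pos h, if_pos ⟨h.1, h.2.1, rfl, h.2.2⟩, one_mul]
    · rw [if_neg h, if_neg fun h' => h ⟨h'.1, h'.2.1, h'.2.2.2⟩, zero_mul]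
  · intro u _ hu
    rw [entry_edge, if_neg fun h => hu h.2.2.1, zero_mul]
  · simp

omit [Fintype J] in
lemma idem_mul_self (v : V) : idem F k v * idem F k v = idem F k v := by
  refine ext_entries fun j a b => ?_
  rw [entry_idem_mul, entry_idem, entry_idem]
  by_cases h : a = v <;> simp [h]

omit [Fintype J] in
lemma sum_idem : ∑ v, idem F k v = 1 := by
  refine ext_entries fun j a b => ?_
  rw [entry_sum, entry_one, Finset.sum_eq_single a]
  · rw [entry_idem]
    simp only [true_and]
    exact if_congr eq_comm rfl rfl
  · intro u _ hu
    rw [entry_idem, if_neg fun h => hu h.1.symm]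
  · simp

omit [Fintype J] in
lemma edge_mul_idem (i : J) (v w : V) : edge F k i v w * idem F k w = edge F k i v w := by
  refine ext_entries fun j a b => ?_
  rw [entry_edge_mul, entry_edge, entry_idem]
  by_cases h : b = w <;> simp [h]

omit [Fintype J] in
lemma edge_mul_edge {i : J} {u v w : V} (huv : F.lt i u v) (hvw : F.lt i v w) :
    edge F k i u v * edge F k i v w = edge F k i u w := by
  refine ext_entries fun j a b => ?_
  rw [entry_edge_mul, entry_edge, entry_edge]
  simp only [huv, hvw, F.trans huv hvw, and_true]
  by_cases h1 : j = i <;> by_cases h2 : a = u <;> simp [h1, h2]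

omit [Fintype J] in
lemma idem_mul_mul_idem [Nonempty J] (v : V) (x : F.alg k) :
    ∃ c : k, idem F k v * x * idem F k v = c • idem F k v := by
  refine ⟨x.1 (Classical.arbitrary J) v v, ext_entries fun j a b => ?_⟩
  rw [entry_mul_idem, entry_idem_mul, entry_smul, entry_idem]
  by_cases h1 : a = v <;> by_cases h2 : b = v <;> simp [h1, h2]
  exact entry_diag x _ _ _

/-- `w` covers `v` in the `i`-th order. -/
def Cov (F : Forest J V) (v : V) (c : J × V) : Prop :=
  F.lt c.1 v c.2 ∧ ∀ u, F.lt c.1 v u → ¬ F.lt c.1 u c.2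

omit [Fintype J] in
lemma exists_cov {j : J} {v b : V} (h : F.lt j v b) :
    ∃ w, F.Cov v (j, w) ∧ (w = b ∨ F.lt j w b) := by
  obtain ⟨w, hw, hmax⟩ := Finset.exists_max_image
    (Finset.univ.filter fun w => F.lt j v w ∧ (w = b ∨ F.lt j w b)) F.rank
    ⟨b, by simp [h]⟩
  simp only [Finset.mem_filter, Finset.mem_univ, true_and] at hw hmax
  refine ⟨w, ⟨hw.1, fun u hu huw => ?_⟩, hw.2⟩
  refine absurd (hmax u ⟨hu, .inr ?_⟩) (not_le.2 (F.rank_lt huw))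
  rcases hw.2 with rfl | h1
  · exact huw
  · exact F.trans huw h1

omit [Fintype J] [Fintype V] in
lemma cov_unique {j : J} {v w w' b : V} (h : F.Cov v (j, w)) (h' : F.Cov v (j, w'))
    (hb : w = b ∨ F.lt j w b) (hb' : w' = b ∨ F.lt j w' b) : w = w' := by
  rcases hb with rfl | hb
  · rcases hb' with rfl | hb'
    · rfl
    · exact absurd hb' (h.2 _ h'.1)
  · rcases hb' with rfl | hb'
    · exact absurd hb (h'.2 _ h.1)
    · rcases F.tree hb hb' with h1 | h1 | h1
      · exact h1
      · exact absurd h1 (h'.2 _ h.1)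
      · exact absurd h1 (h.2 _ h'.1)

variable (F k) in
/-- The radical of the projective at `v`. -/
def radIdeal (v : V) : Submodule (F.alg k)ᵐᵒᵖ (F.alg k)ᵐᵒᵖ where
  carrier := {x | x * op (idem F k v) = x ∧ op (idem F k v) * x = 0}
  zero_mem' := ⟨zero_mul _, mul_zero _⟩
  add_mem' := by
    rintro x y ⟨h1, h2⟩ ⟨h3, h4⟩
    exact ⟨by rw [add_mul, h1, h3], by rw [mul_add, h2, h4, add_zero]⟩
  smul_mem' := by
    rintro c x ⟨h1, h2⟩
    obtain ⟨c, rfl⟩ := op_surjective c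
    obtain ⟨x, rfl⟩ := op_surjective x
    have h1' : idem F k v * x = x := op_injective h1
    have h2' : x * idem F k v = 0 := op_injective h2
    change op c * op x * _ = op c * op x ∧ _ * (op c * op x) = 0
    refine ⟨by rw [mul_assoc, h1], ?_⟩
    rw [← op_mul, ← op_mul, ← h1', ← op_zero]
    congr 1
    refine ext_entries fun j a b => ?_
    rw [entry_mul_idem, mul_assoc, entry_idem_mul, entry_zero]
    split_ifs
    · rw [entry_mul_diag]
      have := congrArg (fun y : F.alg k => y.1 j v v) h2'
      simp only [entry_mul_idem, entry_zero, if_true] at this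
      rw [this, zero_mul]
    · rfl
    · rfl

omit [Fintype J] in
lemma mem_radIdeal {v : V} {x : F.alg k} : op x ∈ radIdeal F k v ↔
    (∀ j a b, a ≠ v → x.1 j a b = 0) ∧ ∀ j, x.1 j v v = 0 := by
  have : op x ∈ radIdeal F k v ↔ idem F k v * x = x ∧ x * idem F k v = 0 :=
    and_congr op_injective.eq_iff op_injective.eq_iff
  rw [this]
  constructor
  · rintro ⟨h1, h2⟩
    refine ⟨fun j a b ha => ?_, fun j => ?_⟩
    · rw [← h1, entry_idem_mul, if_neg ha]
    · have := congrArg (fun y : F.alg k => y.1 j v v) h2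
      simpa only [entry_mul_idem, entry_zero, if_true] using this
  · rintro ⟨h1, h2⟩
    refine ⟨ext_entries fun j a b => ?_, ext_entries fun j a b => ?_⟩
    · rw [entry_idem_mul]
      split_ifs with h
      · rw [h]
      · rw [h1 j a b h]
    · rw [entry_mul_idem, entry_zero]
      split_ifs
      · by_cases ha : a = v
        · rw [ha, h2]
        · rw [h1 j a v ha]
      · rfl

lemma projective_radIdeal (v : V) : Module.Projective (F.alg k)ᵐᵒᵖ (radIdeal F k v) := by
  have hy : ∀ c : {c : J × V // F.Cov v c}, op (edge F k c.1.1 v c.1.2) ∈ radIdeal F k v := by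
    intro c
    rw [mem_radIdeal]
    refine ⟨fun j a b ha => ?_, fun j => ?_⟩
    · rw [entry_edge, if_neg fun h => ha h.2.1]
    · rw [entry_edge, if_neg]
      rintro ⟨_, _, h, h'⟩
      rw [← h] at h'
      exact F.irrefl h'
  have hsum : ∀ b : {c : J × V // F.Cov v c} → F.alg k,
      ((∑ c, op (b c) • (⟨op (edge F k c.1.1 v c.1.2), hy c⟩ : radIdeal F k v) : radIdeal F k v) :
        (F.alg k)ᵐᵒᵖ) = op (∑ c, edge F k c.1.1 v c.1.2 * b c) := by
    intro b
    rw [AddSubmonoidClass.coe_finsetSum, Finset.op_sum]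
    rfl
  have hsum' : ∀ (b : {c : J × V // F.Cov v c} → F.alg k) (j : J) (x : V),
      (∑ c, edge F k c.1.1 v c.1.2 * b c).1 j v x =
        ∑ c, if j = c.1.1 then (b c).1 j c.1.2 x else 0 := by
    intro b j x
    rw [entry_sum]
    refine Finset.sum_congr rfl fun c _ => ?_
    rw [entry_edge_mul]
    simp only [c.2.1, and_true]
  refine projective_of_generators (B := (F.alg k)ᵐᵒᵖ) (M := radIdeal F k v)
    (ι := {c : J × V // F.Cov v c})
    (fun c => (⟨_, hy c⟩ : radIdeal F k v))
    (fun c => op (idem F k c.1.2)) (fun c => ?_) (fun x => ?_) (fun b hb c => ?_)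
  · apply Subtype.ext
    change op _ * op _ = op _
    rw [← op_mul, edge_mul_idem]
  · obtain ⟨x, hx⟩ := x
    obtain ⟨x, rfl⟩ := op_surjective x
    obtain ⟨h1, h2⟩ := mem_radIdeal.1 hx
    let b : {c : J × V // F.Cov v c} → F.alg k := fun c =>
      ⟨fun j a y => if a = c.1.2 ∧ (y = c.1.2 ∨ (j = c.1.1 ∧ F.lt j a y)) then
        x.1 c.1.1 v y else 0, fun j a y hne hlt => by
          refine if_neg ?_
          rintro ⟨rfl, h | h⟩
          · exact hne h.symm
          · exact hlt h.2, fun i j a => by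
          by_cases h : a = c.1.2
          · simp [h]
          · simp [h]⟩
    have hb : ∀ c j a y, (b c).1 j a y =
      if a = c.1.2 ∧ (y = c.1.2 ∨ (j = c.1.1 ∧ F.lt j a y)) then x.1 c.1.1 v y else 0 :=
      fun _ _ _ _ => rfl
    refine ⟨fun c => op (b c), ?_⟩
    apply Subtype.ext
    rw [hsum]
    change op x = _
    congr 1
    refine ext_entries fun j a y => ?_
    by_cases ha : a = v
    · subst ha
      rw [hsum']
      by_cases hlt : F.lt j a y
      · obtain ⟨w, hw, hwy⟩ := exists_cov hlt
        rw [Finset.sum_eq_single ⟨(j, w), hw⟩]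
        · rw [if_pos rfl, hb, if_pos]
          refine ⟨rfl, ?_⟩
          rcases hwy with h | h
          · exact .inl h.symm
          · exact .inr ⟨rfl, h⟩
        · rintro ⟨⟨j', w'⟩, hw'⟩ _ hne
          simp only
          split_ifs with hj
          · subst hj
            rw [hb, if_neg]
            rintro ⟨-, h | h⟩
            · exact hne (Subtype.ext (Prod.ext rfl (cov_unique hw' hw (.inl h.symm) hwy)))
            · exact hne (Subtype.ext (Prod.ext rfl (cov_unique hw' hw (.inr h.2) hwy)))
          · rfl
        · simp
      · have h0 : x.1 j a y = 0 := by
          by_cases hay : a = y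
          · rw [← hay, h2]
          · exact entry_eq_zero x hay hlt
        rw [h0, Finset.sum_eq_zero]
        intro c _
        split_ifs with hj
        · rw [hb, ← hj, h0, ite_self]
        · rfl
    · rw [h1 j a y ha, entry_sum, Finset.sum_eq_zero]
      intro c _
      rw [entry_edge_mul, if_neg fun h => ha h.2.1]
  · obtain ⟨⟨i, w⟩, hw⟩ := c
    choose b' hb' using fun c => op_surjective (b c)
    obtain rfl : (fun c => op (b' c)) = b := funext hb'
    have h1 := congrArg Subtype.val hb
    rw [hsum] at h1
    have h1' : ∑ c, edge F k c.1.1 v c.1.2 * b' c = 0 := op_injective h1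
    have key : ∀ y, (y = w ∨ F.lt i w y) → (b' ⟨(i, w), hw⟩).1 i w y = 0 := by
      intro y hy
      have h2 := hsum' b' i y
      rw [h1', entry_zero, Finset.sum_eq_single ⟨(i, w), hw⟩, if_pos rfl] at h2
      · exact h2.symm
      · rintro ⟨⟨j', w'⟩, hw'⟩ _ hne
        simp only
        split_ifs with hj
        · subst hj
          by_contra h3
          have h4 : w' = y ∨ F.lt i w' y := by
            by_contra h4
            rw [not_or] at h4
            exact h3 (entry_eq_zero _ h4.1 h4.2)
          refine hne (Subtype.ext (Prod.ext rfl (cov_unique hw' hw h4 ?_)))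
          exact hy.imp Eq.symm id
        · rfl
      · simp
    change op _ * op (idem F k w) = 0
    rw [← op_mul, ← op_zero]
    congr 1
    refine ext_entries fun j a y => ?_
    rw [entry_idem_mul, entry_zero]
    split_ifs with ha
    · by_cases hy : w = y
      · subst hy
        rw [entry_diag _ j i]
        exact key w (.inl rfl)
      · by_cases hlt : F.lt j w y
        · obtain rfl := F.branch hw.1 hlt
          exact key y (.inr hlt)
        · exact entry_eq_zero _ hy hlt
    · rfl

instance [Nonempty V] : FiniteDimensional k (F.alg k) := inferInstance

lemma hereditary [Nonempty J] : Hereditary (F.alg k)ᵐᵒᵖ := by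
  intro M
  refine filtration_induction (fun v => op (idem F k v))
    (fun v => by rw [← op_mul, idem_mul_self]) (by rw [← Finset.op_sum, sum_idem, op_one]) F.rank
    (fun _ => True) (fun N => PdLeOne (F.alg k)ᵐᵒᵖ N) ?_ ?_ ?_ M trivial
  · intro N hN
    have : Subsingleton N := ⟨fun x y => by rw [hN x, hN y]⟩
    have : Module.Projective (F.alg k)ᵐᵒᵖ N :=
      Module.Projective.of_lifting_property'' fun g _ =>
        ⟨0, LinearMap.ext fun x => Subsingleton.elim _ _⟩
    exact pdLeOne_of_projective
  · intro M _ _ N h1 h2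
    exact pdLeOne_of_submodule N h1 h2
  · intro N _ _ _ v hv
    refine ⟨?_, trivial⟩
    have := projective_radIdeal (F := F) (k := k) v
    refine (trace_piece (k := k) (e := op (idem F k v)) (by rw [← op_mul, idem_mul_self])
      (W := Unit) (fun _ => op (idem F k v)) (fun _ => op (idem F k v)) (fun x _ => ?_)
      (radIdeal F k v) (fun x => ?_) N (fun _ n hn hn' => by rw [← hn, hn'])
      (fun x hx n hn => ?_)).1
    · obtain ⟨x, rfl⟩ := op_surjective x
      obtain ⟨c, hc⟩ := idem_mul_mul_idem v x
      exact ⟨c, by rw [← op_mul, ← op_mul, ← mul_assoc, hc, op_smul]⟩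
    · exact ⟨fun h => ⟨h.1, fun _ => h.2⟩, fun h => ⟨h.1, h.2 ()⟩⟩
    · obtain ⟨x, rfl⟩ := op_surjective x
      obtain ⟨h1, h2⟩ := mem_radIdeal.1 hx
      rw [← one_smul (F.alg k)ᵐᵒᵖ (op x • n), ← op_one, ← sum_idem, Finset.op_sum,
        Finset.sum_smul]
      refine Finset.sum_eq_zero fun w _ => ?_
      by_cases hw : ∃ j, F.lt j v w
      · obtain ⟨j, hj⟩ := hw
        exact hv w (F.rank_lt hj) _
      · rw [← mul_smul, ← op_mul]
        have : x * idem F k w = 0 := by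
          refine ext_entries fun j a b => ?_
          rw [entry_mul_idem, entry_zero]
          split_ifs
          · by_cases ha : a = v
            · subst ha
              by_cases haw : a = w
              · rw [← haw, h2]
              · exact entry_eq_zero x haw fun h => hw ⟨j, h⟩
            · rw [h1 j a w ha]
          · rfl
        rw [this, op_zero, zero_smul]

end Forest

end Forest

section Thin

set_option linter.unusedSectionVars false

variable {J V : Type} [Fintype V] {F : Forest J V} {k : Type u} [Field k]

/-- A branch together with a convex set of vertices. -/
structure ConvexSet (F : Forest J V) where
  br : J
  supp : V → Prop
  convex : ∀ {u x w}, supp u → supp w → F.lt br u x → F.lt br x w → supp x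

/-- The thin module supported on a convex set. -/
def Thin (C : ConvexSet F) (k : Type u) : Type u := {w // C.supp w} → k

namespace Thin

variable {C : ConvexSet F}

instance : AddCommGroup (Thin C k) := inferInstanceAs (AddCommGroup ({w // C.supp w} → k))

instance : Module k (Thin C k) := inferInstanceAs (Module k ({w // C.supp w} → k))

instance : FiniteDimensional k (Thin C k) :=
  inferInstanceAs (FiniteDimensional k ({w // C.supp w} → k))

lemma ext_apply {f g : Thin C k} (h : ∀ w, f w = g w) : f = g := funext h

lemma add_apply (f g : Thin C k) (w : {w // C.supp w}) : (f + g) w = f w + g w := rfl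

lemma zero_apply (w : {w // C.supp w}) : (0 : Thin C k) w = 0 := rfl

lemma ksmul_apply (c : k) (f : Thin C k) (w : {w // C.supp w}) : (c • f) w = c * f w := rfl

instance : SMul (F.alg k)ᵐᵒᵖ (Thin C k) where
  smul x f := fun w => ∑ u : {w // C.supp w}, f u * x.unop.1 C.br u.1 w.1

lemma smul_apply (x : F.alg k) (f : Thin C k) (w : {w // C.supp w}) :
    (op x • f) w = ∑ u : {w // C.supp w}, f u * x.1 C.br u.1 w.1 := rfl

lemma entry_mul_of_supp (x y : F.alg k) {s w : V} (hs : C.supp s) (hw : C.supp w) :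
    (x * y).1 C.br s w = ∑ u : {w // C.supp w}, x.1 C.br s u.1 * y.1 C.br u.1 w := by
  rw [Forest.entry_mul, ← Fintype.sum_subtype_add_sum_subtype C.supp, add_eq_left]
  refine Finset.sum_eq_zero fun u _ => ?_
  obtain ⟨u, hu⟩ := u
  by_cases h1 : F.lt C.br s u
  · by_cases h2 : F.lt C.br u w
    · exact absurd (C.convex hs hw h1 h2) hu
    · rw [Forest.entry_eq_zero y (by rintro rfl; exact hu hw) h2, mul_zero]
  · rw [Forest.entry_eq_zero x (by rintro rfl; exact hu hs) h1, zero_mul]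

instance : Module (F.alg k)ᵐᵒᵖ (Thin C k) where
  one_smul f := by
    rw [← op_one]
    refine ext_apply fun w => ?_
    rw [smul_apply, Finset.sum_eq_single w]
    · rw [Forest.entry_one, if_pos rfl, mul_one]
    · intro u _ hu
      rw [Forest.entry_one, if_neg fun h => hu (Subtype.ext h), mul_zero]
    · simp
  mul_smul x y f := by
    obtain ⟨x, rfl⟩ := op_surjective x
    obtain ⟨y, rfl⟩ := op_surjective y
    refine ext_apply fun w => ?_
    rw [← op_mul, smul_apply, smul_apply]
    simp only [smul_apply, Finset.sum_mul]
    rw [Finset.sum_comm]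
    refine Finset.sum_congr rfl fun s _ => ?_
    rw [entry_mul_of_supp y x s.2 w.2, Finset.mul_sum]
    exact Finset.sum_congr rfl fun u _ => (mul_assoc _ _ _).symm
  smul_zero x := by
    obtain ⟨x, rfl⟩ := op_surjective x
    refine ext_apply fun w => ?_
    rw [smul_apply]
    exact Finset.sum_eq_zero fun u _ => zero_mul _
  smul_add x f g := by
    obtain ⟨x, rfl⟩ := op_surjective x
    refine ext_apply fun w => ?_
    rw [add_apply, smul_apply, smul_apply, smul_apply, ← Finset.sum_add_distrib]
    exact Finset.sum_congr rfl fun u _ => add_mul _ _ _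
  add_smul x y f := by
    obtain ⟨x, rfl⟩ := op_surjective x
    obtain ⟨y, rfl⟩ := op_surjective y
    refine ext_apply fun w => ?_
    rw [← op_add, add_apply, smul_apply, smul_apply, smul_apply, ← Finset.sum_add_distrib]
    exact Finset.sum_congr rfl fun u _ => mul_add _ _ _
  zero_smul f := by
    rw [← op_zero]
    refine ext_apply fun w => ?_
    rw [smul_apply]
    exact Finset.sum_eq_zero fun u _ => mul_zero _

instance : SMulCommClass (F.alg k)ᵐᵒᵖ k (Thin C k) where
  smul_comm x c f := by
    obtain ⟨x, rfl⟩ := op_surjective x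
    refine ext_apply fun w => ?_
    rw [ksmul_apply, smul_apply, smul_apply, Finset.mul_sum]
    exact Finset.sum_congr rfl fun u _ => mul_assoc _ _ _

instance : IsScalarTower k (F.alg k)ᵐᵒᵖ (Thin C k) where
  smul_assoc c x f := by
    obtain ⟨x, rfl⟩ := op_surjective x
    refine ext_apply fun w => ?_
    rw [← op_smul, ksmul_apply, smul_apply, smul_apply, Finset.mul_sum]
    refine Finset.sum_congr rfl fun u _ => ?_
    rw [Forest.entry_smul, mul_left_comm]

variable (k C) in
/-- The basis vector at a vertex of the support (zero for the other vertices). -/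
def delta (v : V) : Thin C k := fun w => if w.1 = v then 1 else 0

lemma delta_apply (v : V) (w : {w // C.supp w}) :
    delta k C v w = if w.1 = v then 1 else 0 := rfl

lemma delta_ne_zero {v : V} (hv : C.supp v) : delta k C v ≠ 0 := fun h => by
  have := congrFun h ⟨v, hv⟩
  rw [delta_apply, if_pos rfl] at this
  exact one_ne_zero this

lemma smul_delta (x : F.alg k) {v : V} (hv : C.supp v) (w : {w // C.supp w}) :
    (op x • delta k C v) w = x.1 C.br v w.1 := by
  rw [smul_apply, Finset.sum_eq_single ⟨v, hv⟩]
  · rw [delta_apply, if_pos rfl, one_mul]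
  · intro u _ hu
    rw [delta_apply, if_neg fun h => hu (Subtype.ext h), zero_mul]
  · simp

lemma idem_smul (v : V) (f : Thin C k) (w : {w // C.supp w}) :
    (op (Forest.idem F k v) • f) w = if w.1 = v then f w else 0 := by
  rw [smul_apply, Finset.sum_eq_single w]
  · rw [Forest.entry_idem]
    by_cases h : w.1 = v <;> simp [h]
  · intro u _ hu
    rw [Forest.entry_idem, if_neg, mul_zero]
    exact fun h => hu (Subtype.ext (h.1.trans h.2.symm))
  · simp

lemma idem_smul_delta (v : V) : op (Forest.idem F k v) • delta k C v = delta k C v :=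
  ext_apply fun w => by
    rw [idem_smul, delta_apply]
    split_ifs <;> rfl

lemma eq_smul_delta {v : V} (hv : C.supp v) {f : Thin C k}
    (hf : op (Forest.idem F k v) • f = f) : f = f ⟨v, hv⟩ • delta k C v :=
  ext_apply fun w => by
    rw [ksmul_apply, delta_apply]
    by_cases h : w.1 = v
    · obtain ⟨w, hw⟩ := w
      obtain rfl : w = v := h
      rw [if_pos rfl, mul_one]
    · rw [if_neg h, mul_zero, ← hf, idem_smul, if_neg h]

lemma eq_zero_of_idem_smul {v : V} (hv : ¬ C.supp v) {f : Thin C k}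
    (hf : op (Forest.idem F k v) • f = f) : f = 0 :=
  ext_apply fun w => by
    rw [← hf, idem_smul, if_neg fun h : w.1 = v => hv (h ▸ w.2), zero_apply]

lemma edge_smul (j : J) (v w : V) (f : Thin C k) (y : {w // C.supp w}) :
    (op (Forest.edge F k j v w) • f) y =
      if h : j = C.br ∧ y.1 = w ∧ F.lt j v w ∧ C.supp v then f ⟨v, h.2.2.2⟩ else 0 := by
  rw [smul_apply]
  split_ifs with h
  · rw [Finset.sum_eq_single ⟨v, h.2.2.2⟩]
    · rw [Forest.entry_edge, if_pos ⟨h.1.symm, rfl, h.2.1, h.2.2.1⟩, mul_one]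
    · intro u _ hu
      rw [Forest.entry_edge, if_neg fun h' => hu (Subtype.ext h'.2.1), mul_zero]
    · simp
  · refine Finset.sum_eq_zero fun u _ => ?_
    rw [Forest.entry_edge, if_neg, mul_zero]
    rintro ⟨h1, h2, h3, h4⟩
    exact h ⟨h1.symm, h3, h4, h2 ▸ u.2⟩

/-- An algebra element sending the basis vector at `g` to a prescribed vector. -/
def elt (g : V) (f : Thin C k) : F.alg k :=
  ⟨fun j x y => if h : x = g ∧ C.supp y ∧ (y = g ∨ (j = C.br ∧ F.lt j g y)) then f ⟨y, h.2.1⟩ else 0,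
    fun j x y hne hlt => by
      refine dif_neg ?_
      rintro ⟨rfl, _, h | h⟩
      · exact hne h.symm
      · exact hlt h.2,
    fun i j x => by
      by_cases h : x = g <;> simp [h]⟩

lemma entry_elt (g : V) (f : Thin C k) (j : J) (x y : V) : (elt g f).1 j x y =
    if h : x = g ∧ C.supp y ∧ (y = g ∨ (j = C.br ∧ F.lt j g y)) then f ⟨y, h.2.1⟩ else 0 := rfl

/-- `g` generates the thin module. -/
def IsGen (C : ConvexSet F) (g : V) : Prop :=
  C.supp g ∧ ∀ w, C.supp w → w = g ∨ F.lt C.br g w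

lemma entry_elt_row {g : V} (hg : IsGen C g) (f : Thin C k) (w : {w // C.supp w}) :
    (elt g f).1 C.br g w.1 = f w := by
  rw [entry_elt, dif_pos]
  exact ⟨rfl, w.2, (hg.2 _ w.2).imp id fun h => ⟨rfl, h⟩⟩

lemma elt_smul_delta {g : V} (hg : IsGen C g) (f : Thin C k) :
    op (elt g f) • delta k C g = f :=
  ext_apply fun w => by rw [smul_delta _ hg.1, entry_elt_row hg]

lemma hom_ext {E : Type*} [AddCommGroup E] [Module (F.alg k)ᵐᵒᵖ E] {g : V} (hg : IsGen C g)
    {φ ψ : Thin C k →ₗ[(F.alg k)ᵐᵒᵖ] E} (h : φ (delta k C g) = ψ (delta k C g)) : φ = ψ :=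
  LinearMap.ext fun f => by rw [← elt_smul_delta hg f, map_smul, map_smul, h]

lemma smul_eq_zero_of_row {E : Type*} [AddCommGroup E] [Module (F.alg k)ᵐᵒᵖ E] [Fintype J] {g : V}
    {z : E} (hz : op (Forest.idem F k g) • z = z) (hgs : C.supp g)
    (hbad : ∀ j w, F.lt j g w → ¬ (j = C.br ∧ C.supp w) → op (Forest.edge F k j g w) • z = 0)
    {d : F.alg k} (hd : ∀ w, C.supp w → d.1 C.br g w = 0) : op d • z = 0 := by
  have key : Forest.idem F k g * d = ∑ j, ∑ w, if F.lt j g w ∧ ¬ (j = C.br ∧ C.supp w) then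
      Forest.edge F k j g w * algebraMap k (F.alg k) (d.1 j g w) else 0 := by
    have hent : ∀ (j : J) (w : V) (i : J) (a b : V),
        (if F.lt j g w ∧ ¬ (j = C.br ∧ C.supp w) then
          Forest.edge F k j g w * algebraMap k (F.alg k) (d.1 j g w) else 0 : F.alg k).1 i a b =
        if i = j ∧ b = w ∧ a = g ∧ F.lt j g w ∧ ¬ (j = C.br ∧ C.supp w) then d.1 j g w else 0 := by
      intro j w i a b
      by_cases h : F.lt j g w ∧ ¬ (j = C.br ∧ C.supp w)
      · rw [if_pos h, ← Algebra.commutes, ← Algebra.smul_def, Forest.entry_smul, Forest.entry_edge]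
        by_cases h1 : i = j <;> by_cases h2 : a = g <;> by_cases h3 : b = w <;> simp [h1, h2, h3, h]
      · rw [if_neg h, Forest.entry_zero, if_neg fun h' => h h'.2.2.2]
    refine Forest.ext_entries fun i a b => ?_
    rw [Forest.entry_idem_mul, Forest.entry_sum, Finset.sum_eq_single i]
    · rw [Forest.entry_sum, Finset.sum_eq_single b]
      · rw [hent]
        by_cases ha : a = g
        · rw [if_pos ha]
          by_cases h : F.lt i g b ∧ ¬ (i = C.br ∧ C.supp b)
          · rw [if_pos ⟨rfl, rfl, ha, h⟩]
          · rw [if_neg fun h' => h h'.2.2.2]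
            by_cases hb : g = b
            · rw [← hb, Forest.entry_diag d i C.br, hd g hgs]
            · by_cases hlt : F.lt i g b
              · obtain ⟨h1, h2⟩ := not_not.1 fun h' => h ⟨hlt, h'⟩
                rw [h1, hd b h2]
              · exact Forest.entry_eq_zero d hb hlt
        · rw [if_neg ha, if_neg fun h => ha h.2.2.1]
      · intro w _ hw
        rw [hent, if_neg fun h => hw h.2.1.symm]
      · simp
    · intro j _ hj
      rw [Forest.entry_sum]
      refine Finset.sum_eq_zero fun w _ => ?_
      rw [hent, if_neg fun h => hj h.1.symm]
    · simp
  rw [← hz, ← mul_smul, ← op_mul, key, Finset.op_sum, Finset.sum_smul]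
  refine Finset.sum_eq_zero fun j _ => ?_
  rw [Finset.op_sum, Finset.sum_smul]
  refine Finset.sum_eq_zero fun w _ => ?_
  split_ifs with h
  · rw [op_mul, mul_smul, hbad j w h.1 h.2, smul_zero]
  · rw [op_zero, zero_smul]

lemma exists_hom {E : Type*} [AddCommGroup E] [Module (F.alg k)ᵐᵒᵖ E] [Fintype J] {g : V}
    (hg : IsGen C g) {z : E} (hz : op (Forest.idem F k g) • z = z)
    (hbad : ∀ j w, F.lt j g w → ¬ (j = C.br ∧ C.supp w) → op (Forest.edge F k j g w) • z = 0) :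
    ∃ φ : Thin C k →ₗ[(F.alg k)ᵐᵒᵖ] E, φ (delta k C g) = z := by
  have hrow : ∀ x y : F.alg k, (∀ w, C.supp w → x.1 C.br g w = y.1 C.br g w) →
      op x • z = op y • z := by
    intro x y h
    rw [← sub_eq_zero, ← sub_smul, ← op_sub]
    refine smul_eq_zero_of_row hz hg.1 hbad fun w hw => ?_
    rw [sub_eq_add_neg, Forest.entry_add, h w hw, ← Forest.entry_add, add_neg_cancel,
      Forest.entry_zero]
  refine ⟨⟨⟨fun f => op (elt g f) • z, fun f f' => ?_⟩, fun x f => ?_⟩, ?_⟩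
  · rw [← add_smul, ← op_add]
    refine hrow _ _ fun w hw => ?_
    rw [Forest.entry_add, entry_elt_row hg _ ⟨w, hw⟩, entry_elt_row hg _ ⟨w, hw⟩,
      entry_elt_row hg _ ⟨w, hw⟩, add_apply]
  · obtain ⟨x, rfl⟩ := op_surjective x
    rw [RingHom.id_apply, ← mul_smul, ← op_mul]
    refine hrow _ _ fun w hw => ?_
    rw [entry_elt_row hg _ ⟨w, hw⟩, smul_apply, entry_mul_of_supp _ _ hg.1 hw]
    refine Finset.sum_congr rfl fun u _ => ?_
    rw [entry_elt_row hg]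
  · change op (elt g (delta k C g)) • z = z
    conv_rhs => rw [← hz]
    refine hrow _ _ fun w hw => ?_
    rw [entry_elt_row hg _ ⟨w, hw⟩, delta_apply, Forest.entry_idem]
    simp

end Thin

end Thin

section ThinFamily

set_option linter.unusedSectionVars false

variable {J V : Type} [Fintype J] [Fintype V] {F : Forest J V} {k : Type u} [Field k]

/-- A family of thin modules with simple top. -/
structure ThinFamily (F : Forest J V) where
  C : V → ConvexSet F
  gen : V → V
  isGen : ∀ v, Thin.IsGen (C v) (gen v)

namespace ThinFamily

variable (D : ThinFamily F)

/-- The paths starting at the generator which annihilate it. -/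
def Bad (v : V) (j : J) (w : V) : Prop :=
  F.lt j (D.gen v) w ∧ ¬ (j = (D.C v).br ∧ (D.C v).supp w)

/-- There is a nonzero morphism from the `u`-th module to the `v`-th module. -/
def Le (v u : V) : Prop := (D.C v).supp (D.gen u) ∧
  ∀ w, F.lt (D.C v).br (D.gen u) w → (D.C v).supp w → (D.C v).br = (D.C u).br ∧ (D.C u).supp w

/-- The condition ensuring vanishing of self-extensions. -/
def Rigid : Prop := ∀ v j, (∀ w, ¬ D.Bad v j w) ∨ ∃ w₀, D.Bad v j w₀ ∧
  (∀ w, D.Bad v j w → w = w₀ ∨ F.lt j w₀ w) ∧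
  ∀ x, (D.C x).supp w₀ → (D.C x).br = j ∧ (D.C x).supp (D.gen v)

/-- The direct sum of the family. -/
abbrev Total (k : Type u) [Field k] : Type u := ∀ v, Thin (D.C v) k

/-- The generator of the `v`-th module. -/
abbrev top (k : Type u) [Field k] (v : V) : Thin (D.C v) k := Thin.delta k (D.C v) (D.gen v)

variable {D}

lemma edge_smul_eq_zero_of_le {v u : V} (h : D.Le v u) {j : J} {w : V} (hb : D.Bad u j w) :
    op (Forest.edge F k j (D.gen u) w) • Thin.delta k (D.C v) (D.gen u) = 0 := by
  refine Thin.ext_apply fun y => ?_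
  rw [Thin.smul_delta _ h.1, Forest.entry_edge, if_neg, Thin.zero_apply]
  rintro ⟨h1, -, h2, h3⟩
  subst h1
  obtain ⟨h4, h5⟩ := h.2 w h3 (h2 ▸ y.2)
  exact hb.2 ⟨h4, h5⟩

lemma exists_hom_of_le {v u : V} (h : D.Le v u) :
    ∃ φ : Thin (D.C u) k →ₗ[(F.alg k)ᵐᵒᵖ] Thin (D.C v) k,
      φ (D.top k u) = Thin.delta k (D.C v) (D.gen u) :=
  Thin.exists_hom (D.isGen u) (Thin.idem_smul_delta _) fun _ _ h1 h2 =>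
    edge_smul_eq_zero_of_le h ⟨h1, h2⟩

lemma idem_smul_map_top {v u : V} (φ : Thin (D.C u) k →ₗ[(F.alg k)ᵐᵒᵖ] Thin (D.C v) k) :
    op (Forest.idem F k (D.gen u)) • φ (D.top k u) = φ (D.top k u) := by
  rw [← map_smul, Thin.idem_smul_delta]

lemma hom_eq_zero_of_not_le {v u : V} (h : ¬ D.Le v u)
    (φ : Thin (D.C u) k →ₗ[(F.alg k)ᵐᵒᵖ] Thin (D.C v) k) : φ = 0 := by
  refine Thin.hom_ext (D.isGen u) ?_
  rw [LinearMap.zero_apply]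
  by_cases hs : (D.C v).supp (D.gen u)
  · obtain ⟨w, hlt, hw, hbad⟩ : ∃ w, F.lt (D.C v).br (D.gen u) w ∧ (D.C v).supp w ∧
        ¬ ((D.C v).br = (D.C u).br ∧ (D.C u).supp w) := by
      by_contra h'
      push Not at h'
      exact h ⟨hs, fun w h1 h2 => h' w h1 h2⟩
    rw [Thin.eq_smul_delta hs (idem_smul_map_top φ)]
    have h0 : op (Forest.edge F k (D.C v).br (D.gen u) w) • D.top k u = 0 := by
      refine Thin.ext_apply fun y => ?_
      rw [Thin.smul_delta _ (D.isGen u).1, Forest.entry_edge, if_neg, Thin.zero_apply]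
      rintro ⟨h1, -, h2, -⟩
      exact hbad ⟨h1.symm, h2 ▸ y.2⟩
    have h1 := congrArg φ h0
    rw [map_smul, map_zero] at h1
    have h2 := congrFun h1 ⟨w, hw⟩
    rw [Thin.edge_smul, dif_pos ⟨rfl, rfl, hlt, hs⟩] at h2
    rw [h2]
    exact zero_smul _ _
  · exact Thin.eq_zero_of_idem_smul hs (idem_smul_map_top φ)

variable (k D) in
/-- The canonical morphism from the `u`-th module to the `v`-th module. -/
def canon (v u : V) : Thin (D.C u) k →ₗ[(F.alg k)ᵐᵒᵖ] Thin (D.C v) k :=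
  if h : D.Le v u then (exists_hom_of_le h).choose else 0

lemma canon_top {v u : V} (h : D.Le v u) :
    canon k D v u (D.top k u) = Thin.delta k (D.C v) (D.gen u) := by
  rw [canon, dif_pos h]
  exact (exists_hom_of_le h).choose_spec

lemma canon_eq_zero {v u : V} (h : ¬ D.Le v u) : canon k D v u = 0 := dif_neg h

lemma le_refl (v : V) : D.Le v v := ⟨(D.isGen v).1, fun _ _ h => ⟨rfl, h⟩⟩

/-- Every morphism is a multiple of the canonical one. -/
lemma exists_eq_smul_canon {v u : V} (φ : Thin (D.C u) k →ₗ[(F.alg k)ᵐᵒᵖ] Thin (D.C v) k) :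
    ∃ c : k, φ = c • canon k D v u := by
  by_cases h : D.Le v u
  · refine ⟨φ (D.top k u) ⟨_, h.1⟩, Thin.hom_ext (D.isGen u) ?_⟩
    rw [LinearMap.smul_apply, canon_top h]
    exact Thin.eq_smul_delta h.1 (idem_smul_map_top φ)
  · exact ⟨0, by rw [hom_eq_zero_of_not_le h φ, zero_smul]⟩

lemma canon_self (v : V) : canon k D v v = LinearMap.id := by
  refine Thin.hom_ext (D.isGen v) ?_
  rw [canon_top (le_refl v), LinearMap.id_apply]

lemma canon_delta {v u : V} (h : D.Le v u) {w : V}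
    (hw : w = D.gen u ∨ F.lt (D.C v).br (D.gen u) w) (hu : (D.C u).supp w) (hv : (D.C v).supp w) :
    canon k D v u (Thin.delta k (D.C u) w) = Thin.delta k (D.C v) w := by
  rcases hw with rfl | hw
  · exact canon_top h
  · obtain ⟨hbr, -⟩ := h.2 w hw hv
    have key : ∀ x, (D.C x).br = (D.C v).br → (D.C x).supp (D.gen u) →
        op (Forest.edge F k (D.C v).br (D.gen u) w) • Thin.delta k (D.C x) (D.gen u) =
          Thin.delta k (D.C x) w := by
      intro x hx hx'
      refine Thin.ext_apply fun y => ?_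
      rw [Thin.smul_delta _ hx', Forest.entry_edge, Thin.delta_apply]
      exact if_congr ⟨fun h => h.2.2.1, fun h => ⟨hx, rfl, h, hw⟩⟩ rfl rfl
    rw [← key u hbr.symm (D.isGen u).1, map_smul, canon_top h, key v rfl h.1]

lemma canon_comp {v u x : V} (hvu : D.Le v u) (hux : D.Le u x)
    (hgen : D.Le v x → D.gen x = D.gen u ∨ F.lt (D.C v).br (D.gen u) (D.gen x)) :
    (canon k D v u).comp (canon k D u x) = canon k D v x := by
  by_cases h : D.Le v x
  · refine Thin.hom_ext (D.isGen x) ?_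
    rw [LinearMap.comp_apply, canon_top hux, canon_top h]
    exact canon_delta hvu (hgen h) hux.1 h.1
  · rw [canon_eq_zero h]
    exact hom_eq_zero_of_not_le h _

/-! ### Self-extensions -/

lemma single_map_smul (v : V) (x : (F.alg k)ᵐᵒᵖ) (f : Thin (D.C v) k) :
    (Pi.single v (x • f) : D.Total k) = x • Pi.single v f :=
  (LinearMap.single (F.alg k)ᵐᵒᵖ (fun v => Thin (D.C v) k) v).map_smul x f

lemma selfExtVanish (h : D.Rigid) : SelfExtVanish (F.alg k)ᵐᵒᵖ (D.Total k) := by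
  intro E _ _ ι π hι hπ hex
  have hsec : ∀ v, ∃ s : Thin (D.C v) k →ₗ[(F.alg k)ᵐᵒᵖ] E,
      π.comp s = LinearMap.single (F.alg k)ᵐᵒᵖ (fun v => Thin (D.C v) k) v := by
    intro v
    obtain ⟨z₀, hz₀⟩ := hπ (Pi.single v (D.top k v))
    set z₁ := op (Forest.idem F k (D.gen v)) • z₀ with hz₁
    have hz₁e : op (Forest.idem F k (D.gen v)) • z₁ = z₁ := by
      rw [hz₁, ← mul_smul, ← op_mul, Forest.idem_mul_self]
    have hπz₁ : π z₁ = Pi.single v (D.top k v) := by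
      rw [hz₁, map_smul, hz₀, ← single_map_smul, Thin.idem_smul_delta]
    have hη : ∀ j w, D.Bad v j w →
        ∃ η : D.Total k, ι η = op (Forest.edge F k j (D.gen v) w) • z₁ := by
      intro j w hb
      have : op (Forest.edge F k j (D.gen v) w) • z₁ ∈ LinearMap.ker π := by
        rw [LinearMap.mem_ker, map_smul, hπz₁, ← single_map_smul,
          edge_smul_eq_zero_of_le (le_refl v) hb, Pi.single_zero]
      rw [← hex] at this
      exact this
    have hτj : ∀ j, ∃ τ : ∀ x, (D.C x).br = j → k, ∀ w, D.Bad v j w →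
        ∀ (τ' : D.Total k), (∀ x (hx : (D.C x).br = j) (hs : (D.C x).supp (D.gen v)),
          τ' x ⟨_, hs⟩ = τ x hx) →
        ι (op (Forest.edge F k j (D.gen v) w) • τ') = op (Forest.edge F k j (D.gen v) w) • z₁ := by
      intro j
      rcases h v j with hno | ⟨w₀, hb₀, hall, hR⟩
      · exact ⟨fun _ _ => 0, fun w hw => absurd hw (hno w)⟩
      · obtain ⟨η, hη⟩ := hη j w₀ hb₀
        refine ⟨fun x _ => if hs : (D.C x).supp w₀ then η x ⟨_, hs⟩ else 0, ?_⟩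
        intro w hw τ' hτ'
        have hηe : op (Forest.idem F k w₀) • η = η := by
          refine hι ?_
          rw [map_smul, hη, ← mul_smul, ← op_mul, Forest.edge_mul_idem]
        have h0 : op (Forest.edge F k j (D.gen v) w₀) • τ' = η := by
          refine funext fun x => Thin.ext_apply fun y => ?_
          rw [Pi.smul_apply, Thin.edge_smul]
          by_cases hy : y.1 = w₀
          · obtain ⟨y, hys⟩ := y
            obtain rfl : y = w₀ := hy
            obtain ⟨h1, h2⟩ := hR x hys
            rw [dif_pos ⟨h1.symm, rfl, hb₀.1, h2⟩, hτ' x h1 h2]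
            exact dif_pos hys
          · rw [dif_neg fun h => hy h.2.1, ← hηe, Pi.smul_apply, Thin.idem_smul, if_neg hy]
        rcases hall w hw with rfl | hlt
        · rw [h0, hη]
        · rw [← Forest.edge_mul_edge hb₀.1 hlt, op_mul, mul_smul, mul_smul, h0, map_smul, hη]
    choose τ hτ using hτj
    let τ' : D.Total k := fun x => τ _ x rfl • Thin.delta k (D.C x) (D.gen v)
    have hτ'e : op (Forest.idem F k (D.gen v)) • τ' = τ' := by
      refine funext fun x => ?_
      change op (Forest.idem F k (D.gen v)) • (τ _ x rfl • Thin.delta k (D.C x) (D.gen v)) =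
        τ _ x rfl • Thin.delta k (D.C x) (D.gen v)
      rw [smul_comm, Thin.idem_smul_delta]
    obtain ⟨s, hs⟩ := Thin.exists_hom (k := k) (D.isGen v) (z := z₁ - ι τ')
      (by rw [smul_sub, hz₁e, ← map_smul, hτ'e]) (fun j w h1 h2 => by
        rw [smul_sub, ← map_smul, hτ j w ⟨h1, h2⟩ τ', sub_self]
        intro x hx hs
        subst hx
        change τ _ x rfl * Thin.delta k (D.C x) (D.gen v) ⟨_, hs⟩ = _
        rw [Thin.delta_apply, if_pos rfl, mul_one])
    refine ⟨s, Thin.hom_ext (D.isGen v) ?_⟩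
    have h0 : π (ι τ') = 0 := by
      have : ι τ' ∈ LinearMap.ker π := hex ▸ LinearMap.mem_range_self ι τ'
      exact this
    rw [LinearMap.comp_apply, hs, map_sub, h0, sub_zero, hπz₁]
    rfl
  choose s hs using hsec
  refine ⟨∑ v, (s v).comp (LinearMap.proj v), LinearMap.pi_ext fun v f => ?_⟩
  rw [LinearMap.comp_apply, LinearMap.sum_apply, Finset.sum_eq_single v]
  · rw [LinearMap.comp_apply, LinearMap.proj_apply, Pi.single_eq_same, ← LinearMap.comp_apply, hs]
    rfl
  · intro u _ hu
    rw [LinearMap.comp_apply, LinearMap.proj_apply, Pi.single_eq_of_ne hu, map_zero]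
  · simp

end ThinFamily

end ThinFamily

section ThinFamilyEnd

set_option linter.unusedSectionVars false

namespace ThinFamily

variable {J V : Type} [Fintype J] [Fintype V] {F : Forest J V} {k : Type u} [Field k]
  {D : ThinFamily F}

/-! ### The endomorphism algebra -/

variable (k D) in
/-- The canonical morphism between two summands as an endomorphism of the direct sum. -/
def unit (v u : V) : Module.End (F.alg k)ᵐᵒᵖ (D.Total k) :=
  (LinearMap.single (F.alg k)ᵐᵒᵖ (fun v => Thin (D.C v) k) v).comp
    ((canon k D v u).comp (LinearMap.proj u))

variable (k D) in
/-- The coefficient of an endomorphism at a pair of summands. -/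
def coef (v u : V) : Module.End (F.alg k)ᵐᵒᵖ (D.Total k) →ₗ[k] k where
  toFun f := if h : D.Le v u then f (Pi.single u (D.top k u)) v ⟨D.gen u, h.1⟩ else 0
  map_add' f g := by
    split_ifs
    · rfl
    · rw [add_zero]
  map_smul' c f := by
    split_ifs
    · rfl
    · rw [smul_zero]

lemma coef_apply (v u : V) (f : Module.End (F.alg k)ᵐᵒᵖ (D.Total k)) : coef k D v u f =
    if h : D.Le v u then f (Pi.single u (D.top k u)) v ⟨D.gen u, h.1⟩ else 0 := rfl

lemma block (v u : V) (f : Module.End (F.alg k)ᵐᵒᵖ (D.Total k)) :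
    (LinearMap.proj v).comp (f.comp (LinearMap.single (F.alg k)ᵐᵒᵖ (fun v => Thin (D.C v) k) u)) =
      coef k D v u f • canon k D v u := by
  obtain ⟨c, hc⟩ := exists_eq_smul_canon ((LinearMap.proj v).comp
    (f.comp (LinearMap.single (F.alg k)ᵐᵒᵖ (fun v => Thin (D.C v) k) u)))
  rw [hc]
  by_cases h : D.Le v u
  · congr 1
    have h1 := congrFun (LinearMap.congr_fun hc (D.top k u)) ⟨D.gen u, h.1⟩
    rw [LinearMap.smul_apply, canon_top h, Thin.ksmul_apply, Thin.delta_apply, if_pos rfl,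
      mul_one] at h1
    rw [coef_apply, dif_pos h, ← h1]
    rfl
  · rw [canon_eq_zero h, smul_zero, smul_zero]

lemma coef_unit (v u v' u' : V) :
    coef k D v u (unit k D v' u') = if v = v' ∧ u = u' ∧ D.Le v u then 1 else 0 := by
  rw [coef_apply]
  by_cases h : D.Le v u
  · rw [dif_pos h]
    change (Pi.single v' (canon k D v' u' ((Pi.single u (D.top k u) : D.Total k) u')) :
      D.Total k) v ⟨D.gen u, h.1⟩ = _
    by_cases hu : u = u'
    · subst hu
      rw [Pi.single_eq_same]
      by_cases hv : v = v'
      · subst hv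
        rw [Pi.single_eq_same, canon_top h, Thin.delta_apply, if_pos rfl, if_pos ⟨rfl, rfl, h⟩]
      · rw [Pi.single_eq_of_ne hv, if_neg fun h => hv h.1, Thin.zero_apply]
    · rw [Pi.single_eq_of_ne (Ne.symm hu), map_zero, Pi.single_zero, if_neg fun h => hu h.2.1]
      rfl
  · rw [dif_neg h, if_neg fun h' => h h'.2.2]

lemma eq_sum_unit (f : Module.End (F.alg k)ᵐᵒᵖ (D.Total k)) :
    f = ∑ v, ∑ u, coef k D v u f • unit k D v u := by
  refine LinearMap.pi_ext fun u x => funext fun v => ?_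
  have h1 := LinearMap.congr_fun (block v u f) x
  have h2 : f (Pi.single u x) v = coef k D v u f • canon k D v u x := h1
  rw [h2, LinearMap.sum_apply, Finset.sum_apply, Finset.sum_eq_single v]
  · rw [LinearMap.sum_apply, Finset.sum_apply, Finset.sum_eq_single u]
    · change _ = coef k D v u f • (Pi.single v (canon k D v u ((Pi.single u x : D.Total k) u)) :
        D.Total k) v
      rw [Pi.single_eq_same, Pi.single_eq_same]
    · intro u' _ hu
      change coef k D v u' f • (Pi.single v (canon k D v u' ((Pi.single u x : D.Total k) u')) :
        D.Total k) v = 0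
      rw [Pi.single_eq_same, Pi.single_eq_of_ne hu, map_zero, smul_zero]
    · simp
  · intro v' _ hv
    rw [LinearMap.sum_apply, Finset.sum_apply]
    refine Finset.sum_eq_zero fun u' _ => ?_
    change coef k D v' u' f • (Pi.single v' (canon k D v' u' ((Pi.single u x : D.Total k) u')) :
      D.Total k) v = 0
    rw [Pi.single_eq_of_ne (Ne.symm hv), smul_zero]
  · simp

lemma mul_eq_sum_unit (f g : Module.End (F.alg k)ᵐᵒᵖ (D.Total k)) :
    f * g = ∑ v, ∑ u, ∑ u', ∑ x,
      coef k D v u f • coef k D u' x g • (unit k D v u * unit k D u' x) := by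
  conv_lhs => rw [eq_sum_unit f, eq_sum_unit g]
  simp only [Finset.sum_mul]
  simp only [Finset.mul_sum, smul_mul_assoc, mul_smul_comm]
  refine Finset.sum_congr rfl fun v _ => Finset.sum_congr rfl fun u _ =>
    Finset.sum_congr rfl fun u' _ => Finset.sum_congr rfl fun x _ => ?_
  exact smul_comm _ _ _

lemma le_of_coef_ne_zero {v u : V} {f : Module.End (F.alg k)ᵐᵒᵖ (D.Total k)}
    (h : coef k D v u f ≠ 0) : D.Le v u := by
  by_contra h'
  exact h (dif_neg h')

variable (D) in
/-- Canonical morphisms compose to canonical morphisms. -/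
def Composable : Prop := ∀ v u x, D.Le v u → D.Le u x → D.Le v x →
  D.gen x = D.gen u ∨ F.lt (D.C v).br (D.gen u) (D.gen x)

lemma unit_eq_zero {v u : V} (h : ¬ D.Le v u) : unit k D v u = 0 := by
  rw [unit, canon_eq_zero h]
  exact LinearMap.ext fun x => Pi.single_zero _

lemma unit_mul_unit (hD : D.Composable) {v u x : V} (hvu : D.Le v u) (hux : D.Le u x) :
    unit k D v u * unit k D u x = unit k D v x := by
  refine LinearMap.ext fun f => ?_
  change (Pi.single v (canon k D v u ((Pi.single u (canon k D u x (f x)) : D.Total k) u)) :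
    D.Total k) =
    (Pi.single v (canon k D v x (f x)) : D.Total k)
  rw [Pi.single_eq_same, ← canon_comp hvu hux fun h => hD v u x hvu hux h]
  rfl

lemma unit_mul_unit_of_ne {v u u' x : V} (h : u ≠ u') :
    unit k D v u * unit k D u' x = 0 := by
  refine LinearMap.ext fun f => ?_
  change (Pi.single v (canon k D v u ((Pi.single u' (canon k D u' x (f x)) : D.Total k) u)) :
    D.Total k) = 0
  rw [Pi.single_eq_of_ne h, map_zero, Pi.single_zero]

lemma exists_endEquiv (hD : D.Composable) {A : Type u} [Ring A] [Algebra k A] (p : V → V → A)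
    (hp : ∀ v u, p v u ≠ 0 ↔ D.Le v u)
    (hmul : ∀ v u x, D.Le v u → D.Le u x → p v u * p u x = p v x)
    (hmul' : ∀ v u u' x, u ≠ u' → p v u * p u' x = 0)
    (hspan : ∀ x : A, ∃ c : V → V → k, x = ∑ v, ∑ u, c v u • p v u) :
    ∃ φ : A ≃+* Module.End (F.alg k)ᵐᵒᵖ (D.Total k), ∀ (c : k) (x : A), φ (c • x) = c • φ x := by
  have hp0 : ∀ {v u}, ¬ D.Le v u → p v u = 0 := fun {v u} h => by
    by_contra h'
    exact h ((hp v u).1 h')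
  let ψ : Module.End (F.alg k)ᵐᵒᵖ (D.Total k) →ₗ[k] A :=
    ∑ v, ∑ u, (LinearMap.toSpanSingleton k A (p v u)).comp (coef k D v u)
  have hψ : ∀ f, ψ f = ∑ v, ∑ u, coef k D v u f • p v u := fun f => by
    simp only [ψ, LinearMap.sum_apply, LinearMap.comp_apply, LinearMap.toSpanSingleton_apply]
  have hψunit : ∀ v u, ψ (unit k D v u) = p v u := by
    intro v u
    rw [hψ, Finset.sum_eq_single v, Finset.sum_eq_single u]
    · rw [coef_unit]
      by_cases h : D.Le v u
      · rw [if_pos ⟨rfl, rfl, h⟩, one_smul]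
      · rw [hp0 h, smul_zero]
    · intro u' _ hu
      rw [coef_unit, if_neg fun h => hu h.2.1, zero_smul]
    · simp
    · intro v' _ hv
      refine Finset.sum_eq_zero fun u' _ => ?_
      rw [coef_unit, if_neg fun h => hv h.1, zero_smul]
    · simp
  have hmulunit : ∀ v u u' x, ψ (unit k D v u * unit k D u' x) = p v u * p u' x := by
    intro v u u' x
    by_cases h : u = u'
    · subst h
      by_cases h1 : D.Le v u
      · by_cases h2 : D.Le u x
        · rw [unit_mul_unit hD h1 h2, hψunit, hmul v u x h1 h2]
        · rw [unit_eq_zero h2, mul_zero, map_zero, hp0 h2, mul_zero]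
      · rw [unit_eq_zero h1, zero_mul, map_zero, hp0 h1, zero_mul]
    · rw [unit_mul_unit_of_ne h, map_zero, hmul' v u u' x h]
  have hψmul : ∀ f g, ψ (f * g) = ψ f * ψ g := by
    intro f g
    obtain ⟨c, hc⟩ : ∃ c : V → V → k, f = ∑ v, ∑ u, c v u • unit k D v u := ⟨_, eq_sum_unit f⟩
    obtain ⟨d, hd⟩ : ∃ c : V → V → k, g = ∑ v, ∑ u, c v u • unit k D v u := ⟨_, eq_sum_unit g⟩
    rw [hc, hd]
    simp only [Finset.sum_mul, Finset.mul_sum, map_sum, smul_mul_assoc, mul_smul_comm, map_smul,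
      hψunit, hmulunit]
  have hinj : Function.Injective ψ := by
    rw [injective_iff_map_eq_zero]
    intro f hf
    have hcoef : ∀ v u, D.Le v u → coef k D v u f = 0 := by
      intro v u h
      have h1 : p v v * ψ f * p u u = coef k D v u f • p v u := by
        rw [hψ, Finset.mul_sum, Finset.sum_mul, Finset.sum_eq_single v]
        · rw [Finset.mul_sum, Finset.sum_mul, Finset.sum_eq_single u]
          · rw [mul_smul_comm, smul_mul_assoc, hmul v v u (le_refl v) h, hmul v u u h (le_refl u)]
          · intro u' _ hu
            rw [mul_smul_comm, smul_mul_assoc, mul_assoc, hmul' _ _ _ _ hu, mul_zero, smul_zero]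
          · simp
        · intro v' _ hv
          rw [Finset.mul_sum, Finset.sum_mul]
          refine Finset.sum_eq_zero fun u' _ => ?_
          rw [mul_smul_comm, smul_mul_assoc, hmul' _ _ _ _ (Ne.symm hv), zero_mul, smul_zero]
        · simp
      rw [hf, mul_zero, zero_mul] at h1
      exact (smul_eq_zero.1 h1.symm).resolve_right ((hp v u).2 h)
    rw [eq_sum_unit f]
    refine Finset.sum_eq_zero fun v _ => Finset.sum_eq_zero fun u _ => ?_
    by_cases h : D.Le v u
    · rw [hcoef v u h, zero_smul]
    · rw [unit_eq_zero h, smul_zero]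
  have hsurj : Function.Surjective ψ := by
    intro x
    obtain ⟨c, rfl⟩ := hspan x
    refine ⟨∑ v, ∑ u, c v u • unit k D v u, ?_⟩
    simp only [map_sum, map_smul, hψunit]
  let Ψ : Module.End (F.alg k)ᵐᵒᵖ (D.Total k) ≃+* A :=
    { Equiv.ofBijective ψ ⟨hinj, hsurj⟩ with
      map_add' := map_add ψ
      map_mul' := hψmul }
  refine ⟨Ψ.symm, fun c x => Ψ.injective ?_⟩
  rw [RingEquiv.apply_symm_apply]
  have h1 : Ψ (c • Ψ.symm x) = c • Ψ (Ψ.symm x) := map_smul ψ c _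
  rw [h1, RingEquiv.apply_symm_apply]

/-! ### Indecomposable summands -/

variable (D) in
/-- There are no nontrivial cycles of canonical morphisms. -/
def Acyclic : Prop := ∃ r : V → ℕ, ∀ v u, D.Le v u → v = u ∨ r u < r v

lemma indec_thin (v : V) : Indec (F.alg k)ᵐᵒᵖ (ModuleCat.of (F.alg k)ᵐᵒᵖ (Thin (D.C v) k)) := by
  refine ⟨⟨D.top k v, 0, Thin.delta_ne_zero (D.isGen v).1⟩, fun f hf => ?_⟩
  obtain ⟨c, hc⟩ := exists_eq_smul_canon (D := D) (k := k) (v := v) (u := v) f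
  rw [canon_self] at hc
  have h1 : ∀ x : Thin (D.C v) k, f x = c • x := fun x => by rw [hc]; rfl
  have h2 := LinearMap.congr_fun hf (D.top k v)
  rw [LinearMap.comp_apply, h1, h1] at h2
  have h3 : c * (c * 1) = c * 1 := by
    have h4 : D.top k v ⟨D.gen v, (D.isGen v).1⟩ = 1 := if_pos rfl
    rw [← h4]
    exact congrFun h2 ⟨D.gen v, (D.isGen v).1⟩
  rw [mul_one] at h3
  by_cases hc0 : c = 0
  · left
    refine LinearMap.ext fun x => ?_
    rw [h1, hc0, zero_smul]
    rfl
  · right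
    refine LinearMap.ext fun x => ?_
    rw [h1, mul_left_cancel₀ hc0 (h3.trans (mul_one c).symm), one_smul]
    rfl

end ThinFamily

lemma isSummandOf_of_retract {R : Type u} [Ring R] {N : Type u} [AddCommGroup N] [Module R N]
    {M : ModuleCat.{u} R} (ι : M →ₗ[R] N) (π : N →ₗ[R] M) (h : π.comp ι = LinearMap.id) :
    IsSummandOf R N M := by
  have hinj : Function.Injective ι := fun x y hxy => by
    rw [← LinearMap.id_apply (R := R) x, ← LinearMap.id_apply (R := R) y, ← h,
      LinearMap.comp_apply, LinearMap.comp_apply, hxy]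
  refine ⟨LinearMap.range ι, LinearMap.ker (ι.rangeRestrict.comp π), LinearMap.isCompl_of_proj ?_,
    ⟨LinearEquiv.ofInjective ι hinj⟩⟩
  rintro ⟨_, x, rfl⟩
  exact Subtype.ext (congrArg ι (LinearMap.congr_fun h x))

lemma IsSummandOf.exists_retract {R : Type u} [Ring R] {N : Type u} [AddCommGroup N] [Module R N]
    {M : ModuleCat.{u} R} (h : IsSummandOf R N M) :
    ∃ (ι : M →ₗ[R] N) (π : N →ₗ[R] M), π.comp ι = LinearMap.id := by
  obtain ⟨N₁, N₂, hc, ⟨e⟩⟩ := h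
  refine ⟨N₁.subtype.comp e.toLinearMap,
    e.symm.toLinearMap.comp (N₁.projectionOnto N₂ hc), LinearMap.ext fun x => ?_⟩
  simp

namespace ThinFamily

variable {J V : Type} [Fintype J] [Fintype V] {F : Forest J V} {k : Type u} [Field k]
  {D : ThinFamily F}

lemma isSummandOf_thin (v : V) :
    IsSummandOf (F.alg k)ᵐᵒᵖ (D.Total k) (ModuleCat.of (F.alg k)ᵐᵒᵖ (Thin (D.C v) k)) :=
  isSummandOf_of_retract (M := ModuleCat.of (F.alg k)ᵐᵒᵖ (Thin (D.C v) k))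
    (LinearMap.single (F.alg k)ᵐᵒᵖ (fun v => Thin (D.C v) k) v) (LinearMap.proj v)
    (LinearMap.ext fun x => Pi.single_eq_same (M := fun v => Thin (D.C v) k) v x)

lemma eq_of_thin_equiv (hD : D.Acyclic) {v u : V}
    (e : Thin (D.C v) k ≃ₗ[(F.alg k)ᵐᵒᵖ] Thin (D.C u) k) : v = u := by
  obtain ⟨r, hr⟩ := hD
  have key : ∀ v u (e : Thin (D.C v) k ≃ₗ[(F.alg k)ᵐᵒᵖ] Thin (D.C u) k), D.Le u v := by
    intro v u e
    by_contra h
    have h1 := LinearMap.congr_fun (hom_eq_zero_of_not_le h e.toLinearMap) (D.top k v)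
    exact Thin.delta_ne_zero (D.isGen v).1 ((LinearEquiv.map_eq_zero_iff e).1 h1)
  rcases hr _ _ (key v u e) with h | h
  · exact h.symm
  · rcases hr _ _ (key u v e.symm) with h' | h'
    · exact h'
    · exact absurd h h'.asymm

lemma exists_thin_equiv (hcomp : D.Composable) (hac : D.Acyclic)
    {M : ModuleCat.{u} (F.alg k)ᵐᵒᵖ} (hM : Indec _ M)
    (hs : IsSummandOf (F.alg k)ᵐᵒᵖ (D.Total k) M) :
    ∃ v, Nonempty (M ≃ₗ[(F.alg k)ᵐᵒᵖ] Thin (D.C v) k) := by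
  obtain ⟨ι, π, hπι⟩ := hs.exists_retract
  have hπι' : ∀ x, π (ι x) = x := fun x => LinearMap.congr_fun hπι x
  obtain ⟨r, hr⟩ := hac
  let e : Module.End (F.alg k)ᵐᵒᵖ (D.Total k) := ι.comp π
  have hee : e * e = e := LinearMap.ext fun x => congrArg ι (hπι' (π x))
  have hcoef : ∀ v x, coef k D v x e ≠ 0 → ∃ u, coef k D v u e ≠ 0 ∧ coef k D u x e ≠ 0 := by
    intro v x hvx
    by_contra hno
    push Not at hno
    refine hvx ?_
    rw [← hee, mul_eq_sum_unit]
    simp only [map_sum, map_smul, smul_eq_mul]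
    refine Finset.sum_eq_zero fun v' _ => Finset.sum_eq_zero fun u _ =>
      Finset.sum_eq_zero fun u' _ => Finset.sum_eq_zero fun x' _ => ?_
    by_cases h : coef k D v x (unit k D v' u * unit k D u' x') = 0
    · rw [h, mul_zero, mul_zero]
    · by_cases hu : u = u'
      · subst hu
        by_cases h1 : D.Le v' u
        · by_cases h2 : D.Le u x'
          · rw [unit_mul_unit hcomp h1 h2, coef_unit] at h
            by_cases h3 : v = v' ∧ x = x' ∧ D.Le v x
            · obtain ⟨rfl, rfl, -⟩ := h3
              by_cases h4 : coef k D v u e = 0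
              · rw [h4, zero_mul]
              · rw [hno u h4, zero_mul, mul_zero]
            · exact absurd (if_neg h3) h
          · rw [unit_eq_zero h2, mul_zero, map_zero] at h
            exact absurd rfl h
        · rw [unit_eq_zero h1, zero_mul, map_zero] at h
          exact absurd rfl h
      · rw [unit_mul_unit_of_ne hu, map_zero] at h
        exact absurd rfl h
  obtain ⟨v, hv⟩ : ∃ v, coef k D v v e ≠ 0 := by
    by_contra hdiag
    push Not at hdiag
    have hlt : ∀ v x, coef k D v x e ≠ 0 → r x < r v := by
      intro v x h
      rcases hr v x (le_of_coef_ne_zero h) with rfl | h'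
      · exact absurd (hdiag _) h
      · exact h'
    have hzero : ∀ n v x, r v - r x ≤ n → coef k D v x e = 0 := by
      intro n
      induction n with
      | zero =>
        intro v x h
        by_contra h'
        have := hlt v x h'
        omega
      | succ n ih =>
        intro v x h
        by_contra h'
        obtain ⟨u, h1, h2⟩ := hcoef v x h'
        have h3 := hlt v u h1
        have h4 := hlt u x h2
        exact h1 (ih v u (by omega))
    have he : e = 0 := by
      rw [eq_sum_unit e]
      refine Finset.sum_eq_zero fun v _ => Finset.sum_eq_zero fun u _ => ?_
      rw [hzero _ v u le_rfl, zero_smul]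
    obtain ⟨x, y, hxy⟩ := hM.1
    refine hxy ?_
    have h0 : ∀ z : M, z = 0 := fun z => by
      have := LinearMap.congr_fun he (ι z)
      change ι (π (ι z)) = 0 at this
      rw [← hπι' z, ← hπι' z, this, map_zero]
    rw [h0 x, h0 y]
  let α : Thin (D.C v) k →ₗ[(F.alg k)ᵐᵒᵖ] M :=
    π.comp (LinearMap.single (F.alg k)ᵐᵒᵖ (fun v => Thin (D.C v) k) v)
  let β : M →ₗ[(F.alg k)ᵐᵒᵖ] Thin (D.C v) k :=
    ((coef k D v v e)⁻¹ • LinearMap.id).comp ((LinearMap.proj v).comp ι)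
  have hβα : ∀ x, β (α x) = x := by
    intro x
    have h1 := LinearMap.congr_fun (block v v e) x
    rw [canon_self] at h1
    change (coef k D v v e)⁻¹ • e (Pi.single v x) v = x
    have h2 : e (Pi.single v x) v = coef k D v v e • x := h1
    rw [h2, smul_smul, inv_mul_cancel₀ hv, one_smul]
  refine ⟨v, ⟨LinearEquiv.ofLinearMap β α (LinearMap.ext hβα) ?_⟩⟩
  rcases hM.2 (α.comp β) (LinearMap.ext fun x => congrArg α (hβα (β x))) with h | h
  · refine absurd ?_ (Thin.delta_ne_zero (k := k) (D.isGen v).1)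
    have h1 := LinearMap.congr_fun h (α (D.top k v))
    have h2 : β (α (β (α (D.top k v)))) = β 0 := congrArg β h1
    rwa [hβα, hβα, map_zero] at h2
  · exact h

end ThinFamily

end ThinFamilyEnd

section Simples

set_option linter.unusedSectionVars false

variable {J V : Type} [Fintype J] [Fintype V] [Nonempty J] {F : Forest J V} {k : Type u} [Field k]

/-! ### The simple modules over the algebra of a forest -/

variable (F) in
/-- A single vertex as a convex set. -/
def ConvexSet.single (v : V) : ConvexSet F where
  br := Classical.arbitrary J
  supp w := w = v
  convex := by
    rintro u x w rfl rfl h1 h2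
    exact absurd h2 (F.asymm h1)

namespace Forest

variable (F k) in
/-- The simple module at a vertex. -/
abbrev simple (v : V) : ModuleCat.{u} (F.alg k)ᵐᵒᵖ :=
  ModuleCat.of (F.alg k)ᵐᵒᵖ (Thin (ConvexSet.single F v) k)

lemma isGen_single (v : V) : Thin.IsGen (ConvexSet.single F v) v :=
  ⟨rfl, fun _ h => Or.inl h⟩

lemma isSimpleModule_simple (v : V) : IsSimpleModule (F.alg k)ᵐᵒᵖ (simple F k v) := by
  rw [isSimpleModule_iff_toSpanSingleton_surjective]
  refine ⟨⟨Thin.delta k (ConvexSet.single F v) v, 0, Thin.delta_ne_zero rfl⟩, ?_⟩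
  intro (f : Thin (ConvexSet.single F v) k) hf (g : Thin (ConvexSet.single F v) k)
  have hext : ∀ {f g : Thin (ConvexSet.single F v) k}, f ⟨v, rfl⟩ = g ⟨v, rfl⟩ → f = g := by
    rintro f g h
    refine Thin.ext_apply ?_
    rintro ⟨_, rfl⟩
    exact h
  have hf' : f ⟨v, rfl⟩ ≠ 0 := fun h => hf (hext h)
  refine ⟨(g ⟨v, rfl⟩ / f ⟨v, rfl⟩) • 1, ?_⟩
  rw [LinearMap.toSpanSingleton_apply]
  refine Eq.trans (smul_assoc (g ⟨v, rfl⟩ / f ⟨v, rfl⟩) (1 : (F.alg k)ᵐᵒᵖ) f) ?_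
  rw [one_smul]
  refine hext ?_
  rw [Thin.ksmul_apply, div_mul_cancel₀ _ hf']

lemma eq_of_simple_equiv {v u : V} (e : simple F k v ≃ₗ[(F.alg k)ᵐᵒᵖ] simple F k u) : v = u := by
  by_contra h
  refine Thin.delta_ne_zero (k := k) (C := ConvexSet.single F v) (v := v) rfl
    ((LinearEquiv.map_eq_zero_iff e).1 ?_)
  refine Thin.eq_zero_of_idem_smul (C := ConvexSet.single F u) (v := v) h ?_
  refine Eq.trans (map_smul e _ _).symm ?_
  exact congrArg e (Thin.idem_smul_delta v)

lemma exists_simple_equiv {M : ModuleCat.{u} (F.alg k)ᵐᵒᵖ} (hM : IsSimpleModule (F.alg k)ᵐᵒᵖ M) :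
    ∃ v, Nonempty (M ≃ₗ[(F.alg k)ᵐᵒᵖ] simple F k v) := by
  obtain ⟨v, hv⟩ : ∃ v, ∃ m : M, op (idem F k v) • m ≠ 0 := by
    by_contra h
    push Not at h
    have := IsSimpleModule.nontrivial (F.alg k)ᵐᵒᵖ M
    obtain ⟨m, hm⟩ := exists_ne (0 : M)
    refine hm ?_
    rw [← one_smul (F.alg k)ᵐᵒᵖ m, ← op_one, ← sum_idem, Finset.op_sum, Finset.sum_smul]
    exact Finset.sum_eq_zero fun v _ => h v m
  obtain ⟨v, hv, hmin⟩ := Finset.exists_min_image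
    (Finset.univ.filter fun v => ∃ m : M, op (idem F k v) • m ≠ 0) F.rank ⟨v, by simpa using hv⟩
  simp only [Finset.mem_filter_univ] at hv hmin
  obtain ⟨m, hm⟩ := hv
  have hbad : ∀ j w, F.lt j v w → op (edge F k j v w) • op (idem F k v) • m = 0 := by
    intro j w hlt
    by_contra h
    rw [← edge_mul_idem, op_mul, mul_smul] at h
    exact absurd (hmin w ⟨_, h⟩) (not_le.2 (F.rank_lt hlt))
  obtain ⟨φ, hφ⟩ := Thin.exists_hom (k := k) (isGen_single (F := F) v)
    (z := op (idem F k v) • m) (by rw [← mul_smul, ← op_mul, idem_mul_self])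
    fun j w hlt _ => hbad j w hlt
  have := isSimpleModule_simple (F := F) (k := k) v
  have hφ0 : φ ≠ 0 := by
    rintro rfl
    exact hm hφ.symm
  exact ⟨v, ⟨(LinearEquiv.ofBijective (M := simple F k v) φ
    (LinearMap.bijective_of_ne_zero (M := simple F k v) hφ0)).symm⟩⟩

variable (F k) in
lemma numClasses_simple :
    NumClasses (F.alg k)ᵐᵒᵖ (fun M => IsSimpleModule (F.alg k)ᵐᵒᵖ M) (Fintype.card V) := by
  refine ⟨fun i => simple F k ((Fintype.equivFin V).symm i), fun i => isSimpleModule_simple _,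
    fun i j ⟨e⟩ => (Fintype.equivFin V).symm.injective (eq_of_simple_equiv e), fun M hM => ?_⟩
  obtain ⟨v, ⟨e⟩⟩ := exists_simple_equiv hM
  obtain ⟨i, rfl⟩ := (Fintype.equivFin V).symm.surjective v
  exact ⟨i, ⟨e⟩⟩

end Forest

namespace ThinFamily

variable {D : ThinFamily F}

lemma numClasses_summand (hcomp : D.Composable) (hac : D.Acyclic) :
    NumClasses (F.alg k)ᵐᵒᵖ
      (fun M => Indec (F.alg k)ᵐᵒᵖ M ∧ IsSummandOf (F.alg k)ᵐᵒᵖ (D.Total k) M)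
      (Fintype.card V) := by
  refine ⟨fun i => ModuleCat.of (F.alg k)ᵐᵒᵖ (Thin (D.C ((Fintype.equivFin V).symm i)) k),
    fun i => ⟨indec_thin _, isSummandOf_thin _⟩,
    fun i j ⟨e⟩ => (Fintype.equivFin V).symm.injective (eq_of_thin_equiv hac e),
    fun M hM => ?_⟩
  obtain ⟨v, ⟨e⟩⟩ := exists_thin_equiv hcomp hac hM.1 hM.2
  obtain ⟨i, rfl⟩ := (Fintype.equivFin V).symm.surjective v
  exact ⟨i, ⟨e⟩⟩

lemma isTilted [Nonempty V] (hr : D.Rigid) (hcomp : D.Composable) (hac : D.Acyclic)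
    {A : Type u} [Ring A] [Algebra k A] (p : V → V → A)
    (hp : ∀ v u, p v u ≠ 0 ↔ D.Le v u)
    (hmul : ∀ v u x, D.Le v u → D.Le u x → p v u * p u x = p v x)
    (hmul' : ∀ v u u' x, u ≠ u' → p v u * p u' x = 0)
    (hspan : ∀ x : A, ∃ c : V → V → k, x = ∑ v, ∑ u, c v u • p v u) : IsTilted k A := by
  obtain ⟨φ, hφ⟩ := exists_endEquiv (D := D) hcomp p hp hmul hmul' hspan
  exact ⟨F.alg k, inferInstance, inferInstance, inferInstance, Forest.hereditary,
    D.Total k, inferInstance, inferInstance,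
    ⟨Module.Finite.of_restrictScalars_finite k _ _, selfExtVanish hr, Fintype.card V,
      numClasses_summand hcomp hac, Forest.numClasses_simple F k⟩,
    inferInstance, inferInstance, inferInstance, φ, hφ⟩

end ThinFamily

end Simples

section TiltingFamily

variable {k : Type u} [Field k] {T : ToupieAlg k}

/-! ### The tilting module -/

/-- The order of the forest attached to branch `i`: the branch, with the vertices strictly after
`a i + 1` and before `b i` made incomparable to those from `b i` on. -/
def brLt (a b : Fin T.t → ℕ) (i : Fin T.t) : Vtx T.t T.ℓ → Vtx T.t T.ℓ → Prop
  | .src, .src => False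
  | .src, .mid j _ => i = j
  | .src, .snk => True
  | .mid _ _, .src => False
  | .mid j c, .mid j' d =>
    i = j ∧ i = j' ∧ c.1 < d.1 ∧ ¬ (a i < c.1 ∧ c.1 + 1 < b i ∧ b i ≤ d.1 + 1)
  | .mid j c, .snk => i = j ∧ ¬ (a i < c.1 ∧ c.1 + 1 < b i)
  | .snk, _ => False

/-- The distance to the sink, roughly. -/
def lenRank : Vtx T.t T.ℓ → ℕ
  | .src => ∑ i, T.ℓ i + 1
  | .mid j c => T.ℓ j - (c.1 + 1)
  | .snk => 0

lemma lenRank_mid_lt (j : Fin T.t) (c : Fin (T.ℓ j - 1)) :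
    T.ℓ j - (c.1 + 1) < ∑ i, T.ℓ i + 1 := by
  have := Finset.single_le_sum (f := T.ℓ) (fun i _ => Nat.zero_le _) (Finset.mem_univ j)
  omega

lemma brLt_trans {a b : Fin T.t → ℕ} {j : Fin T.t} {u v w : Vtx T.t T.ℓ}
    (h1 : brLt a b j u v) (h2 : brLt a b j v w) : brLt a b j u w := by
  cases u <;> cases v <;> cases w <;> simp only [brLt] at h1 h2 ⊢ <;> grind

lemma brLt_tree {a b : Fin T.t → ℕ} {j : Fin T.t} {u v w : Vtx T.t T.ℓ}
    (h1 : brLt a b j u w) (h2 : brLt a b j v w) : u = v ∨ brLt a b j u v ∨ brLt a b j v u := by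
  cases w with
  | src => cases u <;> exact h1.elim
  | mid i' e =>
    cases u <;> cases v <;> simp only [brLt] at h1 h2 ⊢ <;> try grind
    obtain ⟨rfl, rfl, h1⟩ := h1
    obtain ⟨rfl, -, h2⟩ := h2
    simp only [Vtx.mid.injEq, heq_eq_eq, true_and, Fin.ext_iff]
    omega
  | snk =>
    cases u <;> cases v <;> simp only [brLt] at h1 h2 ⊢ <;> try grind
    obtain ⟨rfl, h1⟩ := h1
    obtain ⟨rfl, h2⟩ := h2
    simp only [Vtx.mid.injEq, heq_eq_eq, true_and, Fin.ext_iff]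
    omega

lemma brLt_branch {a b : Fin T.t → ℕ} {i j : Fin T.t} {u v w : Vtx T.t T.ℓ}
    (h1 : brLt a b i u v) (h2 : brLt a b j v w) : i = j := by
  cases u <;> cases v <;> cases w <;> simp only [brLt] at h1 h2 <;> grind

lemma lenRank_lt {a b : Fin T.t → ℕ} {j : Fin T.t} {u v : Vtx T.t T.ℓ}
    (h : brLt a b j u v) : lenRank v < lenRank u := by
  cases u <;> cases v <;> simp only [brLt] at h
  · exact Nat.succ_pos _
  · exact lenRank_mid_lt (T := T) _ _
  · simp only [lenRank]
    omega
  · obtain ⟨rfl, rfl, h1, -⟩ := h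
    simp only [lenRank]
    omega

variable (T) in
/-- The forest attached to a toupie algebra with one relation on each branch. -/
def brForest (a b : Fin T.t → ℕ) : Forest (Fin T.t) (Vtx T.t T.ℓ) where
  lt := brLt a b
  trans := brLt_trans
  tree := brLt_tree
  branch := brLt_branch
  rank := lenRank
  rank_lt := lenRank_lt

/-- The support of the summand of the tilting module at a vertex. -/
def tiltSupp (a b : Fin T.t → ℕ) : Vtx T.t T.ℓ → Vtx T.t T.ℓ → Prop
  | .src, .src => True
  | .src, .mid _ _ => False
  | .src, .snk => False
  | .mid i c, .src => c.1 + 1 < b i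
  | .mid i c, .mid j d => i = j ∧ if c.1 + 1 < b i then d.1 ≤ c.1 ∨ a i ≤ c.1 ∧ b i ≤ d.1 + 1
      else c.1 ≤ d.1
  | .mid i c, .snk => a i ≤ c.1
  | .snk, .src => False
  | .snk, .mid _ _ => False
  | .snk, .snk => True

/-- The generator of the summand of the tilting module at a vertex. -/
def tiltGen (b : Fin T.t → ℕ) : Vtx T.t T.ℓ → Vtx T.t T.ℓ
  | .src => .src
  | .mid i c => if c.1 + 1 < b i then .src else .mid i c
  | .snk => .snk

variable (T) in
/-- Some branch. -/
def someBr : Fin T.t := ⟨0, by have := T.ht; omega⟩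

/-- The branch of a vertex. -/
def brOf : Vtx T.t T.ℓ → Fin T.t
  | .src => someBr T
  | .mid i _ => i
  | .snk => someBr T

variable {a b : Fin T.t → ℕ} (h : OneRel T a b)

include h

lemma OneRel.tiltSupp_convex {v u x w : Vtx T.t T.ℓ} (hu : tiltSupp a b v u)
    (hw : tiltSupp a b v w) (h1 : brLt a b (brOf v) u x) (h2 : brLt a b (brOf v) x w) :
    tiltSupp a b v x := by
  cases v with
  | src => cases u <;> cases w <;> cases x <;> simp only [tiltSupp, brLt] at hu hw h1 h2
  | snk => cases u <;> cases w <;> cases x <;> simp only [tiltSupp, brLt] at hu hw h1 h2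
  | mid i c =>
    have := h.two_le i
    cases x with
    | src => cases u <;> exact h1.elim
    | snk => exact h2.elim
    | mid j d =>
      cases u <;> cases w <;> simp only [tiltSupp, brLt, brOf] at hu hw h1 h2 ⊢ <;> grind

/-- The summands of the tilting module. -/
def OneRel.tiltFamily : ThinFamily (brForest T a b) where
  C v := ⟨brOf v, tiltSupp a b v, h.tiltSupp_convex⟩
  gen := tiltGen b
  isGen v := by
    change tiltSupp a b v (tiltGen b v) ∧
      ∀ w, tiltSupp a b v w → w = tiltGen b v ∨ brLt a b (brOf v) (tiltGen b v) w
    cases v with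
    | src => exact ⟨trivial, fun w hw => by cases w <;> simp_all [tiltSupp, tiltGen]⟩
    | snk => exact ⟨trivial, fun w hw => by cases w <;> simp_all [tiltSupp, tiltGen]⟩
    | mid i c =>
      have := h.two_le i
      by_cases hc : c.1 + 1 < b i
      · simp only [tiltGen, if_pos hc]
        refine ⟨hc, fun w hw => ?_⟩
        cases w with
        | src => exact Or.inl rfl
        | mid j d => exact Or.inr hw.1
        | snk => exact Or.inr trivial
      · simp only [tiltGen, if_neg hc]
        refine ⟨⟨rfl, by rw [if_neg hc]⟩, fun w hw => ?_⟩
        cases w with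
        | src => exact absurd hw hc
        | mid j d =>
          obtain ⟨rfl, hw⟩ := hw
          rw [if_neg hc] at hw
          rcases hw.eq_or_lt with h1 | h1
          · exact Or.inl (by rw [Fin.ext h1])
          · exact Or.inr ⟨rfl, rfl, h1, fun h2 => hc h2.2.1⟩
        | snk => exact Or.inr ⟨rfl, fun h2 => hc h2.2⟩

lemma OneRel.le_iff {v u : Vtx T.t T.ℓ} : h.tiltFamily.Le v u ↔ pathOf v u ≠ 0 := by
  change (tiltSupp a b v (tiltGen b u) ∧ ∀ w, brLt a b (brOf v) (tiltGen b u) w →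
    tiltSupp a b v w → brOf v = brOf u ∧ tiltSupp a b u w) ↔ _
  cases v with
  | src =>
    have hw : ∀ x w, brLt a b (brOf (T := T) .src) x w → ¬ tiltSupp a b .src w := by
      intro x w h1 h2
      cases w <;> cases x <;> first | exact h1.elim | exact h2.elim
    cases u with
    | src => exact iff_of_true ⟨trivial, fun w h1 h2 => absurd h2 (hw _ w h1)⟩ (ev_ne_zero _)
    | mid j d =>
      rw [h.pathOf_ne_zero_iff_src_mid]
      by_cases hd : d.1 + 1 < b j
      · simp only [tiltGen, if_pos hd]
        exact iff_of_true ⟨trivial, fun w h1 h2 => absurd h2 (hw _ w h1)⟩ hd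
      · simp only [tiltGen, if_neg hd]
        exact iff_of_false (fun h1 => h1.1) hd
    | snk => exact iff_of_false (fun h1 => h1.1) fun h1 => h1 rfl
  | mid i c =>
    have := h.two_le i
    have hcc : tiltSupp a b (.mid i c) (.mid i c) := ⟨rfl, by split_ifs <;> simp⟩
    cases u with
    | src =>
      refine iff_of_false (fun h1 => ?_) fun h1 => h1 rfl
      exact (h1.2 (.mid i c) rfl hcc).2
    | mid j d =>
      rw [h.pathOf_ne_zero_iff_mid]
      by_cases hd : d.1 + 1 < b j
      · simp only [tiltGen, if_pos hd]
        constructor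
        · rintro ⟨h1, h2⟩
          obtain ⟨hij, -, h3⟩ := h2 (.mid i c) rfl hcc
          obtain rfl : i = j := hij
          rw [if_pos hd] at h3
          change c.1 + 1 < b i at h1
          exact ⟨rfl, by omega, by omega⟩
        · rintro ⟨rfl, h1, h2⟩
          refine ⟨by change c.1 + 1 < b i; omega, fun w h3 h4 => ⟨rfl, ?_⟩⟩
          cases w <;> simp only [tiltSupp, brLt, brOf] at h3 h4 ⊢ <;> grind
      · simp only [tiltGen, if_neg hd]
        constructor
        · rintro ⟨⟨rfl, h1⟩, h2⟩
          refine ⟨rfl, ?_⟩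
          split_ifs at h1 <;> omega
        · rintro ⟨rfl, h1, h2⟩
          refine ⟨⟨rfl, by split_ifs <;> omega⟩, fun w h3 h4 => ⟨rfl, ?_⟩⟩
          cases w <;> simp only [tiltSupp, brLt, brOf] at h3 h4 ⊢ <;> grind
    | snk =>
      rw [h.pathOf_ne_zero_iff_mid_snk]
      exact ⟨fun h1 => Nat.lt_succ_of_le h1.1,
        fun h1 => ⟨Nat.le_of_lt_succ h1, fun w h2 => h2.elim⟩⟩
  | snk =>
    cases u with
    | src => exact iff_of_false (fun h1 => h1.1) fun h1 => h1 rfl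
    | mid j d =>
      refine iff_of_false (fun h1 => ?_) fun h1 => h1 rfl
      have h2 := h1.1
      simp only [tiltGen] at h2
      split_ifs at h2 <;> exact h2
    | snk => exact iff_of_true ⟨trivial, fun w h1 => h1.elim⟩ (ev_ne_zero _)

lemma OneRel.rigid : h.tiltFamily.Rigid := by
  intro v j
  change (∀ w, ¬ (brLt a b j (tiltGen b v) w ∧ ¬ (j = brOf v ∧ tiltSupp a b v w))) ∨
    ∃ w₀, (brLt a b j (tiltGen b v) w₀ ∧ ¬ (j = brOf v ∧ tiltSupp a b v w₀)) ∧
      (∀ w, (brLt a b j (tiltGen b v) w ∧ ¬ (j = brOf v ∧ tiltSupp a b v w)) →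
        w = w₀ ∨ brLt a b j w₀ w) ∧
      ∀ x, tiltSupp a b x w₀ → brOf x = j ∧ tiltSupp a b x (tiltGen b v)
  have hj := h.two_le j
  have hj' := h.le_len j
  have hsrc : tiltGen b v = .src → (∀ w, w ≠ .src → ¬ (j = brOf v ∧ tiltSupp a b v w)) →
      ∃ w₀, (brLt a b j (tiltGen b v) w₀ ∧ ¬ (j = brOf v ∧ tiltSupp a b v w₀)) ∧
        (∀ w, (brLt a b j (tiltGen b v) w ∧ ¬ (j = brOf v ∧ tiltSupp a b v w)) →
          w = w₀ ∨ brLt a b j w₀ w) ∧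
        ∀ x, tiltSupp a b x w₀ → brOf x = j ∧ tiltSupp a b x (tiltGen b v) := by
    intro hv hsupp
    rw [hv]
    refine ⟨.mid j ⟨0, by omega⟩, ⟨rfl, hsupp _ nofun⟩, fun w hw => ?_, fun x hx => ?_⟩
    · cases w with
      | src => exact hw.1.elim
      | mid j' d =>
        obtain rfl : j = j' := hw.1
        rcases Nat.eq_zero_or_pos d.1 with h1 | h1
        · exact Or.inl (by rw [Vtx.mid.injEq]; exact ⟨rfl, heq_of_eq (Fin.ext h1)⟩)
        · exact Or.inr ⟨rfl, rfl, h1, fun h2 => absurd h2.1 (Nat.not_lt_zero _)⟩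
      | snk => exact Or.inr ⟨rfl, fun h2 => absurd h2.1 (Nat.not_lt_zero _)⟩
    · cases x with
      | src => exact hx.elim
      | mid i c =>
        obtain ⟨rfl, hx⟩ := hx
        refine ⟨rfl, ?_⟩
        change c.1 + 1 < b i
        split_ifs at hx with h1
        · exact h1
        · simp only at hx
          omega
      | snk => exact hx.elim
  cases v with
  | src =>
    refine Or.inr (hsrc rfl fun w hw h1 => ?_)
    cases w with
    | src => exact hw rfl
    | mid _ _ => exact h1.2
    | snk => exact h1.2
  | mid i c =>
    by_cases hc : c.1 + 1 < b i
    · by_cases hji : j = i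
      · subst hji
        simp only [tiltGen, if_pos hc, brOf, true_and]
        by_cases hc' : c.1 + 2 < b j
        · refine Or.inr ⟨.mid j ⟨c.1 + 1, by omega⟩, ⟨rfl, ?_⟩, fun w hw => ?_, fun x hx => ?_⟩
          · simp only [tiltSupp, if_pos hc]
            omega
          · cases w <;> simp only [tiltSupp, brLt, if_pos hc] at hw ⊢
            · exact hw.1.elim
            · refine Or.inr ⟨trivial, ?_⟩
              omega
            · obtain ⟨rfl, hw⟩ := hw
              simp only [Vtx.mid.injEq, heq_eq_eq, true_and, Fin.ext_iff]
              omega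
          · cases x with
            | src => exact hx.elim
            | mid i c =>
              obtain ⟨rfl, hx⟩ := hx
              refine ⟨rfl, ?_⟩
              simp only [tiltSupp] at hx ⊢
              split_ifs at hx with h1
              · exact h1
              · omega
            | snk => exact hx.elim
        · refine Or.inl fun w hw => ?_
          cases w <;> simp only [tiltSupp, brLt, if_pos hc] at hw
          · exact hw.1.elim
          · omega
          · obtain ⟨rfl, hw⟩ := hw
            simp only [true_and] at hw
            omega
      · exact Or.inr (hsrc (if_pos hc) fun w _ h1 => hji h1.1)
    · refine Or.inl fun w hw => ?_
      simp only [tiltGen, if_neg hc] at hw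
      cases w <;> simp only [tiltSupp, brLt, if_neg hc, brOf] at hw
      · exact hw.1.elim
      · obtain ⟨⟨rfl, -⟩, h2⟩ := hw
        exact h2 ⟨rfl, by omega⟩
      · obtain ⟨⟨rfl, rfl, h1, -⟩, h2⟩ := hw
        exact h2 ⟨rfl, rfl, h1.le⟩
  | snk => exact Or.inl fun w hw => hw.1.elim

lemma OneRel.composable : h.tiltFamily.Composable := by
  intro v u x hvu hux hvx
  rw [h.le_iff] at hvu hux hvx
  change tiltGen b x = tiltGen b u ∨ brLt a b (brOf v) (tiltGen b u) (tiltGen b x)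
  cases u with
  | src =>
    cases v <;> try exact absurd rfl hvu
    cases x with
    | src => exact Or.inl rfl
    | mid j d =>
      rw [h.pathOf_ne_zero_iff_src_mid] at hvx
      exact Or.inl (if_pos hvx)
    | snk => exact absurd rfl hvx
  | mid i c =>
    have key : ∀ j (d : Fin (T.ℓ j - 1)), i = j → c.1 ≤ d.1 →
        (c.1 + 1 < b i → d.1 + 1 < b j ∨ brOf v = j) →
        (b i ≤ c.1 + 1 → brOf v = j) →
        tiltGen b (.mid j d) = tiltGen b (.mid i c) ∨
          brLt a b (brOf v) (tiltGen b (.mid i c)) (tiltGen b (.mid j d)) := by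
      rintro _ d rfl h1 h2 h3
      simp only [tiltGen]
      split_ifs with h4 h5 h5
      · exact Or.inl rfl
      · omega
      · exact Or.inr ((h2 h5).resolve_left h4)
      · rcases h1.eq_or_lt with h1 | h1
        · exact Or.inl (by rw [Fin.ext h1])
        · exact Or.inr ⟨h3 (by omega), h3 (by omega), h1, by rw [h3 (by omega)]; omega⟩
    cases x with
    | src => exact absurd rfl hux
    | mid j d =>
      rw [h.pathOf_ne_zero_iff_mid] at hux
      cases v with
      | src =>
        rw [h.pathOf_ne_zero_iff_src_mid] at hvu hvx
        exact key j d hux.1 hux.2.1 (fun _ => Or.inl hvx) fun h1 => by omega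
      | mid i' c' =>
        rw [h.pathOf_ne_zero_iff_mid] at hvx
        exact key j d hux.1 hux.2.1 (fun _ => Or.inr hvx.1) fun _ => hvx.1
      | snk => exact absurd rfl hvu
    | snk =>
      cases v with
      | src => exact absurd rfl hvx
      | mid i' c' =>
        rw [h.pathOf_ne_zero_iff_mid] at hvu
        refine Or.inr ?_
        simp only [tiltGen]
        split_ifs with h1
        · trivial
        · refine ⟨hvu.1, ?_⟩
          change ¬ (a i' < _ ∧ _ < b i')
          rw [hvu.1]
          omega
      | snk => exact absurd rfl hvu
  | snk =>
    cases x with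
    | src => exact absurd rfl hux
    | mid j d => exact absurd rfl hux
    | snk => exact Or.inl rfl

lemma OneRel.acyclic : h.tiltFamily.Acyclic := by
  refine ⟨lenRank, fun v u hvu => ?_⟩
  rw [h.le_iff] at hvu
  cases v with
  | src =>
    cases u with
    | src => exact Or.inl rfl
    | mid j d => exact Or.inr (lenRank_mid_lt _ _)
    | snk => exact Or.inr (Nat.succ_pos _)
  | mid i c =>
    cases u with
    | src => exact absurd rfl hvu
    | mid j d =>
      obtain ⟨rfl, h1, -⟩ := h.pathOf_ne_zero_iff_mid.1 hvu
      rcases h1.eq_or_lt with h1 | h1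
      · exact Or.inl (by rw [Fin.ext h1])
      · refine Or.inr ?_
        simp only [lenRank]
        omega
    | snk =>
      refine Or.inr ?_
      simp only [lenRank]
      omega
  | snk =>
    cases u with
    | src => exact absurd rfl hvu
    | mid j d => exact absurd rfl hvu
    | snk => exact Or.inl rfl

omit h in
lemma ev_mul_pathOf (v u : Vtx T.t T.ℓ) : ev T v * pathOf v u = pathOf v u := by
  cases v <;> cases u <;> simp only [pathOf, mul_zero, ev_mul_self]
  · rename_i i d
    have h1 := ev_mul_pp (T := T) i 0 (d + 1)
    rwa [vtx_zero] at h1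
  · rw [← vtx_mid, ev_mul_pp]
  · split_ifs
    · rw [← vtx_mid, ev_mul_pp]
    · rw [mul_zero]

omit h in
lemma pathOf_mul_ev (v u : Vtx T.t T.ℓ) : pathOf v u * ev T u = pathOf v u := by
  cases v <;> cases u <;> simp only [pathOf, zero_mul, ev_mul_self]
  · rw [← vtx_mid, pp_mul_ev]
  · rename_i i c
    have h1 := pp_mul_ev (T := T) i (c + 1) (T.ℓ i)
    rwa [vtx_len _ (T.hℓ _)] at h1
  · split_ifs with h
    · subst h
      rw [← vtx_mid, pp_mul_ev]
    · rw [zero_mul]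

lemma OneRel.isTilted (hm : mDim T = 0) : IsTilted k (Alg T) := by
  have : Nonempty (Fin T.t) := ⟨someBr T⟩
  have : Nonempty (Vtx T.t T.ℓ) := ⟨.src⟩
  refine ThinFamily.isTilted h.rigid h.composable h.acyclic pathOf (fun _ _ => h.le_iff.symm)
    (fun v u x hvu hux => pathOf_mul hm (h.le_iff.1 hvu) (h.le_iff.1 hux)) ?_ ?_
  · intro v u u' x hne
    rw [← pathOf_mul_ev, ← ev_mul_pathOf u' x, mul_assoc, ← mul_assoc (ev T u),
      ev_mul_of_ne hne, zero_mul, mul_zero]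
  · intro x
    choose c hc using fun v u => corner hm v u x
    refine ⟨c, ?_⟩
    simp only [← hc, ← Finset.mul_sum, sum_ev, mul_one, ← Finset.sum_mul, one_mul]

end TiltingFamily

/-- For a non simply connected toupie algebra with
`dim_k e₀ A e∞ = 0`, the following are equivalent: (a) `A` is tilted; (b) `A` is
quasitilted; (c) there is exactly one relation on each branch of `Q`. -/
theorem tilted_iff_quasitilted_iff_exactlyOneRel {k : Type u} [Field k]
    (T : ToupieAlg k) (hnsc : ¬ SimplyConnected T) (hm : mDim T = 0) :
    (IsTilted k (Alg T) ↔ Quasitilted (Alg T)ᵐᵒᵖ) ∧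
      (Quasitilted (Alg T)ᵐᵒᵖ ↔ ∀ i : Fin T.t, ExactlyOneRel T i) := by
  have hct : (∀ i, ExactlyOneRel T i) → IsTilted k (Alg T) := fun h => by
    obtain ⟨a, b, hab⟩ := exists_oneRel h
    exact hab.isTilted hm
  have hcq : (∀ i, ExactlyOneRel T i) → Quasitilted (Alg T)ᵐᵒᵖ := fun h => by
    obtain ⟨a, b, hab⟩ := exists_oneRel h
    exact hab.quasitilted hm
  exact ⟨⟨fun h => hcq (exactlyOneRel_of_isTilted hm h),
    fun h => hct (exactlyOneRel_of_quasitilted hm h)⟩,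
    ⟨exactlyOneRel_of_quasitilted hm, hcq⟩⟩

end Toupie
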